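/- arXiv:2507.02451 — 10 statements merged into one kernel-verified Lean document; each statement's English description precedes it below -/
import Mathlib

section
/- Let K ⊆ ℝ² be a compact, connected set with H¹(K) < ∞. Then for all x, y ∈ K, the geodesic distance satisfies d_K(x,y) ≤ H¹(K). -/
open MeasureTheory Set
open scoped ENNReal NNReal

abbrev Plane := EuclideanSpace ℝ (Fin 2)

/-- Geodesic distance in `K`: infimum of lengths `∫₀¹ ‖γ'(t)‖ dt` over Lipschitz curves
`γ : [0,1] → K` with `γ 0 = x`, `γ 1 = y`; equals `⊤` if no such curve exists. -/
noncomputable def dK (K : Set Plane) (x y : Plane) : ℝ≥0∞ :=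
  ⨅ (γ : ℝ → Plane) (_ : ∃ C : ℝ≥0, LipschitzOnWith C γ (Icc 0 1))
    (_ : MapsTo γ (Icc 0 1) K) (_ : γ 0 = x) (_ : γ 1 = y),
    ENNReal.ofReal (∫ t in Icc (0:ℝ) 1, ‖derivWithin γ (Icc 0 1) t‖)

section CoarsePath

variable {X : Type*} [MetricSpace X] {K : Set X} {δ ℓ : ℝ} {a b c x y : X}

/-- A map `f : ℝ → K` from `a` (at time `0`) to `b` (from time `ℓ` on) which is `1`-Lipschitz
up to an additive error `δ`. -/
structure IsCoarsePath (K : Set X) (δ : ℝ) (a b : X) (ℓ : ℝ) (f : ℝ → X) : Prop where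
  length_nonneg : 0 ≤ ℓ
  mem : ∀ t, f t ∈ K
  start : f 0 = a
  eq_of_le : ∀ t, ℓ ≤ t → f t = b
  dist_le : ∀ s t, s ≤ t → dist (f s) (f t) ≤ t - s + δ

theorem isCoarsePath_const (hδ : 0 ≤ δ) (ha : a ∈ K) : IsCoarsePath K δ a a 0 fun _ => a where
  length_nonneg := le_rfl
  mem _ := ha
  start := rfl
  eq_of_le _ _ := rfl
  dist_le s t h := by rw [dist_self]; linarith

/-- A coarse path can be prolonged by a jump of size at most `δ`. -/
theorem IsCoarsePath.snoc {f : ℝ → X} (hf : IsCoarsePath K δ a b ℓ f) (hc : c ∈ K) {d : ℝ}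
    (hbc : dist b c ≤ d) (hd : d ≤ δ) :
    IsCoarsePath K δ a c (ℓ + d) fun t => if t < ℓ + d then f t else c := by
  have hd0 : 0 ≤ d := dist_nonneg.trans hbc
  have hℓ := hf.length_nonneg
  refine ⟨by linarith, fun t => ?_, ?_, fun t ht => if_neg ht.not_gt, fun s t hst => ?_⟩
  · split_ifs
    exacts [hf.mem t, hc]
  · split_ifs with h
    · exact hf.start
    · have hd' : d = 0 := by linarith
      have hℓ' : ℓ = 0 := by linarith
      have hbc' : b = c := dist_le_zero.1 (hbc.trans hd'.le)
      rw [← hbc', ← hf.start, hf.eq_of_le 0 hℓ'.le]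
  · by_cases ht : t < ℓ + d
    · rw [if_pos ht, if_pos (hst.trans_lt ht)]
      exact hf.dist_le s t hst
    · rw [if_neg ht]
      split_ifs with hs
      · have htri := dist_triangle (f s) b c
        rcases le_total s ℓ with h | h
        · have := hf.dist_le s ℓ h
          rw [hf.eq_of_le ℓ le_rfl] at this
          linarith
        · rw [hf.eq_of_le s h]
          linarith
      · rw [dist_self]
        linarith

/-- The graph recording which members of a family of sets intersect inside `K`. -/
def intersectionGraph {ι : Type*} (K : Set X) (U : ι → Set X) : SimpleGraph ι where
  Adj i j := i ≠ j ∧ (K ∩ (U i ∩ U j)).Nonempty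
  symm := ⟨fun i j h => ⟨h.1.symm, by rw [inter_comm (U j)]; exact h.2⟩⟩
  loopless := ⟨fun _ h => h.1 rfl⟩

theorem exists_isCoarsePath_of_walk {ι : Type*} {U : ι → Set X} {i j : ι}
    (hb : ∀ i, Bornology.IsBounded (U i)) (hd : ∀ i, Metric.diam (U i) ≤ δ)
    (w : (intersectionGraph K U).Walk i j) (hx : x ∈ K ∩ U i) (hy : y ∈ K ∩ U j) :
    ∃ f, IsCoarsePath K δ y x (w.support.map fun k => Metric.diam (U k)).sum f := by
  induction w generalizing x with
  | @nil i =>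
    have h := (isCoarsePath_const (Metric.diam_nonneg.trans (hd i)) hy.1).snoc hx.1
      (Metric.dist_le_diam_of_mem (hb i) hy.2 hx.2) (hd i)
    exact ⟨_, by simpa only [SimpleGraph.Walk.support_nil, List.map_singleton,
      List.sum_singleton, zero_add] using h⟩
  | @cons i k j h w ih =>
    obtain ⟨p, hpK, hpi, hpk⟩ := h.2
    obtain ⟨f, hf⟩ := ih ⟨hpK, hpk⟩ hy
    have := hf.snoc hx.1 (Metric.dist_le_diam_of_mem (hb i) hpi hx.2) (hd i)
    rw [SimpleGraph.Walk.support_cons, List.map_cons, List.sum_cons, add_comm]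
    exact ⟨_, this⟩

theorem IsPreconnected.reachable_intersectionGraph {ι : Type*} {U : ι → Set X}
    (hK : IsPreconnected K) (hU : ∀ i, IsOpen (U i)) (hKU : K ⊆ ⋃ i, U i) {i j : ι}
    (hx : x ∈ K ∩ U i) (hy : y ∈ K ∩ U j) : (intersectionGraph K U).Reachable i j := by
  by_contra hij
  obtain ⟨z, hzK, hz₁, hz₂⟩ := hK
    (⋃ k ∈ {k | (intersectionGraph K U).Reachable i k}, U k)
    (⋃ k ∈ {k | ¬ (intersectionGraph K U).Reachable i k}, U k)
    (isOpen_biUnion fun k _ => hU k) (isOpen_biUnion fun k _ => hU k)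
    (fun z hz => by
      obtain ⟨k, hk⟩ := mem_iUnion.1 (hKU hz)
      by_cases h : (intersectionGraph K U).Reachable i k
      · exact Or.inl (mem_biUnion h hk)
      · exact Or.inr (mem_biUnion h hk))
    ⟨x, hx.1, mem_biUnion (SimpleGraph.Reachable.refl i) hx.2⟩
    ⟨y, hy.1, mem_biUnion hij hy.2⟩
  obtain ⟨k, hk, hzk⟩ := mem_iUnion₂.1 hz₁
  obtain ⟨l, hl, hzl⟩ := mem_iUnion₂.1 hz₂
  have hkl : k ≠ l := by
    rintro rfl
    exact hl hk
  exact hl (hk.trans (SimpleGraph.Adj.reachable ⟨hkl, z, hzK, hzk, hzl⟩))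

theorem IsPreconnected.exists_isCoarsePath_of_cover {ι : Type*} [Fintype ι] {U : ι → Set X}
    (hK : IsPreconnected K) (hU : ∀ i, IsOpen (U i)) (hKU : K ⊆ ⋃ i, U i)
    (hb : ∀ i, Bornology.IsBounded (U i)) (hd : ∀ i, Metric.diam (U i) ≤ δ)
    (hx : x ∈ K) (hy : y ∈ K) :
    ∃ ℓ ≤ ∑ i, Metric.diam (U i), ∃ f, IsCoarsePath K δ x y ℓ f := by
  classical
  obtain ⟨i, hi⟩ := mem_iUnion.1 (hKU hx)
  obtain ⟨j, hj⟩ := mem_iUnion.1 (hKU hy)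
  obtain ⟨w, hw⟩ :=
    (hK.reachable_intersectionGraph hU hKU ⟨hy, hj⟩ ⟨hx, hi⟩).exists_isPath
  refine ⟨_, ?_, exists_isCoarsePath_of_walk hb hd w ⟨hy, hj⟩ ⟨hx, hi⟩⟩
  rw [← List.sum_toFinset _ hw.support_nodup]
  exact Finset.sum_le_sum_of_subset_of_nonneg (Finset.subset_univ _)
    fun _ _ _ => Metric.diam_nonneg

/-- A limit of coarse paths with errors tending to `0` is a `1`-Lipschitz path. -/
theorem IsCompact.exists_lipschitzWith_one_of_isCoarsePath (hK : IsCompact K) {L : ℝ}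
    (h : ∀ ε > 0, ∃ ℓ ≤ L + ε, ∃ f, IsCoarsePath K ε x y ℓ f) :
    ∃ g : ℝ → X, LipschitzWith 1 g ∧ (∀ t, g t ∈ K) ∧ g 0 = x ∧ g L = y := by
  choose ℓ hℓ f hf using fun n : ℕ => h (1 / ((n : ℝ) + 1)) Nat.one_div_pos_of_nat
  have hlim (t : ℝ) : ∃ p ∈ K,
      Filter.Tendsto (fun n => f n t) (Filter.hyperfilter ℕ : Filter ℕ) (nhds p) :=
    hK.ultrafilter_le_nhds ((Filter.hyperfilter ℕ).map fun n => f n t)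
      (Filter.tendsto_principal.2 (Filter.Eventually.of_forall fun n => (hf n).mem t))
  choose g hgK hg using hlim
  have hzero : Filter.Tendsto (fun n : ℕ => 1 / ((n : ℝ) + 1))
      (Filter.hyperfilter ℕ : Filter ℕ) (nhds 0) :=
    tendsto_one_div_add_atTop_nhds_zero_nat.mono_left Nat.hyperfilter_le_atTop
  have hmono (s t : ℝ) (hst : s ≤ t) : dist (g s) (g t) ≤ t - s := by
    refine le_of_tendsto_of_tendsto' ((hg s).dist (hg t)) ?_ fun n => (hf n).dist_le s t hst
    simpa using hzero.const_add (t - s)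
  refine ⟨g, LipschitzWith.of_dist_le_mul fun s t => ?_, hgK, ?_, ?_⟩
  · rw [NNReal.coe_one, one_mul, Real.dist_eq]
    rcases le_total s t with hst | hst
    · rw [abs_sub_comm]
      exact (hmono s t hst).trans (le_abs_self _)
    · rw [dist_comm]
      exact (hmono t s hst).trans (le_abs_self _)
  · refine tendsto_nhds_unique (hg 0) ?_
    simp only [(hf _).start]
    exact tendsto_const_nhds
  · have hdist (n : ℕ) : dist (f n L) y ≤ 1 / ((n : ℝ) + 1) + 1 / ((n : ℝ) + 1) := by
      have hpos : (0 : ℝ) < 1 / ((n : ℝ) + 1) := Nat.one_div_pos_of_nat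
      have := (hf n).dist_le L (L + 1 / ((n : ℝ) + 1)) (by linarith)
      rw [(hf n).eq_of_le _ (hℓ n)] at this
      linarith
    refine dist_le_zero.1 (le_of_tendsto_of_tendsto' ((hg L).dist tendsto_const_nhds) ?_ hdist)
    simpa using hzero.add hzero

end CoarsePath

section Hausdorff

variable {X : Type*} [MetricSpace X] [MeasurableSpace X] [BorelSpace X] {K : Set X}

theorem exists_isOpen_cover_tsum_ediam_le (hfin : μH[1] K < ⊤) {ε : ℝ≥0} (hε : 0 < ε) :
    ∃ U : ℕ → Set X, (∀ n, IsOpen (U n)) ∧ K ⊆ ⋃ n, U n ∧ (∀ n, Metric.ediam (U n) ≤ ε) ∧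
      ∑' n, Metric.ediam (U n) ≤ μH[1] K + ε := by
  have hε2 : (0 : ℝ≥0∞) < ((ε / 2 : ℝ≥0) : ℝ≥0∞) := ENNReal.coe_pos.2 (half_pos hε)
  have hε4 : ((ε / 4 : ℝ≥0) : ℝ≥0∞) ≠ 0 := (ENNReal.coe_pos.2 (by positivity)).ne'
  have hlt : μH[1] K < μH[1] K + (ε / 2 : ℝ≥0) := ENNReal.lt_add_right hfin.ne hε2.ne'
  have hinf := (le_iSup₂ (f := fun (r : ℝ≥0∞) (_ : 0 < r) =>
    ⨅ (t : ℕ → Set X) (_ : K ⊆ ⋃ n, t n) (_ : ∀ n, Metric.ediam (t n) ≤ r),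
      ∑' n, ⨆ _ : (t n).Nonempty, Metric.ediam (t n) ^ (1 : ℝ)) _ hε2).trans_lt
    ((Measure.hausdorffMeasure_apply 1 K).symm.trans_lt hlt)
  simp only [iInf_lt_iff] at hinf
  obtain ⟨t, htK, htd, hts⟩ := hinf
  obtain ⟨r, hr, hrs⟩ := ENNReal.exists_pos_sum_of_countable hε4 ℕ
  have hsum4 : 2 * ((ε / 4 : ℝ≥0) : ℝ≥0∞) = (ε / 2 : ℝ≥0) := by
    rw [← ENNReal.coe_ofNat, ← ENNReal.coe_mul]
    congr 1
    ring
  have hsum2 : ((ε / 2 : ℝ≥0) : ℝ≥0∞) + (ε / 2 : ℝ≥0) = ε := by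
    rw [← ENNReal.coe_add, add_halves]
  have htsum : ∑' n, Metric.ediam (t n) ≤ μH[1] K + (ε / 2 : ℝ≥0) := by
    refine le_trans (ENNReal.tsum_le_tsum fun n => ?_) hts.le
    rcases (t n).eq_empty_or_nonempty with h | h
    · simp [h]
    · simp [h]
  refine ⟨fun n => Metric.thickening (r n) (t n), fun n => Metric.isOpen_thickening,
    htK.trans (iUnion_mono fun n => Metric.self_subset_thickening (hr n) _), fun n => ?_, ?_⟩
  · calc
      _ ≤ Metric.ediam (t n) + 2 * r n := Metric.ediam_thickening_le _
      _ ≤ (ε / 2 : ℝ≥0) + 2 * (ε / 4 : ℝ≥0) := by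
        gcongr
        · exact htd n
        · exact ENNReal.coe_le_coe.1 ((ENNReal.le_tsum n).trans hrs.le)
      _ = ε := by rw [hsum4, hsum2]
  · calc
      _ ≤ ∑' n, (Metric.ediam (t n) + 2 * r n) :=
        ENNReal.tsum_le_tsum fun n => Metric.ediam_thickening_le _
      _ = ∑' n, Metric.ediam (t n) + 2 * ∑' n, (r n : ℝ≥0∞) := by
        rw [ENNReal.tsum_add, ENNReal.tsum_mul_left]
      _ ≤ μH[1] K + (ε / 2 : ℝ≥0) + 2 * (ε / 4 : ℝ≥0) := by gcongr
      _ = μH[1] K + ε := by rw [hsum4, add_assoc, hsum2]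

/-- Any two points of a continuum of finite `1`-dimensional Hausdorff measure `L` are joined by
a `1`-Lipschitz path of duration `L` inside the continuum. -/
theorem IsCompact.exists_lipschitzWith_one_path (hc : IsCompact K) (hconn : IsPreconnected K)
    (hfin : μH[1] K < ⊤) {x y : X} (hx : x ∈ K) (hy : y ∈ K) :
    ∃ g : ℝ → X, LipschitzWith 1 g ∧ (∀ t, g t ∈ K) ∧ g 0 = x ∧ g (μH[1] K).toReal = y := by
  refine hc.exists_lipschitzWith_one_of_isCoarsePath fun ε hε => ?_
  lift ε to ℝ≥0 using hε.le
  obtain ⟨U, hU, hKU, hd, hs⟩ := exists_isOpen_cover_tsum_ediam_le hfin (NNReal.coe_pos.1 hε)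
  obtain ⟨I, hI⟩ := hc.elim_finite_subcover U hU hKU
  have htop (n : ℕ) : Metric.ediam (U n) ≠ ⊤ := ((hd n).trans_lt ENNReal.coe_lt_top).ne
  obtain ⟨ℓ, hℓ, f, hf⟩ := hconn.exists_isCoarsePath_of_cover (U := fun i : I => U i) (δ := ε)
    (fun i => hU i) (by simpa only [iUnion_subtype] using hI)
    (fun i => Metric.isBounded_iff_ediam_ne_top.2 (htop i))
    (fun i => ENNReal.toReal_le_coe_of_le_coe (hd i)) hx hy
  refine ⟨ℓ, hℓ.trans ?_, f, hf⟩
  rw [Finset.sum_coe_sort I fun i => Metric.diam (U i)]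
  simp only [Metric.diam]
  rw [← ENNReal.toReal_sum fun i _ => htop i, ← ENNReal.coe_toReal ε,
    ← ENNReal.toReal_add hfin.ne ENNReal.coe_ne_top]
  exact ENNReal.toReal_mono (by finiteness) ((ENNReal.sum_le_tsum I).trans hs)

end Hausdorff

theorem stmt1 (K : Set Plane) (hc : IsCompact K) (hconn : IsConnected K)
    (hfin : μH[1] K < ⊤) :
    ∀ x ∈ K, ∀ y ∈ K, dK K x y ≤ μH[1] K := by
  intro x hx y hy
  obtain ⟨g, hg, hgK, hg0, hg1⟩ :=
    hc.exists_lipschitzWith_one_path hconn.isPreconnected hfin hx hy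
  set L : ℝ≥0 := (μH[1] K).toNNReal
  have hlip : LipschitzWith L fun t => g (L * t) := by
    refine LipschitzWith.of_dist_le_mul fun s t => (hg.dist_le_mul _ _).trans_eq ?_
    rw [NNReal.coe_one, one_mul, Real.dist_eq, Real.dist_eq, ← mul_sub, abs_mul, NNReal.abs_eq]
  refine (iInf₂_le (fun t => g (L * t)) ⟨L, hlip.lipschitzOnWith⟩).trans
    ((iInf₂_le (fun t _ => hgK _) (by simpa using hg0)).trans
      ((iInf_le _ ((congrArg g (mul_one _)).trans hg1)).trans ?_))
  refine ENNReal.ofReal_le_of_le_toReal ?_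
  rw [integral_Icc_eq_integral_Ioo]
  refine (le_abs_self _).trans ?_
  have hbound := norm_setIntegral_le_of_norm_le_const (μ := volume) (s := Ioo (0 : ℝ) 1)
    (f := fun t => ‖derivWithin (fun t => g (L * t)) (Icc 0 1) t‖) (C := L)
    measure_Ioo_lt_top fun t ht => by
      rw [norm_norm, derivWithin_of_mem_nhds (Icc_mem_nhds ht.1 ht.2)]
      exact norm_deriv_le_of_lipschitz hlip
  change _ ≤ (L : ℝ)
  simpa using hbound
end

section
/- Let K ⊆ ℝ² be a compact, connected set with H¹(K) < ∞, and let u : ℝ² → ℝ be continuously differentiable. Then for all x, y ∈ K, |u(x) − u(y)|² ≤ d_K(x,y) · ∫_K ‖∇u(z)‖² dH¹(z). -/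
open MeasureTheory Set
open scoped ENNReal NNReal

section Curves

variable {E : Type*} [NormedAddCommGroup E] [InnerProductSpace ℝ E] [FiniteDimensional ℝ E]
  {γ : ℝ → E} {C : ℝ≥0} {a b : ℝ}

/-- The speed of a Lipschitz curve is integrable. -/
theorem LipschitzOnWith.integrableOn_norm_deriv (hγ : LipschitzOnWith C γ (Icc a b)) :
    IntegrableOn (fun t => ‖deriv γ t‖) (Ioo a b) := by
  refine Measure.integrableOn_of_bounded (M := C) (by simp)
    (aestronglyMeasurable_deriv γ _).norm ?_
  filter_upwards [ae_restrict_mem measurableSet_Ioo] with t ht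
  rw [norm_norm]
  exact norm_deriv_le_of_lipschitzOn (Icc_mem_nhds ht.1 ht.2) hγ

/-- The chord of a Lipschitz curve is at most the integral of its speed. -/
theorem LipschitzOnWith.dist_le_integral_norm_deriv (hγ : LipschitzOnWith C γ (Icc a b))
    (hab : a ≤ b) : dist (γ a) (γ b) ≤ ∫ t in a..b, ‖deriv γ t‖ := by
  set e := γ b - γ a with he
  have hint : IntervalIntegrable (fun t => ‖deriv γ t‖) volume a b :=
    (intervalIntegrable_iff_integrableOn_Ioo_of_le hab).2 hγ.integrableOn_norm_deriv
  have hlip : LipschitzOnWith (‖innerSL ℝ e‖₊ * C) (fun t => inner ℝ e (γ t)) (uIcc a b) := by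
    rw [uIcc_of_le hab]
    exact (innerSL ℝ e).lipschitz.comp_lipschitzOnWith hγ
  have hac := hlip.absolutelyContinuousOnInterval
  have hdiff : ∀ᵐ t, t ∈ Icc a b → DifferentiableWithinAt ℝ γ (Icc a b) t :=
    hγ.ae_differentiableWithinAt_of_mem
  have hle : ∫ t in a..b, deriv (fun t => inner ℝ e (γ t)) t ≤
      ∫ t in a..b, ‖e‖ * ‖deriv γ t‖ := by
    refine intervalIntegral.integral_mono_ae_restrict hab hac.intervalIntegrable_deriv
      (hint.const_mul _) ?_
    rw [← Measure.restrict_congr_set Ioo_ae_eq_Icc]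
    filter_upwards [ae_restrict_mem measurableSet_Ioo, ae_restrict_of_ae hdiff] with t ht hd
    have hderiv := ((hd (Ioo_subset_Icc_self ht)).differentiableAt
      (Icc_mem_nhds ht.1 ht.2)).hasDerivAt
    have h : HasDerivAt (fun t => inner ℝ e (γ t)) (inner ℝ e (deriv γ t)) t :=
      (innerSL ℝ e).hasFDerivAt.comp_hasDerivAt t hderiv
    rw [h.deriv]
    exact real_inner_le_norm _ _
  rw [hac.integral_deriv_eq_sub, ← inner_sub_right, real_inner_self_eq_norm_mul_norm,
    intervalIntegral.integral_const_mul] at hle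
  rw [dist_comm, dist_eq_norm, ← he]
  rcases (norm_nonneg e).eq_or_lt with h | h
  · rw [← h]
    exact intervalIntegral.integral_nonneg hab fun _ _ => norm_nonneg _
  · exact le_of_mul_le_mul_left hle h

/-- The trace of a Lipschitz curve has one-dimensional measure at most its length. -/
theorem LipschitzOnWith.hausdorffMeasure_image_Icc_le [MeasurableSpace E] [BorelSpace E]
    (hγ : LipschitzOnWith C γ (Icc a b)) (hab : a ≤ b) :
    μH[1] (γ '' Icc a b) ≤ ENNReal.ofReal (∫ t in a..b, ‖deriv γ t‖) := by
  have hint : IntervalIntegrable (fun t => ‖deriv γ t‖) volume a b :=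
    (intervalIntegrable_iff_integrableOn_Ioo_of_le hab).2 hγ.integrableOn_norm_deriv
  set ℓ : ℝ → ℝ := fun t => ∫ s in a..t, ‖deriv γ s‖ with hℓ
  have hsub : ∀ s ∈ Icc a b, ∀ t ∈ Icc a b, s ≤ t →
      ℓ t - ℓ s = ∫ r in s..t, ‖deriv γ r‖ := fun s hs t ht hst => by
    have hI : ∀ r ∈ Icc a b, IntervalIntegrable (fun t => ‖deriv γ t‖) volume a r :=
      fun r hr => hint.mono_set (by
        rw [uIcc_of_le hab, uIcc_of_le hr.1]; exact Icc_subset_Icc_right hr.2)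
    rw [hℓ, intervalIntegral.integral_interval_sub_left (hI t ht) (hI s hs)]
  have hmono : MonotoneOn ℓ (Icc a b) := fun s hs t ht hst => by
    rw [← sub_nonneg, hsub s hs t ht hst]
    exact intervalIntegral.integral_nonneg hst fun _ _ => norm_nonneg _
  have hdist : ∀ s ∈ Icc a b, ∀ t ∈ Icc a b, dist (γ s) (γ t) ≤ dist (ℓ s) (ℓ t) := by
    have key : ∀ s ∈ Icc a b, ∀ t ∈ Icc a b, s ≤ t →
        dist (γ s) (γ t) ≤ dist (ℓ s) (ℓ t) := fun s hs t ht hst => by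
      have := (hγ.mono (Icc_subset_Icc hs.1 ht.2)).dist_le_integral_norm_deriv hst
      rw [← hsub s hs t ht hst] at this
      rw [dist_comm (ℓ s)]
      exact this.trans (le_abs_self _)
    intro s hs t ht
    rcases le_total s t with h | h
    · exact key s hs t ht h
    · rw [dist_comm, dist_comm (ℓ s)]
      exact key t ht s hs h
  set r := Function.invFunOn ℓ (Icc a b)
  have hr : ∀ y ∈ ℓ '' Icc a b, r y ∈ Icc a b ∧ ℓ (r y) = y := fun y hy =>
    Function.invFunOn_pos hy
  have hg : LipschitzOnWith 1 (γ ∘ r) (ℓ '' Icc a b) := by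
    refine LipschitzOnWith.of_dist_le_mul fun y hy z hz => ?_
    have := hdist _ (hr y hy).1 _ (hr z hz).1
    rwa [(hr y hy).2, (hr z hz).2, ← one_mul (dist y z)] at this
  have hcover : γ '' Icc a b ⊆ (γ ∘ r) '' (ℓ '' Icc a b) := by
    rintro _ ⟨t, ht, rfl⟩
    refine ⟨ℓ t, mem_image_of_mem _ ht, ?_⟩
    have h := hr _ (mem_image_of_mem ℓ ht)
    have := hdist _ h.1 t ht
    rw [h.2, dist_self] at this
    exact dist_le_zero.1 this
  have hrange : ℓ '' Icc a b ⊆ Icc 0 (ℓ b) := by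
    rintro _ ⟨t, ht, rfl⟩
    have h0 : ℓ a = 0 := intervalIntegral.integral_same
    exact ⟨h0 ▸ hmono (left_mem_Icc.2 hab) ht ht.1, hmono ht (right_mem_Icc.2 hab) ht.2⟩
  calc μH[1] (γ '' Icc a b) ≤ μH[1] ((γ ∘ r) '' (ℓ '' Icc a b)) := measure_mono hcover
    _ ≤ μH[1] (ℓ '' Icc a b) := by simpa using hg.hausdorffMeasure_image_le zero_le_one
    _ ≤ μH[1] (Icc 0 (ℓ b)) := measure_mono hrange
    _ = ENNReal.ofReal (ℓ b) := by rw [hausdorffMeasure_real, Real.volume_Icc, sub_zero]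

end Curves

section Functions

variable {E : Type*} [NormedAddCommGroup E] [NormedSpace ℝ E] [MeasurableSpace E] [BorelSpace E]
  {u : E → ℝ} {S : Set E}

/-- One-dimensional area inequality up to an error proportional to the measure of the set. -/
theorem IsCompact.volume_image_le_lintegral_add (hS : IsCompact S) (hu : ContDiff ℝ 1 u)
    {ε : ℝ≥0} (hε : 0 < ε) :
    volume (u '' S) ≤ ∫⁻ z in S, (‖fderiv ℝ u z‖ₑ + ε) ∂μH[1] := by
  suffices h : ∃ T, MeasurableSet T ∧ S ⊆ T ∧ ∀ A ⊆ T, MeasurableSet A →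
      volume (u '' A) ≤ ∫⁻ z in A, (‖fderiv ℝ u z‖ₑ + ε) ∂μH[1] by
    obtain ⟨T, -, hST, hT⟩ := h
    exact hT S hST hS.measurableSet
  refine hS.induction_on ⟨∅, .empty, Subset.rfl, ?_⟩ ?_ ?_ ?_
  · intro A hA _
    simp [subset_empty_iff.1 hA]
  · rintro s t hst ⟨T, hTm, hT, h⟩
    exact ⟨T, hTm, hst.trans hT, h⟩
  · rintro s t ⟨T₁, hm₁, hs, h₁⟩ ⟨T₂, hm₂, ht, h₂⟩
    refine ⟨T₁ ∪ T₂, hm₁.union hm₂, union_subset_union hs ht, fun A hA hAm => ?_⟩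
    calc volume (u '' A) = volume (u '' (A ∩ T₁) ∪ u '' (A \ T₁)) := by
          rw [← image_union, inter_union_sdiff]
      _ ≤ volume (u '' (A ∩ T₁)) + volume (u '' (A \ T₁)) := measure_union_le _ _
      _ ≤ _ := add_le_add (h₁ _ inter_subset_right (hAm.inter hm₁))
          (h₂ _ (sdiff_subset_iff.2 hA) (hAm.diff hm₁))
      _ = _ := lintegral_inter_add_sdiff _ _ hm₁
  · intro x _
    have hcont : Continuous fun z => ‖fderiv ℝ u z‖₊ := (hu.continuous_fderiv one_ne_zero).nnnorm
    obtain ⟨δ, hδ, hball⟩ := Metric.continuousAt_iff.1 hcont.continuousAt (ε / 2)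
      (by positivity : (0 : ℝ) < ε / 2)
    have hbd : ∀ z ∈ Metric.ball x δ, ‖fderiv ℝ u z‖₊ ≤ ‖fderiv ℝ u x‖₊ + ε / 2 ∧
        ‖fderiv ℝ u x‖₊ + ε / 2 ≤ ‖fderiv ℝ u z‖₊ + ε := fun z hz => by
      have h := abs_lt.1 (Real.dist_eq _ _ ▸ hball hz : |‖fderiv ℝ u z‖ - ‖fderiv ℝ u x‖| < ε / 2)
      constructor <;> rw [← NNReal.coe_le_coe] <;> push_cast <;> linarith
    have hlip : LipschitzOnWith (‖fderiv ℝ u x‖₊ + ε / 2) u (Metric.ball x δ) :=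
      (convex_ball x δ).lipschitzOnWith_of_nnnorm_fderiv_le
        (fun z _ => hu.differentiable one_ne_zero z) fun z hz => (hbd z hz).1
    refine ⟨_, mem_nhdsWithin_of_mem_nhds (Metric.ball_mem_nhds x hδ), Metric.ball x δ,
      measurableSet_ball, Subset.rfl, fun A hA hAm => ?_⟩
    rw [← hausdorffMeasure_real]
    calc μH[1] (u '' A) ≤ ↑(‖fderiv ℝ u x‖₊ + ε / 2) * μH[1] A := by
          simpa using (hlip.mono hA).hausdorffMeasure_image_le zero_le_one
      _ = ∫⁻ _ in A, ↑(‖fderiv ℝ u x‖₊ + ε / 2) ∂μH[1] := by rw [setLIntegral_const]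
      _ ≤ _ := setLIntegral_mono' hAm fun z hz => by
          rw [enorm_eq_nnnorm]
          exact_mod_cast (hbd z (hA hz)).2

/-- One-dimensional area inequality. -/
theorem IsCompact.volume_image_le_lintegral_enorm_fderiv (hS : IsCompact S) (hfin : μH[1] S ≠ ⊤)
    (hu : ContDiff ℝ 1 u) :
    volume (u '' S) ≤ ∫⁻ z in S, ‖fderiv ℝ u z‖ₑ ∂μH[1] := by
  refine ENNReal.le_of_forall_pos_le_add fun ε hε _ => ?_
  have hM : 0 < (μH[1] S).toNNReal + 1 := by positivity
  refine (hS.volume_image_le_lintegral_add hu (div_pos hε hM)).trans ?_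
  rw [lintegral_add_right _ measurable_const, setLIntegral_const]
  gcongr
  rw [← ENNReal.coe_toNNReal hfin]
  norm_cast
  rw [div_mul_eq_mul_div, div_le_iff₀ hM]
  gcongr
  exact le_self_add

/-- Cauchy–Schwarz estimate for the oscillation of a `C¹` function on a continuum. -/
theorem IsCompact.ofReal_sq_abs_sub_le (hS : IsCompact S) (hconn : IsPreconnected S)
    (hfin : μH[1] S ≠ ⊤) (hu : ContDiff ℝ 1 u) {x y : E} (hx : x ∈ S) (hy : y ∈ S) :
    ENNReal.ofReal (|u x - u y| ^ 2) ≤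
      μH[1] S * ∫⁻ z in S, ‖fderiv ℝ u z‖ₑ ^ 2 ∂μH[1] := by
  have hvol : ENNReal.ofReal |u x - u y| ≤ volume (u '' S) := by
    rw [abs_sub_comm, ← Real.volume_interval]
    exact measure_mono ((hconn.image u hu.continuous.continuousOn).ordConnected.uIcc_subset
      (mem_image_of_mem u hx) (mem_image_of_mem u hy))
  have hmeas : AEMeasurable (fun z => ‖fderiv ℝ u z‖ₑ) (μH[1].restrict S) :=
    (hu.continuous_fderiv one_ne_zero).enorm.aemeasurable
  have hCS := ENNReal.lintegral_mul_le_Lp_mul_Lq (μH[1].restrict S) Real.HolderConjugate.two_two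
    (aemeasurable_const (b := (1 : ℝ≥0∞))) hmeas
  simp only [Pi.mul_apply, one_mul, ENNReal.rpow_ofNat, one_pow, lintegral_one,
    Measure.restrict_apply_univ] at hCS
  have h := (hvol.trans (hS.volume_image_le_lintegral_enorm_fderiv hfin hu)).trans hCS
  rw [ENNReal.ofReal_pow (abs_nonneg _)]
  calc _ ≤ _ := pow_le_pow_left' h 2
    _ = _ := by
      simp only [mul_pow, ← ENNReal.rpow_mul_natCast]
      norm_num

end Functions

theorem stmt2 (K : Set Plane) (hc : IsCompact K) (hconn : IsConnected K)
    (hfin : μH[1] K < ⊤) (u : Plane → ℝ) (hu : ContDiff ℝ 1 u) :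
    ∀ x ∈ K, ∀ y ∈ K,
      ENNReal.ofReal (|u x - u y| ^ 2) ≤
        dK K x y * ENNReal.ofReal (∫ z in K, ‖gradient u z‖ ^ 2 ∂μH[1]) := by
  intro x hx y hy
  have hcont : Continuous fun z => ‖gradient u z‖ ^ 2 := by
    simp only [gradient, LinearIsometryEquiv.norm_map]
    exact (hu.continuous_fderiv one_ne_zero).norm.pow 2
  have : IsFiniteMeasure ((μH[1] : Measure Plane).restrict K) :=
    isFiniteMeasure_restrict.2 hfin.ne
  have hint : IntegrableOn (fun z => ‖gradient u z‖ ^ 2) K μH[1] := by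
    obtain ⟨M, hM⟩ := hc.exists_bound_of_continuousOn hcont.continuousOn
    exact Measure.integrableOn_of_bounded hfin.ne hcont.aestronglyMeasurable
      ((ae_restrict_mem hc.measurableSet).mono hM)
  have henergy : ENNReal.ofReal (∫ z in K, ‖gradient u z‖ ^ 2 ∂μH[1]) =
      ∫⁻ z in K, ‖fderiv ℝ u z‖ₑ ^ 2 ∂μH[1] := by
    rw [ofReal_integral_eq_lintegral_ofReal hint (ae_of_all _ fun _ => sq_nonneg _)]
    simp only [gradient, LinearIsometryEquiv.norm_map, ENNReal.ofReal_pow (norm_nonneg _),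
      ofReal_norm]
  have htop : ∫⁻ z in K, ‖fderiv ℝ u z‖ₑ ^ 2 ∂μH[1] ≠ ⊤ := henergy ▸ ENNReal.ofReal_ne_top
  rw [henergy]
  rcases eq_or_ne (∫⁻ z in K, ‖fderiv ℝ u z‖ₑ ^ 2 ∂μH[1]) 0 with h0 | h0
  · have := hc.ofReal_sq_abs_sub_le hconn.isPreconnected hfin.ne hu hx hy
    rw [h0, mul_zero] at this ⊢
    exact this
  rw [← ENNReal.div_le_iff h0 htop]
  refine le_iInf fun γ => le_iInf fun ⟨C, hγ⟩ => le_iInf fun hK => le_iInf fun h0x =>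
    le_iInf fun h1y => ?_
  rw [ENNReal.div_le_iff h0 htop]
  have hsub : γ '' Icc 0 1 ⊆ K := hK.image_subset
  have hlen : ∫ t in Icc (0 : ℝ) 1, ‖derivWithin γ (Icc 0 1) t‖ =
      ∫ t in (0 : ℝ)..1, ‖deriv γ t‖ := by
    rw [intervalIntegral.integral_of_le zero_le_one, integral_Icc_eq_integral_Ioo,
      integral_Ioc_eq_integral_Ioo]
    refine setIntegral_congr_fun measurableSet_Ioo fun t ht => ?_
    simp only [derivWithin_of_mem_nhds (Icc_mem_nhds ht.1 ht.2)]
  calc _ ≤ μH[1] (γ '' Icc 0 1) * ∫⁻ z in γ '' Icc 0 1, ‖fderiv ℝ u z‖ₑ ^ 2 ∂μH[1] :=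
        (isCompact_Icc.image_of_continuousOn hγ.continuousOn).ofReal_sq_abs_sub_le
          (isPreconnected_Icc.image γ hγ.continuousOn)
          ((measure_mono hsub).trans_lt hfin).ne hu
          ⟨0, by simp, h0x⟩ ⟨1, by simp, h1y⟩
    _ ≤ _ := by
      rw [hlen]
      exact mul_le_mul' (hγ.hausdorffMeasure_image_Icc_le zero_le_one)
        (lintegral_mono_set hsub)
end

section
/- Let K ⊆ ℝ² be a compact, connected set with 0 < H¹(K) < ∞, and let u : ℝ² → ℝ be continuously differentiable. Then for every x ∈ K, |u(x)| ≤ H¹(K)^{-1/2} · (∫_K u(z)² dH¹(z))^{1/2} + H¹(K)^{1/2} · (∫_K ‖∇u(z)‖² dH¹(z))^{1/2}. -/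
open MeasureTheory Set
open scoped ENNReal NNReal

/-- A `C¹` function is, near every point, Lipschitz with a constant comparable to its derivative, so
the Hausdorff measure of the image of a small set is controlled by the integral of the derivative. -/
theorem exists_nhds_volume_image_le {E : Type*} [NormedAddCommGroup E] [NormedSpace ℝ E]
    [MeasurableSpace E] [BorelSpace E] {f : E → ℝ} (hf : ContDiff ℝ 1 f) {ε : ℝ≥0} (hε : 0 < ε)
    (x : E) : ∃ U : Set E, IsOpen U ∧ x ∈ U ∧ ∀ T ⊆ U, MeasurableSet T →
      volume (f '' T) ≤ ∫⁻ z in T, (‖fderiv ℝ f z‖ₑ + ε) ∂μH[1] := by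
  have hε' : (0 : ℝ) < ε / 2 := by positivity
  obtain ⟨r, hr, hball⟩ := Metric.continuousAt_iff.1
    (hf.continuous_fderiv one_ne_zero).continuousAt (ε / 2) hε'
  refine ⟨Metric.ball x r, Metric.isOpen_ball, Metric.mem_ball_self hr, fun T hT hTm => ?_⟩
  have hnorm : ∀ z ∈ Metric.ball x r, ‖fderiv ℝ f z - fderiv ℝ f x‖ < ε / 2 := fun z hz => by
    simpa [dist_eq_norm] using hball hz
  have hlip : LipschitzOnWith (‖fderiv ℝ f x‖₊ + ε / 2) f (Metric.ball x r) := by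
    refine (convex_ball x r).lipschitzOnWith_of_nnnorm_fderiv_le (𝕜 := ℝ)
      (fun z _ => hf.differentiable one_ne_zero z) fun z hz => ?_
    rw [← NNReal.coe_le_coe]
    push_cast
    have h₁ := norm_le_norm_add_norm_sub' (fderiv ℝ f z) (fderiv ℝ f x)
    have h₂ := hnorm z hz
    linarith
  have himage := (hlip.mono hT).hausdorffMeasure_image_le zero_le_one
  rw [ENNReal.rpow_one, hausdorffMeasure_real] at himage
  refine himage.trans ?_
  rw [← setLIntegral_const]
  refine setLIntegral_mono' hTm fun z hz => ?_
  rw [enorm_eq_nnnorm, ← ENNReal.coe_add, ENNReal.coe_le_coe, ← NNReal.coe_le_coe]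
  push_cast
  have h₁ := norm_le_norm_add_norm_sub (fderiv ℝ f z) (fderiv ℝ f x)
  have h₂ := hnorm z (hT hz)
  linarith

/-- The area inequality for a real-valued `C¹` function on a compact set of finite `μH[1]` measure. -/
theorem IsCompact.volume_image_le_lintegral_enorm_fderiv_s3 {E : Type*} [NormedAddCommGroup E]
    [NormedSpace ℝ E] [MeasurableSpace E] [BorelSpace E] {f : E → ℝ} (hf : ContDiff ℝ 1 f)
    {K : Set E} (hK : IsCompact K) (hfin : μH[1] K ≠ ⊤) :
    volume (f '' K) ≤ ∫⁻ z in K, ‖fderiv ℝ f z‖ₑ ∂μH[1] := by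
  have key : ∀ ε : ℝ≥0, 0 < ε →
      volume (f '' K) ≤ ∫⁻ z in K, ‖fderiv ℝ f z‖ₑ ∂μH[1] + ε * μH[1] K := by
    intro ε hε
    obtain ⟨S, hKS, -, hS⟩ : ∃ S, K ⊆ S ∧ MeasurableSet S ∧ ∀ T ⊆ S, MeasurableSet T →
        volume (f '' T) ≤ ∫⁻ z in T, (‖fderiv ℝ f z‖ₑ + ε) ∂μH[1] := by
      refine hK.induction_on (p := fun A => ∃ S, A ⊆ S ∧ MeasurableSet S ∧ ∀ T ⊆ S,
        MeasurableSet T → volume (f '' T) ≤ ∫⁻ z in T, (‖fderiv ℝ f z‖ₑ + ε) ∂μH[1]) ?_ ?_ ?_ ?_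
      · refine ⟨∅, Subset.rfl, .empty, fun T hT _ => ?_⟩
        simp [subset_empty_iff.1 hT]
      · rintro A B hAB ⟨S, hBS, hS⟩
        exact ⟨S, hAB.trans hBS, hS⟩
      · rintro A B ⟨S, hAS, hSm, hS⟩ ⟨R, hBR, hRm, hR⟩
        refine ⟨S ∪ R, union_subset_union hAS hBR, hSm.union hRm, fun T hT hTm => ?_⟩
        rw [← lintegral_inter_add_sdiff _ T hSm]
        calc volume (f '' T) = volume (f '' (T ∩ S) ∪ f '' (T \ S)) := by
              rw [← image_union, inter_union_sdiff]
          _ ≤ volume (f '' (T ∩ S)) + volume (f '' (T \ S)) := measure_union_le _ _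
          _ ≤ _ := add_le_add (hS _ inter_subset_right (hTm.inter hSm))
              (hR _ (sdiff_subset_iff.2 hT) (hTm.diff hSm))
      · intro x _
        obtain ⟨U, hU, hxU, h⟩ := exists_nhds_volume_image_le hf hε x
        exact ⟨U, mem_nhdsWithin_of_mem_nhds (hU.mem_nhds hxU), U, Subset.rfl,
          hU.measurableSet, h⟩
    refine (hS K hKS hK.measurableSet).trans_eq ?_
    rw [lintegral_add_right _ measurable_const, setLIntegral_const]
  have hlim : Filter.Tendsto
      (fun ε : ℝ≥0 => ∫⁻ z in K, ‖fderiv ℝ f z‖ₑ ∂μH[1] + ε * μH[1] K)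
      (nhdsWithin 0 (Ioi 0)) (nhds (∫⁻ z in K, ‖fderiv ℝ f z‖ₑ ∂μH[1] + (0 : ℝ≥0) * μH[1] K)) := by
    refine (Filter.Tendsto.mono_left ?_ nhdsWithin_le_nhds)
    exact tendsto_const_nhds.add (ENNReal.Tendsto.mul_const
      (ENNReal.continuous_coe.tendsto 0) (Or.inr hfin))
  rw [ENNReal.coe_zero, zero_mul, add_zero] at hlim
  exact ge_of_tendsto hlim (eventually_nhdsWithin_of_forall key)

/-- A continuous function on a compact set of finite measure is integrable there. -/
theorem Continuous.integrableOn_of_isCompact {X : Type*} [TopologicalSpace X] [T2Space X]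
    [MeasurableSpace X] [OpensMeasurableSpace X] [TopologicalSpace.PseudoMetrizableSpace X]
    {μ : Measure X} {g : X → ℝ} (hg : Continuous g) {K : Set X} (hK : IsCompact K)
    (hfin : μ K ≠ ⊤) : IntegrableOn g K μ := by
  have : IsFiniteMeasure (μ.restrict K) := isFiniteMeasure_restrict.2 hfin
  have h : IntegrableOn g K (μ.restrict K) := hg.continuousOn.integrableOn_compact hK
  rwa [IntegrableOn, Measure.restrict_restrict hK.measurableSet, inter_self] at h

/-- The oscillation of a `C¹` function on a compact connected set is bounded by the integral of its
derivative. -/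
theorem IsConnected.abs_sub_le_integral_norm_fderiv {E : Type*} [NormedAddCommGroup E]
    [NormedSpace ℝ E] [MeasurableSpace E] [BorelSpace E] {f : E → ℝ} (hf : ContDiff ℝ 1 f)
    {K : Set E} (hconn : IsConnected K) (hK : IsCompact K) (hfin : μH[1] K ≠ ⊤) {x y : E}
    (hx : x ∈ K) (hy : y ∈ K) : |f x - f y| ≤ ∫ z in K, ‖fderiv ℝ f z‖ ∂μH[1] := by
  have hord : (f '' K).OrdConnected :=
    (hconn.isPreconnected.image f hf.continuous.continuousOn).ordConnected
  have hle : ENNReal.ofReal |f x - f y| ≤ ∫⁻ z in K, ‖fderiv ℝ f z‖ₑ ∂μH[1] := by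
    rw [abs_sub_comm, ← Real.volume_interval]
    exact (measure_mono (hord.uIcc_subset (mem_image_of_mem f hx) (mem_image_of_mem f hy))).trans
      (hK.volume_image_le_lintegral_enorm_fderiv_s3 hf hfin)
  have hint : IntegrableOn (fun z => ‖fderiv ℝ f z‖) K μH[1] :=
    (hf.continuous_fderiv one_ne_zero).norm.integrableOn_of_isCompact hK hfin
  rw [← ENNReal.ofReal_le_ofReal_iff (integral_nonneg fun _ => norm_nonneg _),
    ofReal_integral_eq_lintegral_ofReal hint (.of_forall fun _ => norm_nonneg _)]
  simpa only [ofReal_norm] using hle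

/-- The Cauchy-Schwarz inequality against a constant function on a set of finite measure. -/
theorem setIntegral_le_sqrt_mul_sqrt_integral_sq {X : Type*} [MeasurableSpace X] {μ : Measure X}
    {K : Set X} (hpos : 0 < μ.real K) {g : X → ℝ} (hg : IntegrableOn g K μ)
    (hg2 : IntegrableOn (fun z => g z ^ 2) K μ) :
    ∫ z in K, g z ∂μ ≤ √(μ.real K) * √(∫ z in K, g z ^ 2 ∂μ) := by
  have hfin : μ K ≠ ⊤ := fun h => by simp [Measure.real, h] at hpos
  set m := (∫ z in K, g z ∂μ) / μ.real K
  have hmul : m * μ.real K = ∫ z in K, g z ∂μ := div_mul_cancel₀ _ hpos.ne'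
  have hexp : ∫ z in K, (g z - m) ^ 2 ∂μ =
      ∫ z in K, g z ^ 2 ∂μ - 2 * m * ∫ z in K, g z ∂μ + μ.real K * m ^ 2 := by
    have hc : IntegrableOn (fun _ => m ^ 2) K μ := integrableOn_const hfin
    have hl : IntegrableOn (fun z => 2 * m * g z) K μ := hg.const_mul (2 * m)
    have hsub : IntegrableOn (fun z => g z ^ 2 - 2 * m * g z) K μ := hg2.sub hl
    rw [← integral_const_mul, ← integral_sub hg2 hl, ← smul_eq_mul (μ.real K),
      ← setIntegral_const, ← integral_add hsub hc]
    exact integral_congr_ae (.of_forall fun z => by ring)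
  have h0 : 0 ≤ ∫ z in K, (g z - m) ^ 2 ∂μ := integral_nonneg fun z => sq_nonneg _
  rw [← Real.sqrt_mul hpos.le]
  apply Real.le_sqrt_of_sq_le
  rw [hexp, ← hmul] at h0
  rw [← hmul]
  nlinarith [mul_nonneg hpos.le h0]

theorem stmt3 (K : Set Plane) (hc : IsCompact K) (hconn : IsConnected K)
    (hpos : 0 < μH[1] K) (hfin : μH[1] K < ⊤)
    (u : Plane → ℝ) (hu : ContDiff ℝ 1 u) :
    ∀ x ∈ K,
      |u x| ≤ (Real.sqrt ((μH[1] K).toReal))⁻¹ * Real.sqrt (∫ z in K, (u z) ^ 2 ∂μH[1]) +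
        Real.sqrt ((μH[1] K).toReal) * Real.sqrt (∫ z in K, ‖gradient u z‖ ^ 2 ∂μH[1]) := by
  have hH : 0 < μH[1].real K := ENNReal.toReal_pos hpos.ne' hfin.ne
  have hgrad : ∀ z, ‖gradient u z‖ = ‖fderiv ℝ u z‖ := fun z => by simp [gradient]
  have hu' := (hu.continuous_fderiv one_ne_zero).norm
  have hintu := hu.continuous.abs.integrableOn_of_isCompact hc hfin.ne
  intro x hx
  change |u x| ≤ (√(μH[1].real K))⁻¹ * _ + √(μH[1].real K) * _
  simp only [hgrad]
  have hosc : ∀ y ∈ K, |u x| - ∫ z in K, ‖fderiv ℝ u z‖ ∂μH[1] ≤ |u y| := fun y hy => by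
    have h₁ := hconn.abs_sub_le_integral_norm_fderiv hu hc hfin.ne hx hy
    have h₂ := abs_sub_abs_le_abs_sub (u x) (u y)
    linarith
  have hmean := setIntegral_mono_on (integrableOn_const hfin.ne) hintu hc.measurableSet hosc
  rw [setIntegral_const, smul_eq_mul] at hmean
  have hcs_u := setIntegral_le_sqrt_mul_sqrt_integral_sq hH hintu
    ((hu.continuous.abs.pow 2).integrableOn_of_isCompact hc hfin.ne)
  have hcs_grad := setIntegral_le_sqrt_mul_sqrt_integral_sq hH
    (hu'.integrableOn_of_isCompact hc hfin.ne)
    ((hu'.pow 2).integrableOn_of_isCompact hc hfin.ne)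
  simp only [sq_abs] at hcs_u
  have hs : 0 < √(μH[1].real K) := Real.sqrt_pos.2 hH
  have hmean' : |u x| - ∫ z in K, ‖fderiv ℝ u z‖ ∂μH[1] ≤
      (√(μH[1].real K))⁻¹ * √(∫ z in K, u z ^ 2 ∂μH[1]) := by
    rw [le_inv_mul_iff₀ hs, ← mul_le_mul_iff_right₀ hs, ← mul_assoc, Real.mul_self_sqrt hH.le]
    exact hmean.trans hcs_u
  linarith
end

section
/- Let K ⊆ ℝ² be a compact, connected set with 0 < H¹(K) < ∞, let M ≥ 0, and let u : K → ℝ be H¹-measurable with ∫_K u² dH¹ < ∞. Assume that |u(x) − u(y)| ≤ M · d_K(x,y)^{1/2} for all x, y ∈ K. Then for every x ∈ K, |u(x)| ≤ H¹(K)^{-1/2} · (∫_K u(z)² dH¹(z))^{1/2} + M · H¹(K)^{1/2}. -/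
open MeasureTheory Set
open scoped ENNReal NNReal

open Filter Topology

theorem exists_minimal_chain {Y : Type*} [PseudoMetricSpace Y] [PreconnectedSpace Y] (x y : Y)
    {ε : ℝ} (hε : 0 < ε) :
    ∃ (N : ℕ) (p : ℕ → Y), p 0 = x ∧ p N = y ∧ (∀ i, i < N → dist (p i) (p (i + 1)) < ε) ∧
      ∀ i j, i + 2 ≤ j → j ≤ N → ε ≤ dist (p i) (p j) := by
  let G : SimpleGraph Y := SimpleGraph.fromRel fun a b => dist a b < ε
  have hG : ∀ a b, G.Adj a b ↔ a ≠ b ∧ dist a b < ε := fun a b => by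
    simp [G, dist_comm b a]
  have hnear : ∀ a b, dist a b < ε → G.Reachable a b := fun a b h => by
    by_cases hab : a = b
    · exact hab ▸ SimpleGraph.Reachable.refl a
    · exact ((hG a b).2 ⟨hab, h⟩).reachable
  have hclopen : IsClopen {z | G.Reachable x z} := by
    constructor
    · rw [← isOpen_compl_iff, Metric.isOpen_iff]
      intro z hz
      refine ⟨ε, hε, fun w hw hxw => hz ?_⟩
      exact SimpleGraph.Reachable.trans hxw (hnear w z hw)
    · rw [Metric.isOpen_iff]
      intro z hz
      refine ⟨ε, hε, fun w hw => ?_⟩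
      exact SimpleGraph.Reachable.trans hz (hnear z w (by rwa [dist_comm]))
  have hreach : G.Reachable x y := by
    have := hclopen.eq_univ ⟨x, SimpleGraph.Reachable.refl x⟩
    exact eq_univ_iff_forall.1 this y
  obtain ⟨w, hw⟩ := hreach.exists_walk_length_eq_dist
  refine ⟨w.length, w.getVert, w.getVert_zero, w.getVert_length,
    fun i hi => ((hG _ _).1 (w.adj_getVert_succ hi)).2, fun i j hij hj => ?_⟩
  by_contra! h
  obtain ⟨q, hq⟩ : ∃ q : G.Walk (w.getVert i) (w.getVert j), q.length ≤ 1 := by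
    by_cases hab : w.getVert i = w.getVert j
    · exact ⟨SimpleGraph.Walk.nil.copy rfl hab, by simp⟩
    · exact ⟨((hG _ _).2 ⟨hab, h⟩).toWalk, by simp⟩
  have := G.dist_le ((w.take i).append (q.append (w.drop j)))
  simp [SimpleGraph.Walk.take_length, SimpleGraph.Walk.drop_length] at this
  omega

section
variable {X : Type*} [MetricSpace X]

/-- `γ` restricts to a `c`-Lipschitz map `[0,1] → K` from `x` to `y`. -/
structure IsLipschitzPathIn (K : Set X) (x y : X) (c : ℝ) (γ : ℝ → X) : Prop where
  mapsTo : MapsTo γ (Icc 0 1) K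
  source : γ 0 = x
  target : γ 1 = y
  dist_le : ∀ s ∈ Icc (0 : ℝ) 1, ∀ t ∈ Icc (0 : ℝ) 1, dist (γ s) (γ t) ≤ c * |s - t|

theorem exists_isLipschitzPathIn_of_tendsto {K : Set X} (hK : IsCompact K) {x y : X}
    {C e : ℕ → ℝ} {c : ℝ} (hC : Tendsto C atTop (𝓝 c)) (he : Tendsto e atTop (𝓝 0))
    {g : ℕ → ℝ → X} (hg : ∀ n, MapsTo (g n) (Icc 0 1) K) (h0 : ∀ n, g n 0 = x)
    (h1 : ∀ n, g n 1 = y)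
    (hd : ∀ n, ∀ s ∈ Icc (0 : ℝ) 1, ∀ t ∈ Icc (0 : ℝ) 1,
      dist (g n s) (g n t) ≤ C n * |s - t| + e n) :
    ∃ γ, IsLipschitzPathIn K x y c γ := by
  have key : ∀ t : ℝ, ∃ z, t ∈ Icc (0 : ℝ) 1 →
      z ∈ K ∧ Tendsto (fun n => g n t) (hyperfilter ℕ) (𝓝 z) := by
    intro t
    by_cases ht : t ∈ Icc (0 : ℝ) 1
    · obtain ⟨z, hz, hlim⟩ := hK.ultrafilter_le_nhds' ((hyperfilter ℕ).map fun n => g n t)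
        (Ultrafilter.mem_map.2 (Filter.univ_mem' fun n => hg n ht))
      exact ⟨z, fun _ => ⟨hz, hlim⟩⟩
    · exact ⟨x, fun h => absurd h ht⟩
  choose γ hγ using key
  have m0 : (0 : ℝ) ∈ Icc (0 : ℝ) 1 := by simp
  have m1 : (1 : ℝ) ∈ Icc (0 : ℝ) 1 := by simp
  refine ⟨γ, fun t ht => (hγ t ht).1, ?_, ?_, fun s hs t ht => ?_⟩
  · have := (hγ 0 m0).2
    simp only [h0] at this
    exact tendsto_nhds_unique this tendsto_const_nhds
  · have := (hγ 1 m1).2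
    simp only [h1] at this
    exact tendsto_nhds_unique this tendsto_const_nhds
  · have hr : Tendsto (fun n => C n * |s - t| + e n) (hyperfilter ℕ) (𝓝 (c * |s - t| + 0)) :=
      (((hC.mul_const _).add he).mono_left Nat.hyperfilter_le_atTop)
    rw [add_zero] at hr
    exact le_of_tendsto_of_tendsto' ((hγ s hs).2.dist (hγ t ht).2) hr fun n => hd n s hs t ht

theorem exists_minimal_isLipschitzPathIn {K : Set X} (hK : IsCompact K) {x y : X}
    (h : ∃ c γ, 0 ≤ c ∧ IsLipschitzPathIn K x y c γ) :
    ∃ c γ, 0 ≤ c ∧ IsLipschitzPathIn K x y c γ ∧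
      ∀ c' γ', 0 ≤ c' → IsLipschitzPathIn K x y c' γ' → c ≤ c' := by
  let S : Set ℝ := {c | 0 ≤ c ∧ ∃ γ, IsLipschitzPathIn K x y c γ}
  have hS : S.Nonempty := by
    obtain ⟨c, γ, hc, hγ⟩ := h
    exact ⟨c, hc, γ, hγ⟩
  have hbdd : BddBelow S := ⟨0, fun c hc => hc.1⟩
  obtain ⟨C, -, hC, hCS⟩ := exists_seq_tendsto_sInf hS hbdd
  choose g hg using fun n => (hCS n).2
  obtain ⟨γ, hγ⟩ := exists_isLipschitzPathIn_of_tendsto hK hC tendsto_const_nhds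
    (fun n => (hg n).mapsTo) (fun n => (hg n).source) (fun n => (hg n).target)
    (fun n s hs t ht => by simpa using (hg n).dist_le s hs t ht)
  exact ⟨sInf S, γ, le_csInf hS fun c hc => hc.1, hγ, fun c' γ' h0 h' => csInf_le hbdd ⟨h0, γ', h'⟩⟩

theorem IsLipschitzPathIn.injOn_of_minimal {K : Set X} {x y : X} {c : ℝ} {γ : ℝ → X}
    (hc : 0 < c) (hγ : IsLipschitzPathIn K x y c γ)
    (hmin : ∀ c' γ', 0 ≤ c' → IsLipschitzPathIn K x y c' γ' → c ≤ c') :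
    InjOn γ (Icc 0 1) := by
  suffices H : ∀ s t, 0 ≤ s → s < t → t ≤ 1 → γ s ≠ γ t by
    intro s hs t ht hst
    by_contra hne
    rcases lt_or_gt_of_ne hne with h | h
    · exact H s t hs.1 h ht.2 hst
    · exact H t s ht.1 h hs.2 hst.symm
  intro s t hs hst ht heq
  set r : ℝ := 1 - (t - s) with hr
  have hr0 : 0 ≤ r := by linarith
  let φ : ℝ → ℝ := fun a => if r * a ≤ s then r * a else r * a + (t - s)
  have hφ : ∀ a ∈ Icc (0 : ℝ) 1, φ a ∈ Icc (0 : ℝ) 1 := by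
    rintro a ⟨ha0, ha1⟩
    have h1 : 0 ≤ r * a := mul_nonneg hr0 ha0
    have h2 : r * a ≤ r := mul_le_of_le_one_right hr0 ha1
    simp only [φ]
    split_ifs <;> constructor <;> linarith
  have hs' : s ∈ Icc (0 : ℝ) 1 := ⟨hs, by linarith⟩
  have ht' : t ∈ Icc (0 : ℝ) 1 := ⟨by linarith, ht⟩
  have hmono : ∀ a ∈ Icc (0 : ℝ) 1, ∀ b ∈ Icc (0 : ℝ) 1, a ≤ b →
      dist (γ (φ a)) (γ (φ b)) ≤ c * (r * (b - a)) := by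
    intro a ha b hb hab
    have hle : r * a ≤ r * b := mul_le_mul_of_nonneg_left hab hr0
    have ha' := hφ a ha
    have hb' := hφ b hb
    simp only [φ] at ha' hb' ⊢
    split_ifs at ha' hb' ⊢ with h1 h2 h2
    · refine (hγ.dist_le _ ha' _ hb').trans_eq ?_
      rw [abs_sub_comm, abs_of_nonneg (by linarith)]
      ring
    · calc dist (γ (r * a)) (γ (r * b + (t - s)))
          ≤ dist (γ (r * a)) (γ s) + dist (γ t) (γ (r * b + (t - s))) := by
            rw [← heq]; exact dist_triangle _ _ _
        _ ≤ c * |r * a - s| + c * |t - (r * b + (t - s))| :=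
            add_le_add (hγ.dist_le _ ha' _ hs') (hγ.dist_le _ ht' _ hb')
        _ = c * (r * (b - a)) := by
            rw [abs_of_nonpos (by linarith), abs_of_nonpos (by linarith)]
            ring
    · linarith
    · refine (hγ.dist_le _ ha' _ hb').trans_eq ?_
      rw [abs_sub_comm, abs_of_nonneg (by linarith)]
      ring
  have hnew : IsLipschitzPathIn K x y (c * r) (γ ∘ φ) := by
    refine ⟨fun a ha => hγ.mapsTo (hφ a ha), ?_, ?_, fun a ha b hb => ?_⟩
    · simp [φ, hs, hγ.source]
    · have : γ (φ 1) = γ 1 := by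
        simp only [φ, mul_one]
        split_ifs with h
        · have h1 : t = 1 := by linarith
          have h2 : r = s := by linarith
          rw [h2, heq, h1]
        · congr 1; linarith
      simpa [hγ.target] using this
    · rcases le_total a b with hab | hab
      · rw [abs_sub_comm, abs_of_nonneg (by linarith), mul_assoc]
        exact hmono a ha b hb hab
      · rw [abs_of_nonneg (by linarith), mul_assoc, dist_comm]
        exact hmono b hb a ha hab
  have := hmin _ _ (by positivity) hnew
  nlinarith

theorem dist_le_mul_of_chain {p : ℕ → X} {N : ℕ} {ε : ℝ}
    (hstep : ∀ i, i < N → dist (p i) (p (i + 1)) < ε) {i j : ℕ} (hij : i ≤ j) (hj : j ≤ N) :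
    dist (p i) (p j) ≤ ε * ((j : ℝ) - i) := by
  induction j, hij using Nat.le_induction with
  | base => simp
  | succ k hk ih =>
    have := ih (by omega)
    have h2 := hstep k (by omega)
    have h3 := dist_triangle (p i) (p k) (p (k + 1))
    push_cast
    linarith

variable [MeasurableSpace X] [BorelSpace X]

theorem IsPreconnected.ofReal_le_hausdorffMeasure_inter_ball {S : Set X} (hS : IsPreconnected S)
    {a b : X} (ha : a ∈ S) (hb : b ∈ S) {r : ℝ} (hr : r ≤ dist a b) :
    ENNReal.ofReal r ≤ μH[1] (S ∩ Metric.ball a r) := by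
  have hf : LipschitzWith 1 (fun z => dist z a) := LipschitzWith.dist_left a
  have hsub : Ico 0 r ⊆ (fun z => dist z a) '' (S ∩ Metric.ball a r) := by
    intro t ht
    have hmem : t ∈ Icc ((fun z => dist z a) a) ((fun z => dist z a) b) := by
      simp only [dist_self, dist_comm b a]
      exact ⟨ht.1, ht.2.le.trans hr⟩
    obtain ⟨z, hz, hzt⟩ := hS.intermediate_value ha hb hf.continuous.continuousOn hmem
    exact ⟨z, ⟨hz, by simpa [hzt] using hzt.trans_lt ht.2⟩, hzt⟩
  calc ENNReal.ofReal r = μH[1] (Ico 0 r) := by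
        rw [hausdorffMeasure_real, Real.volume_Ico, sub_zero]
    _ ≤ μH[1] ((fun z => dist z a) '' (S ∩ Metric.ball a r)) := measure_mono hsub
    _ ≤ μH[1] (S ∩ Metric.ball a r) := by
        simpa using hf.hausdorffMeasure_image_le zero_le_one (S ∩ Metric.ball a r)

theorem IsPreconnected.edist_le_hausdorffMeasure {S : Set X} (hS : IsPreconnected S)
    {a b : X} (ha : a ∈ S) (hb : b ∈ S) : edist a b ≤ μH[1] S := by
  rw [edist_dist]
  exact (hS.ofReal_le_hausdorffMeasure_inter_ball ha hb le_rfl).trans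
    (measure_mono inter_subset_left)

theorem length_mul_le_of_chain {K : Set X} (hK : IsPreconnected K) (hKm : MeasurableSet K)
    (hfin : μH[1] K < ⊤) {p : ℕ → X} {N : ℕ} {ε : ℝ} (hε : 0 < ε) (hp : ∀ i, p i ∈ K)
    (hfar : ∀ i j, i + 2 ≤ j → j ≤ N → ε ≤ dist (p i) (p j)) (hε' : ε ≤ dist (p 0) (p N)) :
    N * ε ≤ 4 * (μH[1] K).toReal := by
  have hball : ∀ i, ENNReal.ofReal (ε / 2) ≤ μH[1] (K ∩ Metric.ball (p i) (ε / 2)) := by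
    intro i
    rcases le_or_gt (ε / 2) (dist (p i) (p 0)) with h | h
    · exact hK.ofReal_le_hausdorffMeasure_inter_ball (hp i) (hp 0) h
    · refine hK.ofReal_le_hausdorffMeasure_inter_ball (hp i) (hp N) ?_
      have := dist_triangle (p 0) (p i) (p N)
      rw [dist_comm (p 0) (p i)] at this
      linarith
  have hsum : ∑ i ∈ Finset.range (N / 2 + 1), ENNReal.ofReal (ε / 2) ≤ μH[1] K := by
    calc _ ≤ ∑ i ∈ Finset.range (N / 2 + 1), μH[1] (K ∩ Metric.ball (p (2 * i)) (ε / 2)) :=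
          Finset.sum_le_sum fun i _ => hball _
      _ = μH[1] (⋃ i ∈ Finset.range (N / 2 + 1), K ∩ Metric.ball (p (2 * i)) (ε / 2)) := by
          refine (measure_biUnion_finset ?_ fun i _ => hKm.inter Metric.isOpen_ball.measurableSet).symm
          have hlt : ∀ i j : ℕ, i < j → j < N / 2 + 1 →
              Disjoint (K ∩ Metric.ball (p (2 * i)) (ε / 2))
                (K ∩ Metric.ball (p (2 * j)) (ε / 2)) := by
            intro i j hij hj
            refine (Metric.ball_disjoint_ball ?_).mono inter_subset_right inter_subset_right
            linarith [hfar (2 * i) (2 * j) (by omega) (by omega)]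
          intro i hi j hj hij
          simp only [Finset.coe_range, mem_Iio] at hi hj
          rcases lt_or_gt_of_ne hij with h | h
          · exact hlt i j h hj
          · exact (hlt j i h hi).symm
      _ ≤ μH[1] K := measure_mono (by simp)
  have := ENNReal.toReal_mono hfin.ne hsum
  simp only [Finset.sum_const, Finset.card_range, nsmul_eq_mul, ENNReal.toReal_mul,
    ENNReal.toReal_natCast, ENNReal.toReal_ofReal (half_pos hε).le] at this
  have hN : (N : ℝ) ≤ 2 * ((N / 2 + 1 : ℕ) : ℝ) := by
    exact_mod_cast (by omega : N ≤ 2 * (N / 2 + 1))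
  nlinarith

theorem exists_isLipschitzPathIn {K : Set X} (hK : IsCompact K) (hconn : IsPreconnected K)
    (hfin : μH[1] K < ⊤) {x y : X} (hx : x ∈ K) (hy : y ∈ K) :
    ∃ c γ, 0 ≤ c ∧ IsLipschitzPathIn K x y c γ := by
  rcases eq_or_ne x y with rfl | hxy
  · exact ⟨0, fun _ => x, le_rfl, fun _ _ => hx, rfl, rfl, by simp⟩
  have hd : 0 < dist x y := dist_pos.2 hxy
  set H := (μH[1] K).toReal
  have : PreconnectedSpace K := isPreconnected_iff_preconnectedSpace.1 hconn
  let ε : ℕ → ℝ := fun n => dist x y * (1 / ((n : ℝ) + 1))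
  have hε : ∀ n, 0 < ε n := fun n => by positivity
  have hεd : ∀ n, ε n ≤ dist x y := fun n => by
    refine mul_le_of_le_one_right hd.le ?_
    rw [div_le_one (by positivity)]
    linarith [(Nat.cast_nonneg n : (0 : ℝ) ≤ n)]
  have hεlim : Tendsto ε atTop (𝓝 0) := by
    simpa [ε] using (tendsto_one_div_add_atTop_nhds_zero_nat (𝕜 := ℝ)).const_mul (dist x y)
  choose N p hp0 hpN hstep hfar using fun n =>
    exists_minimal_chain (⟨x, hx⟩ : K) ⟨y, hy⟩ (hε n)
  let q : ℕ → ℕ → X := fun n i => p n i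
  have hq0 : ∀ n, q n 0 = x := fun n => by simp [q, hp0]
  have hqN : ∀ n, q n (N n) = y := fun n => by simp [q, hpN]
  have hNε : ∀ n, N n * ε n ≤ 4 * H := fun n =>
    length_mul_le_of_chain hconn hK.measurableSet hfin (hε n) (p := q n)
      (fun i => (p n i).2) (fun i j hij hj => hfar n i j hij hj) (by rw [hq0, hqN]; exact hεd n)
  have hH : 0 ≤ H := ENNReal.toReal_nonneg
  have hmono : ∀ n, ∀ s ∈ Icc (0 : ℝ) 1, ∀ t ∈ Icc (0 : ℝ) 1, s ≤ t →
      dist (q n ⌊s * N n⌋₊) (q n ⌊t * N n⌋₊) ≤ 4 * H * (t - s) + ε n := by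
    intro n s hs t ht hst
    have hNn : (0 : ℝ) ≤ N n := Nat.cast_nonneg _
    have h1 : ⌊s * N n⌋₊ ≤ ⌊t * N n⌋₊ := Nat.floor_mono (by gcongr)
    have h2 : ⌊t * N n⌋₊ ≤ N n := by
      rw [← Nat.floor_natCast (R := ℝ) (N n)]
      refine Nat.floor_mono ?_
      rw [Nat.floor_natCast]
      exact mul_le_of_le_one_left hNn ht.2
    refine (dist_le_mul_of_chain (fun i hi => hstep n i hi) h1 h2).trans ?_
    have h3 := Nat.floor_le (mul_nonneg ht.1 hNn)
    have h4 := Nat.lt_floor_add_one (s * N n)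
    calc ε n * ((⌊t * N n⌋₊ : ℝ) - ⌊s * N n⌋₊) ≤ ε n * (t * N n - s * N n + 1) := by
          refine mul_le_mul_of_nonneg_left ?_ (hε n).le
          linarith
      _ = (N n * ε n) * (t - s) + ε n := by ring
      _ ≤ 4 * H * (t - s) + ε n := by
          have := mul_le_mul_of_nonneg_right (hNε n) (sub_nonneg.2 hst)
          linarith
  obtain ⟨γ, hγ⟩ := exists_isLipschitzPathIn_of_tendsto hK (x := x) (y := y)
    (tendsto_const_nhds (x := 4 * H)) hεlim (g := fun n t => q n ⌊t * N n⌋₊)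
    (fun n t _ => (p n _).2) (fun n => by simp [hq0]) (fun n => by simp [hqN])
    (fun n s hs t ht => by
      rcases le_total s t with h | h
      · rw [abs_sub_comm, abs_of_nonneg (by linarith)]
        exact hmono n s hs t ht h
      · rw [abs_of_nonneg (by linarith), dist_comm]
        exact hmono n t ht s hs h)
  exact ⟨4 * H, γ, by positivity, hγ⟩

theorem exists_isLipschitzPathIn_hausdorffMeasure {K : Set X} (hK : IsCompact K)
    (hconn : IsPreconnected K) (hfin : μH[1] K < ⊤) {x y : X} (hx : x ∈ K) (hy : y ∈ K) :
    ∃ γ, IsLipschitzPathIn K x y (μH[1] K).toReal γ := by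
  obtain ⟨c, γ, hc, hγ, hmin⟩ :=
    exists_minimal_isLipschitzPathIn hK (exists_isLipschitzPathIn hK hconn hfin hx hy)
  suffices hcH : c ≤ (μH[1] K).toReal from ⟨γ, hγ.mapsTo, hγ.source, hγ.target,
    fun s hs t ht => (hγ.dist_le s hs t ht).trans (by gcongr)⟩
  rcases hc.eq_or_lt with rfl | hc
  · exact ENNReal.toReal_nonneg
  have hinj := hγ.injOn_of_minimal hc hmin
  have hlip : LipschitzOnWith c.toNNReal γ (Icc 0 1) :=
    LipschitzOnWith.of_dist_le_mul fun s hs t ht => by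
      rw [Real.coe_toNNReal _ hc.le, Real.dist_eq]
      exact hγ.dist_le s hs t ht
  have hsub : ∀ {s t : ℝ}, 0 ≤ s → t ≤ 1 → Icc s t ⊆ Icc 0 1 := fun h0 h1 =>
    Icc_subset_Icc h0 h1
  have hcont : ∀ {s t : ℝ}, 0 ≤ s → t ≤ 1 → ContinuousOn γ (Icc s t) := fun h0 h1 =>
    hlip.continuousOn.mono (hsub h0 h1)
  have himg : ∀ {s t : ℝ}, 0 ≤ s → t ≤ 1 → μH[1] (γ '' Icc s t) ≤ μH[1] K := fun h0 h1 =>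
    measure_mono ((hγ.mapsTo.mono_left (hsub h0 h1)).image_subset)
  have htop : ∀ {s t : ℝ}, 0 ≤ s → t ≤ 1 → μH[1] (γ '' Icc s t) ≠ ⊤ := fun h0 h1 =>
    ((himg h0 h1).trans_lt hfin).ne
  let φ : ℝ → ℝ := fun t => (μH[1] (γ '' Icc 0 t)).toReal
  have hadd : ∀ {s t : ℝ}, 0 ≤ s → s ≤ t → t ≤ 1 →
      φ t = φ s + (μH[1] (γ '' Icc s t)).toReal := by
    intro s t hs hst ht
    rw [← ENNReal.toReal_add (htop le_rfl (hst.trans ht)) (htop hs ht), ← measure_union₀,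
      ← image_union, Icc_union_Icc_eq_Icc hs hst]
    · exact (isCompact_Icc.image_of_continuousOn (hcont hs ht)).measurableSet.nullMeasurableSet
    · have : NullSingletonClass (μH[1] : Measure X) :=
        Measure.nullSingletonClass_hausdorff X one_pos
      refine measure_mono_null ?_ (measure_singleton (γ s))
      rintro _ ⟨⟨a, ha, rfl⟩, ⟨b, hb, hab⟩⟩
      have := hinj (hsub hs ht hb) (hsub le_rfl (hst.trans ht) ha) hab
      have : a = s := le_antisymm ha.2 (this ▸ hb.1)
      simp [this]
  have hlower : ∀ {s t : ℝ}, 0 ≤ s → s ≤ t → t ≤ 1 → dist (γ s) (γ t) ≤ φ t - φ s := by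
    intro s t hs hst ht
    have h := (isPreconnected_Icc.image γ (hcont hs ht)).edist_le_hausdorffMeasure
      (mem_image_of_mem γ (left_mem_Icc.2 hst)) (mem_image_of_mem γ (right_mem_Icc.2 hst))
    have h2 := ENNReal.toReal_mono (htop hs ht) h
    rw [edist_dist, ENNReal.toReal_ofReal dist_nonneg] at h2
    linarith [hadd hs hst ht]
  have hupper : ∀ {s t : ℝ}, 0 ≤ s → s ≤ t → t ≤ 1 → φ t - φ s ≤ c * (t - s) := by
    intro s t hs hst ht
    have h := (hlip.mono (hsub hs ht)).hausdorffMeasure_image_le (d := 1) zero_le_one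
    rw [hausdorffMeasure_real, Real.volume_Icc, ENNReal.rpow_one] at h
    have h2 := ENNReal.toReal_mono (by finiteness) h
    rw [ENNReal.toReal_mul, ENNReal.coe_toReal, Real.coe_toNNReal _ hc.le,
      ENNReal.toReal_ofReal (by linarith)] at h2
    linarith [hadd hs hst ht]
  have hφcont : ContinuousOn φ (Icc 0 1) := by
    refine (LipschitzOnWith.of_dist_le_mul (K := c.toNNReal) fun s hs t ht => ?_).continuousOn
    rw [Real.coe_toNNReal _ hc.le, Real.dist_eq, Real.dist_eq]
    rcases le_total s t with h | h
    · rw [abs_sub_comm, abs_sub_comm s, abs_of_nonneg (dist_nonneg.trans (hlower hs.1 h ht.2)),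
        abs_of_nonneg (by linarith)]
      exact hupper hs.1 h ht.2
    · rw [abs_of_nonneg (dist_nonneg.trans (hlower ht.1 h hs.2)), abs_of_nonneg (by linarith)]
      exact hupper ht.1 h hs.2
  have hφ0 : φ 0 = 0 := by
    have := hadd (le_refl (0 : ℝ)) le_rfl zero_le_one
    simp only [φ] at this ⊢
    linarith
  have hφ1 : 0 ≤ φ 1 := ENNReal.toReal_nonneg
  have hinv : ∀ r : ℝ, ∃ t, r ∈ Icc (0 : ℝ) 1 → t ∈ Icc (0 : ℝ) 1 ∧ φ t = φ 1 * r := by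
    intro r
    by_cases hr : r ∈ Icc (0 : ℝ) 1
    · obtain ⟨t, ht, h⟩ := intermediate_value_Icc zero_le_one hφcont
        (show φ 1 * r ∈ Icc (φ 0) (φ 1) from
          ⟨hφ0.trans_le (mul_nonneg hφ1 hr.1), mul_le_of_le_one_right hφ1 hr.2⟩)
      exact ⟨t, fun _ => ⟨ht, h⟩⟩
    · exact ⟨0, fun h => absurd h hr⟩
  choose ψ hψ using hinv
  have hdist : ∀ s ∈ Icc (0 : ℝ) 1, ∀ t ∈ Icc (0 : ℝ) 1, dist (γ s) (γ t) ≤ |φ s - φ t| := by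
    intro s hs t ht
    rcases le_total s t with h | h
    · rw [abs_sub_comm]
      exact (hlower hs.1 h ht.2).trans (le_abs_self _)
    · rw [dist_comm]
      exact (hlower ht.1 h hs.2).trans (le_abs_self _)
  have m0 : (0 : ℝ) ∈ Icc (0 : ℝ) 1 := by simp
  have m1 : (1 : ℝ) ∈ Icc (0 : ℝ) 1 := by simp
  have hnew : IsLipschitzPathIn K x y (φ 1) (γ ∘ ψ) := by
    refine ⟨fun r hr => hγ.mapsTo (hψ r hr).1, ?_, ?_, fun r hr r' hr' => ?_⟩
    · have := hdist _ (hψ 0 m0).1 _ m0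
      rw [(hψ 0 m0).2, hφ0, mul_zero, sub_zero, abs_zero, dist_le_zero] at this
      exact this.trans hγ.source
    · have := hdist _ (hψ 1 m1).1 _ m1
      rw [(hψ 1 m1).2, mul_one, sub_self, abs_zero, dist_le_zero] at this
      exact this.trans hγ.target
    · refine (hdist _ (hψ r hr).1 _ (hψ r' hr').1).trans_eq ?_
      rw [(hψ r hr).2, (hψ r' hr').2, ← mul_sub, abs_mul, abs_of_nonneg hφ1]
  exact (hmin _ _ hφ1 hnew).trans (ENNReal.toReal_mono hfin.ne (himg le_rfl le_rfl))

end

theorem dK_le_hausdorffMeasure {K : Set Plane} (hK : IsCompact K) (hconn : IsPreconnected K)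
    (hfin : μH[1] K < ⊤) {x y : Plane} (hx : x ∈ K) (hy : y ∈ K) : dK K x y ≤ μH[1] K := by
  obtain ⟨γ, hγ⟩ := exists_isLipschitzPathIn_hausdorffMeasure hK hconn hfin hx hy
  have hlip : LipschitzOnWith (μH[1] K).toNNReal γ (Icc 0 1) :=
    LipschitzOnWith.of_dist_le_mul fun s hs t ht => hγ.dist_le s hs t ht
  refine iInf_le_of_le γ <| iInf_le_of_le ⟨_, hlip⟩ <| iInf_le_of_le hγ.mapsTo <|
    iInf_le_of_le hγ.source <| iInf_le_of_le hγ.target ?_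
  refine ENNReal.ofReal_le_of_le_toReal ?_
  rw [integral_Icc_eq_integral_Ioo]
  refine (le_abs_self _).trans ?_
  have h := norm_setIntegral_le_of_norm_le_const (μ := volume) (s := Ioo (0 : ℝ) 1)
    (f := fun t => ‖derivWithin γ (Icc 0 1) t‖) (C := (μH[1] K).toReal) (by simp) ?_
  · simpa using h
  · intro t ht
    have hnhds : Icc (0 : ℝ) 1 ∈ 𝓝 t := Icc_mem_nhds ht.1 ht.2
    rw [norm_norm, derivWithin_of_mem_nhds hnhds]
    exact norm_deriv_le_of_lipschitzOn hnhds hlip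

theorem stmt4 (K : Set Plane) (hc : IsCompact K) (hconn : IsConnected K)
    (hpos : 0 < μH[1] K) (hfin : μH[1] K < ⊤)
    (M : ℝ) (hM : 0 ≤ M) (u : Plane → ℝ)
    (hmeas : AEMeasurable u (μH[1].restrict K))
    (hint : Integrable (fun z => (u z) ^ 2) (μH[1].restrict K))
    (hHolder : ∀ x ∈ K, ∀ y ∈ K,
      ENNReal.ofReal |u x - u y| ≤ ENNReal.ofReal M * (dK K x y) ^ ((1:ℝ)/2)) :
    ∀ x ∈ K,
      |u x| ≤ (Real.sqrt ((μH[1] K).toReal))⁻¹ * Real.sqrt (∫ z in K, (u z) ^ 2 ∂μH[1]) +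
        M * Real.sqrt ((μH[1] K).toReal) := by
  intro x hx
  set H := (μH[1] K).toReal with hH
  have hHpos : 0 < H := ENNReal.toReal_pos hpos.ne' hfin.ne
  have hosc : ∀ z ∈ K, |u x - u z| ≤ M * √H := by
    intro z hz
    have h := (hHolder x hx z hz).trans (mul_le_mul_right
      (ENNReal.rpow_le_rpow (dK_le_hausdorffMeasure hc hconn.isPreconnected hfin hx hz)
        (by norm_num : (0 : ℝ) ≤ 1 / 2)) (ENNReal.ofReal M))
    have h2 := ENNReal.toReal_mono (by finiteness) h
    rwa [ENNReal.toReal_ofReal (abs_nonneg _), ENNReal.toReal_mul, ENNReal.toReal_ofReal hM,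
      ← ENNReal.toReal_rpow, ← Real.sqrt_eq_rpow] at h2
  rw [← sub_le_iff_le_add]
  set a := |u x| - M * √H
  rcases le_or_gt a 0 with ha | ha
  · exact ha.trans (by positivity)
  have hlow : ∀ z ∈ K, a ^ 2 ≤ u z ^ 2 := by
    intro z hz
    rw [← sq_abs (u z)]
    refine pow_le_pow_left₀ ha.le ?_ 2
    linarith [hosc z hz, abs_sub_abs_le_abs_sub (u x) (u z)]
  have hI : a ^ 2 * H ≤ ∫ z in K, (u z) ^ 2 ∂μH[1] := by
    have h := setIntegral_mono_on (integrableOn_const hfin.ne) hint hc.measurableSet hlow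
    rw [setIntegral_const, smul_eq_mul, mul_comm] at h
    exact h
  rw [inv_mul_eq_div, le_div_iff₀ (Real.sqrt_pos.2 hHpos)]
  refine Real.le_sqrt_of_sq_le ?_
  rwa [mul_pow, Real.sq_sqrt hHpos.le]
end

section
/- Let K ⊆ ℝ² be a compact, connected set with H¹(K) < ∞, let M ≥ 0, and let u : K → ℝ be H¹-measurable with ∫_K u² dH¹ < ∞. Assume that |u(x) − u(y)| ≤ M · d_K(x,y)^{1/2} holds for (H¹ × H¹)-almost every pair (x,y) ∈ K × K. Then there exists a function ũ : K → ℝ such that ũ = u H¹-almost everywhere on K and |ũ(x) − ũ(y)| ≤ M · d_K(x,y)^{1/2} for ALL x, y ∈ K; in particular u admits a continuous representative on K. -/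
open MeasureTheory Set
open scoped ENNReal NNReal

open Filter Topology Metric

section Metric

variable {X : Type*} [MetricSpace X]

/-- In a preconnected set, any two points are joined by an `ε`-chain which is shortest, so that
points that are not consecutive are at distance at least `ε`. -/
theorem IsPreconnected.exists_shortest_chain {C : Set X} (hC : IsPreconnected C) {ε : ℝ}
    (hε : 0 < ε) {x y : X} (hx : x ∈ C) (hy : y ∈ C) :
    ∃ (n : ℕ) (p : ℕ → X), p 0 = x ∧ p n = y ∧ (∀ i, p i ∈ C) ∧
      (∀ i, dist (p i) (p (i + 1)) ≤ ε) ∧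
      ∀ i j, i + 2 ≤ j → j ≤ n → ε ≤ dist (p i) (p j) := by
  let G : SimpleGraph C := SimpleGraph.mk (fun a b => a ≠ b ∧ dist a b < ε)
    ⟨fun a b h => ⟨h.1.symm, dist_comm a b ▸ h.2⟩⟩ ⟨fun a h => h.1 rfl⟩
  have hadj : ∀ a b : C, G.Adj a b ↔ a ≠ b ∧ dist a b < ε := fun _ _ => Iff.rfl
  have : PreconnectedSpace C := Subtype.preconnectedSpace hC
  have : Nonempty C := ⟨⟨x, hx⟩⟩
  have hG : G.Connected := by
    refine ⟨fun a b => ?_⟩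
    refine PreconnectedSpace.induction₂' G.Reachable (fun a => ?_) ⟨fun _ _ _ => .trans⟩ a b
    filter_upwards [ball_mem_nhds a hε] with b hb
    have : G.Reachable a b := by
      by_cases h : a = b
      · exact h ▸ .rfl
      · exact SimpleGraph.Adj.reachable ⟨h, mem_ball'.1 hb⟩
    exact ⟨this, this.symm⟩
  obtain ⟨w, hw⟩ := hG.exists_walk_length_eq_dist ⟨x, hx⟩ ⟨y, hy⟩
  refine ⟨w.length, fun i => w.getVert i, by simp, by simp, fun i => (w.getVert i).2,
    fun i => ?_, fun i j hij hj => ?_⟩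
  · rcases lt_or_ge i w.length with h | h
    · exact ((hadj _ _).1 (w.adj_getVert_succ h)).2.le
    · simp [w.getVert_of_length_le h, w.getVert_of_length_le (h.trans i.le_succ), hε.le]
  · by_contra! hlt
    have h1 : G.dist (w.getVert i) (w.getVert j) ≤ 1 := by
      by_cases h : w.getVert i = w.getVert j
      · simp [h]
      · exact (SimpleGraph.dist_eq_one_iff_adj.2 ((hadj _ _).2 ⟨h, hlt⟩)).le
    have h2 := SimpleGraph.dist_le (w.take i)
    have h3 := SimpleGraph.dist_le (w.drop j)
    rw [w.take_length] at h2
    rw [w.drop_length] at h3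
    have h4 := hG.dist_triangle (u := ⟨x, hx⟩) (v := w.getVert i) (w := ⟨y, hy⟩)
    have h5 := hG.dist_triangle (u := w.getVert i) (v := w.getVert j) (w := ⟨y, hy⟩)
    omega

variable [MeasurableSpace X] [BorelSpace X]

theorem ofReal_sub_le_hausdorffMeasure_of_subset_image_dist {S : Set X} {x : X} {a b : ℝ}
    (h : Ico a b ⊆ (fun y => dist x y) '' S) : ENNReal.ofReal (b - a) ≤ μH[1] S := by
  calc ENNReal.ofReal (b - a) = μH[1] (Ico a b) := by rw [hausdorffMeasure_real, Real.volume_Ico]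
    _ ≤ μH[1] ((fun y => dist x y) '' S) := measure_mono h
    _ ≤ μH[1] S := by
      simpa using (LipschitzWith.dist_right x).hausdorffMeasure_image_le zero_le_one S

theorem IsPreconnected.ofReal_le_hausdorffMeasure_inter_ball_s5 {C : Set X} (hC : IsPreconnected C)
    {x y : X} (hx : x ∈ C) (hy : y ∈ C) {r : ℝ} (hr : r ≤ dist x y) :
    ENNReal.ofReal r ≤ μH[1] (C ∩ ball x r) := by
  rw [← sub_zero r]
  refine ofReal_sub_le_hausdorffMeasure_of_subset_image_dist (x := x) fun t ht => ?_
  have := hC.intermediate_value hx hy (f := fun z => dist x z) (by fun_prop)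
  obtain ⟨z, hz, rfl⟩ := this ⟨by simpa using ht.1, ht.2.le.trans hr⟩
  exact ⟨z, ⟨hz, by simpa [dist_comm] using ht.2⟩, rfl⟩

/-- Packing bound for shortest chains: the number of steps times the step size is controlled by the
one-dimensional measure. -/
theorem IsPreconnected.mul_le_hausdorffMeasure_of_chain {C : Set X} (hC : IsPreconnected C)
    (hfin : μH[1] C ≠ ⊤) {ε : ℝ} (hε : 0 < ε) {n : ℕ} {p : ℕ → X} (hp : ∀ i, p i ∈ C)
    (hsep : ∀ i j, i + 2 ≤ j → j ≤ n → ε ≤ dist (p i) (p j)) :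
    n * ε ≤ 4 * (μH[1] C).toReal + ε := by
  have hH : 0 ≤ (μH[1] C).toReal := ENNReal.toReal_nonneg
  rcases lt_or_ge n 2 with hn | hn
  · have : (n : ℝ) ≤ 1 := by exact_mod_cast (by omega : n ≤ 1)
    nlinarith
  have hball : ∀ k ∈ Finset.range (n / 2 + 1),
      ENNReal.ofReal (ε / 2) ≤ μH[1] (C ∩ ball (p (2 * k)) (ε / 2)) := by
    intro k hk
    rw [Finset.mem_range] at hk
    rcases Nat.eq_zero_or_pos k with rfl | hk0
    · exact hC.ofReal_le_hausdorffMeasure_inter_ball_s5 (hp _) (hp 2)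
        ((by linarith : ε / 2 ≤ ε).trans (hsep 0 2 le_rfl hn))
    · refine hC.ofReal_le_hausdorffMeasure_inter_ball_s5 (hp _) (hp 0) ?_
      rw [dist_comm]
      exact (by linarith : ε / 2 ≤ ε).trans (hsep 0 (2 * k) (by omega) (by omega))
  have hdisj : ∀ i ∈ Finset.range (n / 2 + 1), ∀ j ∈ Finset.range (n / 2 + 1), i < j →
      Disjoint (ball (p (2 * i)) (ε / 2)) (ball (p (2 * j)) (ε / 2)) := by
    intro i _ j hj hij
    rw [Finset.mem_range] at hj
    exact ball_disjoint_ball (by linarith [hsep (2 * i) (2 * j) (by omega) (by omega)])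
  have hsum : ∑ _k ∈ Finset.range (n / 2 + 1), ENNReal.ofReal (ε / 2) ≤ μH[1] C := by
    calc _ ≤ ∑ k ∈ Finset.range (n / 2 + 1), (μH[1].restrict C) (ball (p (2 * k)) (ε / 2)) := by
          refine Finset.sum_le_sum fun k hk => ?_
          rw [Measure.restrict_apply measurableSet_ball, inter_comm]
          exact hball k hk
      _ = (μH[1].restrict C) (⋃ k ∈ Finset.range (n / 2 + 1), ball (p (2 * k)) (ε / 2)) := by
          refine (measure_biUnion_finset (fun i hi j hj hij => ?_)
            fun _ _ => measurableSet_ball).symm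
          rcases hij.lt_or_gt with h | h
          · exact hdisj i hi j hj h
          · exact (hdisj j hj i hi h).symm
      _ ≤ μH[1] C := by
          rw [← Measure.restrict_apply_univ C]
          exact measure_mono (subset_univ _)
  have hsum' := ENNReal.toReal_mono hfin hsum
  rw [Finset.sum_const, Finset.card_range, nsmul_eq_mul, ENNReal.toReal_mul,
    ENNReal.toReal_ofReal (by positivity), ENNReal.toReal_natCast] at hsum'
  have hn' : (n : ℝ) ≤ 2 * ((n / 2 + 1 : ℕ) : ℝ) := by exact_mod_cast (by omega)
  nlinarith

/-- A compact connected set of finite one-dimensional measure is connected by Lipschitz curves. -/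
theorem IsCompact.exists_lipschitzOnWith_curve {C : Set X} (hc : IsCompact C)
    (hC : IsPreconnected C) (hfin : μH[1] C ≠ ⊤) {x y : X} (hx : x ∈ C) (hy : y ∈ C) :
    ∃ γ : ℝ → X, LipschitzOnWith (4 * (μH[1] C).toNNReal) γ (Icc 0 1) ∧ MapsTo γ (Icc 0 1) C ∧
      γ 0 = x ∧ γ 1 = y := by
  set h : ℝ := (μH[1] C).toReal with h_def
  have happrox : ∀ ε : ℝ, 0 < ε → ∃ γ : ℝ → X, (∀ t, γ t ∈ C) ∧ γ 0 = x ∧ γ 1 = y ∧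
      ∀ s t, 0 ≤ s → s ≤ t → t ≤ 1 → dist (γ s) (γ t) ≤ 4 * h * (t - s) + 2 * ε := by
    intro ε hε
    obtain ⟨n, p, hp0, hpn, hpC, hstep, hsep⟩ := hC.exists_shortest_chain hε hx hy
    have hn := hC.mul_le_hausdorffMeasure_of_chain hfin hε hpC hsep
    refine ⟨fun t => p ⌊n * t⌋₊, fun t => hpC _, by simpa, by simpa, fun s t hs hst ht => ?_⟩
    have hle : ⌊n * s⌋₊ ≤ ⌊n * t⌋₊ := Nat.floor_mono (by gcongr)
    have hd := dist_le_Ico_sum_of_dist_le hle (d := fun _ => ε) fun {k} _ _ => hstep k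
    rw [Finset.sum_const, Nat.card_Ico, nsmul_eq_mul, Nat.cast_sub hle] at hd
    have h1 : (⌊n * t⌋₊ : ℝ) ≤ n * t := Nat.floor_le (mul_nonneg n.cast_nonneg (hs.trans hst))
    have h2 : (n * s : ℝ) < ⌊n * s⌋₊ + 1 := Nat.lt_floor_add_one _
    calc dist (p ⌊n * s⌋₊) (p ⌊n * t⌋₊) ≤ (⌊n * t⌋₊ - ⌊n * s⌋₊) * ε := hd
      _ ≤ (n * (t - s) + 1) * ε := by gcongr; linarith
      _ = n * ε * (t - s) + ε := by ring
      _ ≤ (4 * h + ε) * (t - s) + ε := by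
          have : 0 ≤ t - s := by linarith
          gcongr
      _ ≤ 4 * h * (t - s) + 2 * ε := by nlinarith
  choose γ hγC hγ0 hγ1 hγ using fun n : ℕ => happrox (1 / (n + 1)) Nat.one_div_pos_of_nat
  have hlim : ∀ t, ∃ z ∈ C, Tendsto (fun n => γ n t) (hyperfilter ℕ) (𝓝 z) := fun t =>
    hc.ultrafilter_le_nhds ((hyperfilter ℕ).map fun n => γ n t) (by
      rw [le_principal_iff]
      exact univ_mem' (f := (hyperfilter ℕ : Filter ℕ)) fun n => hγC n t)
  choose g hgC hg using hlim
  have hord : ∀ s t, 0 ≤ s → s ≤ t → t ≤ 1 → dist (g s) (g t) ≤ 4 * h * (t - s) := by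
    intro s t hs hst ht
    have hε : Tendsto (fun n : ℕ => 4 * h * (t - s) + 2 * (1 / ((n : ℝ) + 1))) (hyperfilter ℕ)
        (𝓝 (4 * h * (t - s) + 2 * 0)) :=
      ((tendsto_one_div_add_atTop_nhds_zero_nat.mono_left Nat.hyperfilter_le_atTop).const_mul
        2).const_add _
    simpa using le_of_tendsto_of_tendsto' ((hg s).dist (hg t)) hε fun n => hγ n s t hs hst ht
  refine ⟨g, LipschitzOnWith.of_dist_le_mul fun s hs t ht => ?_, fun t _ => hgC t, ?_, ?_⟩
  · have hcoe : ((4 * (μH[1] C).toNNReal : ℝ≥0) : ℝ) = 4 * h := by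
      rw [h_def]; simp [ENNReal.coe_toNNReal_eq_toReal]
    rw [hcoe, Real.dist_eq]
    rcases le_total s t with hst | hst
    · rw [abs_sub_comm, abs_of_nonneg (by linarith)]
      exact hord s t hs.1 hst ht.2
    · rw [dist_comm, abs_of_nonneg (by linarith)]
      exact hord t s ht.1 hst hs.2
  · exact tendsto_nhds_unique (hg 0) (by simp [hγ0])
  · exact tendsto_nhds_unique (hg 1) (by simp [hγ1])

end Metric

section Local

variable {X : Type*} [MetricSpace X] [MeasurableSpace X] [BorelSpace X]

/-- A relatively clopen piece of `K ∩ closedBall x r` that comes close to the centre has to reach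
the boundary sphere, hence has large measure. -/
theorem IsPreconnected.ofReal_le_hausdorffMeasure_of_isClopen {K : Set X} (hK : IsPreconnected K)
    (hc : IsCompact K) {x z : X} {r : ℝ} (hz : z ∈ K) (hzr : r ≤ dist x z)
    {V : Set ↥(K ∩ closedBall x r)} (hV : IsClopen V) {v : ↥(K ∩ closedBall x r)} (hv : v ∈ V)
    (hvr : dist x v < r / 2) :
    ENNReal.ofReal (r / 2) ≤ μH[1] (Subtype.val '' V) := by
  have hF : IsClosed (K ∩ closedBall x r) := hc.isClosed.inter isClosed_closedBall
  have hVc : IsClosed (Subtype.val '' V) := hF.isClosedMap_subtype_val _ hV.isClosed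
  have hVc' : IsClosed (Subtype.val '' Vᶜ) := hF.isClosedMap_subtype_val _ hV.compl.isClosed
  rw [show r / 2 = r - r / 2 by ring]
  refine ofReal_sub_le_hausdorffMeasure_of_subset_image_dist (x := x) fun s hs => ?_
  by_contra hne
  have hdist : Continuous fun y => dist x y := by fun_prop
  obtain ⟨q, -, ⟨hq1, hq2⟩, hq3⟩ := isPreconnected_closed_iff.1 hK
    (Subtype.val '' V ∩ {y | dist x y ≤ s}) (Subtype.val '' Vᶜ ∪ {y | s ≤ dist x y})
    (hVc.inter (isClosed_le hdist continuous_const))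
    (hVc'.union (isClosed_le continuous_const hdist)) (fun y hy => by
      rcases le_or_gt s (dist x y) with h | h
      · exact .inr (.inr h)
      · have hyF : y ∈ K ∩ closedBall x r := ⟨hy, mem_closedBall'.2 (h.le.trans hs.2.le)⟩
        by_cases hyV : (⟨y, hyF⟩ : ↥(K ∩ closedBall x r)) ∈ V
        · exact .inl ⟨⟨_, hyV, rfl⟩, h.le⟩
        · exact .inr (.inl ⟨_, hyV, rfl⟩))
    ⟨v, v.2.1, ⟨v, hv, rfl⟩, (hvr.trans_le hs.1).le⟩ ⟨z, hz, .inr (hs.2.le.trans hzr)⟩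
  rcases hq3 with hq3 | hq3
  · obtain ⟨a, ha, rfl⟩ := hq1
    obtain ⟨b, hb, hab⟩ := hq3
    exact hb (Subtype.ext hab ▸ ha)
  · exact hne ⟨q, hq1, le_antisymm hq2 hq3⟩

/-- In a continuum of finite one-dimensional measure, the component of `x` in
`K ∩ closedBall x r` is a neighbourhood of `x` in `K`. -/
theorem IsPreconnected.exists_ball_subset_connectedComponent {K : Set X} (hK : IsPreconnected K)
    (hc : IsCompact K) (hfin : μH[1] K ≠ ⊤) {x z : X} {r : ℝ} (hr : 0 < r) (hz : z ∈ K)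
    (hzr : r ≤ dist x z) (x₀ : ↥(K ∩ closedBall x r)) (hx₀ : (x₀ : X) = x) :
    ∃ δ > 0, ∀ y ∈ K, dist x y < δ → y ∈ Subtype.val '' connectedComponent x₀ := by
  have hF : IsCompact (K ∩ closedBall x r) := hc.inter_right isClosed_closedBall
  have : CompactSpace ↥(K ∩ closedBall x r) := isCompact_iff_compactSpace.1 hF
  have hle : ∀ V : Set ↥(K ∩ closedBall x r), Subtype.val '' V ⊆ K := by
    rintro V _ ⟨a, -, rfl⟩
    exact a.2.1
  have hmeas : ∀ V : Set ↥(K ∩ closedBall x r), IsClopen V →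
      MeasurableSet (Subtype.val '' V) := fun V hV =>
    (hF.isClosed.isClosedMap_subtype_val _ hV.isClosed).measurableSet
  set m : ℝ≥0∞ := ⨅ U : { U : Set ↥(K ∩ closedBall x r) // IsClopen U ∧ x₀ ∈ U },
    μH[1] (Subtype.val '' (U : Set ↥(K ∩ closedBall x r))) with hm
  have hmtop : m ≠ ⊤ :=
    ne_top_of_le_ne_top hfin
      ((iInf_le _ ⟨univ, isClopen_univ, mem_univ _⟩).trans (measure_mono (hle _)))
  have hlt : m < m + ENNReal.ofReal (r / 2) := ENNReal.lt_add_right hmtop (by simpa using hr)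
  obtain ⟨⟨U, hU, hxU⟩, hUm⟩ := iInf_lt_iff.1 (hm ▸ hlt)
  have hsub : ∀ y ∈ U, dist x y < r / 2 → y ∈ connectedComponent x₀ := by
    intro y hyU hyr
    rw [connectedComponent_eq_iInter_isClopen, mem_iInter]
    rintro ⟨V, hV, hxV⟩
    by_contra hyV
    have h1 := hK.ofReal_le_hausdorffMeasure_of_isClopen hc hz hzr (hU.diff hV) ⟨hyU, hyV⟩ hyr
    have h2 : m ≤ μH[1] (Subtype.val '' (U ∩ V)) :=
      iInf_le_of_le ⟨U ∩ V, hU.inter hV, hxU, hxV⟩ le_rfl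
    have h3 := measure_inter_add_sdiff (μ := μH[1]) (Subtype.val '' U) (hmeas V hV)
    rw [← image_inter Subtype.val_injective, ← image_sdiff Subtype.val_injective] at h3
    exact (hUm.trans_le ((add_le_add h2 h1).trans_eq h3)).false
  obtain ⟨δ, hδ, hball⟩ := Metric.isOpen_iff.1 hU.isOpen x₀ hxU
  refine ⟨min δ (r / 2), lt_min hδ (by positivity), fun y hy hyx => ?_⟩
  have hyF : y ∈ K ∩ closedBall x r :=
    ⟨hy, mem_closedBall'.2 (by linarith [min_le_right δ (r / 2)])⟩
  refine ⟨⟨y, hyF⟩, hsub _ (hball ?_) (hyx.trans_le (min_le_right _ _)), rfl⟩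
  rw [mem_ball', Subtype.dist_eq, hx₀]
  exact hyx.trans_le (min_le_left _ _)

/-- In a continuum of finite one-dimensional measure, nearby points are joined by short curves. -/
theorem IsCompact.exists_short_curve {K : Set X} (hc : IsCompact K)
    (hK : IsPreconnected K) (hfin : μH[1] K ≠ ⊤) {x : X} (hx : x ∈ K) {η : ℝ≥0} (hη : 0 < η) :
    ∃ δ > 0, ∀ y ∈ K, dist x y < δ → ∃ γ : ℝ → X, LipschitzOnWith η γ (Icc 0 1) ∧
      MapsTo γ (Icc 0 1) K ∧ γ 0 = x ∧ γ 1 = y := by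
  have hsmall : ∃ r > 0, μH[1] (K ∩ closedBall x r) < (η / 4 : ℝ≥0) := by
    have hlim := tendsto_measure_cthickening_of_isClosed (μ := μH[1].restrict K)
      (s := {x}) ⟨1, one_pos, ne_top_of_le_ne_top hfin
        ((measure_mono (subset_univ _)).trans_eq (Measure.restrict_apply_univ K))⟩ isClosed_singleton
    have hx0 : (μH[1].restrict K) {x} = 0 := by
      have := Measure.nullSingletonClass_hausdorff X one_pos
      exact measure_singleton x
    rw [hx0] at hlim
    have hev := (hlim.mono_left (nhdsWithin_le_nhds (s := Ioi 0))).eventually_lt_const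
      (u := ((η / 4 : ℝ≥0) : ℝ≥0∞)) (by exact_mod_cast div_pos hη four_pos)
    obtain ⟨r, hr, hr0⟩ := (hev.and self_mem_nhdsWithin).exists
    refine ⟨r, hr0, ?_⟩
    rw [cthickening_singleton _ (le_of_lt hr0), Measure.restrict_apply measurableSet_closedBall,
      inter_comm] at hr
    exact hr
  obtain ⟨r, hr, hrη⟩ := hsmall
  have hC : ∃ C ⊆ K ∩ closedBall x r, IsCompact C ∧ IsPreconnected C ∧ x ∈ C ∧
      ∃ δ > 0, ∀ y ∈ K, dist x y < δ → y ∈ C := by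
    by_cases hz : ∃ z ∈ K, r ≤ dist x z
    · obtain ⟨z, hz, hzr⟩ := hz
      have hxF : x ∈ K ∩ closedBall x r := ⟨hx, mem_closedBall_self hr.le⟩
      have hF : IsCompact (K ∩ closedBall x r) := hc.inter_right isClosed_closedBall
      refine ⟨Subtype.val '' connectedComponent (⟨x, hxF⟩ : ↥(K ∩ closedBall x r)), ?_,
        hF.of_isClosed_subset (hF.isClosed.isClosedMap_subtype_val _ isClosed_connectedComponent)
          ?_, isPreconnected_connectedComponent.image _ continuous_subtype_val.continuousOn,
        ⟨_, mem_connectedComponent, rfl⟩,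
        hK.exists_ball_subset_connectedComponent hc hfin hr hz hzr _ rfl⟩ <;>
      · rintro _ ⟨a, -, rfl⟩
        exact a.2
    · push Not at hz
      exact ⟨K, fun y hy => ⟨hy, mem_closedBall'.2 (hz y hy).le⟩, hc, hK, hx, 1, one_pos,
        fun y hy _ => hy⟩
  obtain ⟨C, hCF, hCc, hCp, hxC, δ, hδ, hδC⟩ := hC
  have hCη : μH[1] C < (η / 4 : ℝ≥0) := (measure_mono hCF).trans_lt hrη
  refine ⟨δ, hδ, fun y hy hyδ => ?_⟩
  obtain ⟨γ, hγ, hγC, h0, h1⟩ := hCc.exists_lipschitzOnWith_curve hCp hCη.ne_top hxC (hδC y hy hyδ)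
  refine ⟨γ, hγ.weaken ?_, fun t ht => (hCF (hγC ht)).1, h0, h1⟩
  have := ENNReal.toNNReal_mono ENNReal.coe_ne_top hCη.le
  rw [ENNReal.toNNReal_coe] at this
  calc 4 * (μH[1] C).toNNReal ≤ 4 * (η / 4) := by gcongr
    _ = η := mul_div_cancel₀ _ four_ne_zero

end Local

section Geodesic

variable {E : Type*} [NormedAddCommGroup E] [NormedSpace ℝ E]

theorem setIntegral_norm_derivWithin_eq_intervalIntegral (γ : ℝ → E) :
    ∫ t in Icc (0 : ℝ) 1, ‖derivWithin γ (Icc 0 1) t‖ = ∫ t in (0 : ℝ)..1, ‖deriv γ t‖ := by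
  rw [intervalIntegral.integral_of_le zero_le_one, integral_Icc_eq_integral_Ioo,
    integral_Ioc_eq_integral_Ioo]
  exact setIntegral_congr_fun measurableSet_Ioo fun t ht => by
    simp only [derivWithin_of_mem_nhds (Icc_mem_nhds ht.1 ht.2)]

theorem LipschitzOnWith.norm_deriv_le_of_mem_Ioo {γ : ℝ → E} {L : ℝ≥0} {a b t : ℝ}
    (h : LipschitzOnWith L γ (Icc a b)) (ht : t ∈ Ioo a b) : ‖deriv γ t‖ ≤ L :=
  norm_deriv_le_of_lipschitzOn (Icc_mem_nhds ht.1 ht.2) h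

theorem LipschitzOnWith.intervalIntegrable_norm_deriv [CompleteSpace E] {γ : ℝ → E} {L : ℝ≥0}
    (h : LipschitzOnWith L γ (Icc 0 1)) {a b : ℝ} (ha : 0 ≤ a) (hab : a ≤ b) (hb : b ≤ 1) :
    IntervalIntegrable (fun t => ‖deriv γ t‖) volume a b := by
  rw [intervalIntegrable_iff_integrableOn_Ioo_of_le hab]
  refine IntegrableOn.of_bound measure_Ioo_lt_top
    (stronglyMeasurable_deriv γ).norm.aestronglyMeasurable (L : ℝ) ?_
  refine (ae_restrict_iff' measurableSet_Ioo).2 (.of_forall fun t ht => ?_)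
  rw [norm_norm]
  exact h.norm_deriv_le_of_mem_Ioo (Ioo_subset_Ioo ha hb ht)

/-- Concatenation of two Lipschitz curves, with additivity of length. -/
theorem exists_concat_lipschitzOnWith [CompleteSpace E] {K : Set E} {γ₁ γ₂ : ℝ → E} {L₁ L₂ : ℝ≥0}
    (h₁ : LipschitzOnWith L₁ γ₁ (Icc 0 1)) (h₂ : LipschitzOnWith L₂ γ₂ (Icc 0 1))
    (hK₁ : MapsTo γ₁ (Icc 0 1) K) (hK₂ : MapsTo γ₂ (Icc 0 1) K) (h : γ₁ 1 = γ₂ 0) :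
    ∃ γ : ℝ → E, (∃ L : ℝ≥0, LipschitzOnWith L γ (Icc 0 1)) ∧ MapsTo γ (Icc 0 1) K ∧
      γ 0 = γ₁ 0 ∧ γ 1 = γ₂ 1 ∧
      ∫ t in (0 : ℝ)..1, ‖deriv γ t‖ =
        (∫ t in (0 : ℝ)..1, ‖deriv γ₁ t‖) + ∫ t in (0 : ℝ)..1, ‖deriv γ₂ t‖ := by
  let γ : ℝ → E := fun t => if t ≤ 1 / 2 then γ₁ (2 * t) else γ₂ (2 * t - 1)
  have hγ₁ : ∀ t, t ≤ 1 / 2 → γ t = γ₁ (2 * t) := fun t ht => if_pos ht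
  have hγ₂ : ∀ t, 1 / 2 ≤ t → γ t = γ₂ (2 * t - 1) := fun t ht => by
    rcases ht.eq_or_lt with rfl | ht
    · rw [hγ₁ _ le_rfl]; norm_num [h]
    · exact if_neg ht.not_ge
  have hd₁ : ∀ s t, 0 ≤ s → s ≤ t → t ≤ 1 / 2 →
      dist (γ s) (γ t) ≤ 2 * (L₁ + L₂) * (t - s) := by
    intro s t hs hst ht
    have := h₁.dist_le_mul (2 * s) ⟨by linarith, by linarith⟩ (2 * t) ⟨by linarith, by linarith⟩
    rw [hγ₁ s (hst.trans ht), hγ₁ t ht]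
    rw [dist_comm (2 * s), Real.dist_eq, abs_of_nonneg (by linarith)] at this
    nlinarith [L₂.coe_nonneg]
  have hd₂ : ∀ s t, 1 / 2 ≤ s → s ≤ t → t ≤ 1 →
      dist (γ s) (γ t) ≤ 2 * (L₁ + L₂) * (t - s) := by
    intro s t hs hst ht
    have := h₂.dist_le_mul (2 * s - 1) ⟨by linarith, by linarith⟩ (2 * t - 1)
      ⟨by linarith, by linarith⟩
    rw [hγ₂ s hs, hγ₂ t (hs.trans hst)]
    rw [dist_comm (2 * s - 1), Real.dist_eq, abs_of_nonneg (by linarith)] at this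
    nlinarith [L₁.coe_nonneg]
  have hd : ∀ s t, 0 ≤ s → s ≤ t → t ≤ 1 → dist (γ s) (γ t) ≤ 2 * (L₁ + L₂) * (t - s) := by
    intro s t hs hst ht
    rcases le_total t (1 / 2) with h | h
    · exact hd₁ s t hs hst h
    rcases le_total (1 / 2) s with h' | h'
    · exact hd₂ s t h' hst ht
    linarith [hd₁ s _ hs h' le_rfl, hd₂ _ t le_rfl h ht, dist_triangle (γ s) (γ (1 / 2)) (γ t)]
  have hL : LipschitzOnWith (2 * (L₁ + L₂)) γ (Icc 0 1) :=
    LipschitzOnWith.of_dist_le_mul fun s hs t ht => by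
      rw [Real.dist_eq]
      push_cast
      rcases le_total s t with hst | hst
      · rw [abs_sub_comm, abs_of_nonneg (by linarith)]
        exact hd s t hs.1 hst ht.2
      · rw [dist_comm, abs_of_nonneg (by linarith)]
        exact hd t s ht.1 hst hs.2
  refine ⟨γ, ⟨_, hL⟩, fun t ht => ?_, ?_, ?_, ?_⟩
  · rcases le_total t (1 / 2) with h | h
    · rw [hγ₁ t h]
      exact hK₁ ⟨by linarith [ht.1], by linarith⟩
    · rw [hγ₂ t h]
      exact hK₂ ⟨by linarith, by linarith [ht.2]⟩
  · rw [hγ₁ 0 (by norm_num), mul_zero]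
  · rw [hγ₂ 1 (by norm_num)]; norm_num
  have e₁ : ∫ t in (0 : ℝ)..(1 / 2), ‖deriv γ t‖ = ∫ t in (0 : ℝ)..1, ‖deriv γ₁ t‖ := by
    have : ∫ t in (0 : ℝ)..(1 / 2), ‖deriv γ t‖ =
        ∫ t in (0 : ℝ)..(1 / 2), 2 * ‖deriv γ₁ (2 * t)‖ := by
      rw [intervalIntegral.integral_of_le (by norm_num), intervalIntegral.integral_of_le
        (by norm_num), integral_Ioc_eq_integral_Ioo, integral_Ioc_eq_integral_Ioo]
      refine setIntegral_congr_fun measurableSet_Ioo fun t ht => ?_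
      have : γ =ᶠ[𝓝 t] fun s => γ₁ (2 * s) := by
        filter_upwards [Iio_mem_nhds ht.2] with s hs using hγ₁ s (le_of_lt hs)
      simp only [this.deriv_eq, deriv_comp_mul_left, norm_smul, Real.norm_ofNat]
    rw [this, intervalIntegral.integral_const_mul,
      intervalIntegral.integral_comp_mul_left (fun t => ‖deriv γ₁ t‖) two_ne_zero]
    norm_num
    ring
  have e₂ : ∫ t in (1 / 2 : ℝ)..1, ‖deriv γ t‖ = ∫ t in (0 : ℝ)..1, ‖deriv γ₂ t‖ := by
    have : ∫ t in (1 / 2 : ℝ)..1, ‖deriv γ t‖ =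
        ∫ t in (1 / 2 : ℝ)..1, 2 * ‖deriv γ₂ (2 * t - 1)‖ := by
      rw [intervalIntegral.integral_of_le (by norm_num), intervalIntegral.integral_of_le
        (by norm_num), integral_Ioc_eq_integral_Ioo, integral_Ioc_eq_integral_Ioo]
      refine setIntegral_congr_fun measurableSet_Ioo fun t ht => ?_
      have : γ =ᶠ[𝓝 t] fun s => γ₂ (2 * s - 1) := by
        filter_upwards [Ioi_mem_nhds ht.1] with s hs using hγ₂ s (le_of_lt hs)
      simp only [this.deriv_eq, deriv_comp_mul_left (f := fun s => γ₂ (s - 1)),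
        deriv_comp_sub_const, norm_smul, Real.norm_ofNat]
    rw [this, intervalIntegral.integral_const_mul,
      intervalIntegral.integral_comp_mul_sub (fun t => ‖deriv γ₂ t‖) two_ne_zero]
    norm_num
    ring
  rw [← e₁, ← e₂]
  exact (intervalIntegral.integral_add_adjacent_intervals
    (hL.intervalIntegrable_norm_deriv le_rfl (by norm_num) (by norm_num))
    (hL.intervalIntegrable_norm_deriv (by norm_num) (by norm_num) le_rfl)).symm

theorem dK_le_intervalIntegral {K : Set Plane} {γ : ℝ → Plane} {L : ℝ≥0}
    (h : LipschitzOnWith L γ (Icc 0 1)) (hK : MapsTo γ (Icc 0 1) K) :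
    dK K (γ 0) (γ 1) ≤ ENNReal.ofReal (∫ t in (0 : ℝ)..1, ‖deriv γ t‖) := by
  rw [← setIntegral_norm_derivWithin_eq_intervalIntegral]
  exact iInf_le_of_le γ (iInf_le_of_le ⟨L, h⟩ (iInf_le_of_le hK (iInf_le_of_le rfl
    (iInf_le_of_le rfl le_rfl))))

theorem dK_le_of_lipschitzOnWith {K : Set Plane} {γ : ℝ → Plane} {L : ℝ≥0}
    (h : LipschitzOnWith L γ (Icc 0 1)) (hK : MapsTo γ (Icc 0 1) K) :
    dK K (γ 0) (γ 1) ≤ L := by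
  refine (dK_le_intervalIntegral h hK).trans (ENNReal.ofReal_le_of_le_toReal ?_)
  rw [ENNReal.coe_toReal, intervalIntegral.integral_of_le zero_le_one,
    integral_Ioc_eq_integral_Ioo]
  have := norm_setIntegral_le_of_norm_le_const (f := fun t => ‖deriv γ t‖) (C := (L : ℝ))
    (measure_Ioo_lt_top (μ := volume) (a := (0 : ℝ)) (b := 1)) fun t ht => by
      rw [norm_norm]
      exact h.norm_deriv_le_of_mem_Ioo ht
  exact (le_abs_self _).trans (this.trans_eq (by simp))

theorem dK_self {K : Set Plane} {x : Plane} (hx : x ∈ K) : dK K x x = 0 := by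
  have := dK_le_of_lipschitzOnWith (K := K) (γ := fun _ => x) (L := 0)
    (LipschitzWith.const x).lipschitzOnWith fun _ _ => hx
  simpa using this

theorem dK_le_dK_swap (K : Set Plane) (x y : Plane) : dK K x y ≤ dK K y x := by
  conv_rhs => unfold dK
  refine le_iInf fun γ => le_iInf fun ⟨L, hL⟩ => le_iInf fun hK => le_iInf fun h0 =>
    le_iInf fun h1 => ?_
  have hmaps : MapsTo (fun t : ℝ => 1 - t) (Icc 0 1) (Icc 0 1) := fun t ht =>
    ⟨by linarith [ht.2], by linarith [ht.1]⟩
  have hL' : LipschitzOnWith L (fun t => γ (1 - t)) (Icc 0 1) :=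
    LipschitzOnWith.of_dist_le_mul fun s hs t ht => by
      simpa only [dist_sub_left] using hL.dist_le_mul _ (hmaps hs) _ (hmaps ht)
  have := dK_le_intervalIntegral hL' (hK.comp hmaps)
  simp only [deriv_comp_const_sub, norm_neg, sub_zero, sub_self, h0, h1] at this
  rw [intervalIntegral.integral_comp_sub_left (fun t => ‖deriv γ t‖)] at this
  rw [setIntegral_norm_derivWithin_eq_intervalIntegral]
  simpa using this

theorem dK_comm (K : Set Plane) (x y : Plane) : dK K x y = dK K y x :=
  (dK_le_dK_swap K x y).antisymm (dK_le_dK_swap K y x)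

theorem dK_triangle (K : Set Plane) (x y z : Plane) : dK K x z ≤ dK K x y + dK K y z := by
  conv_rhs => simp only [dK, ENNReal.iInf_add, ENNReal.add_iInf]
  refine le_iInf fun γ₂ => le_iInf fun ⟨L₂, h₂⟩ => le_iInf fun hK₂ => le_iInf fun h0' =>
    le_iInf fun h1' => le_iInf fun γ₁ => le_iInf fun ⟨L₁, h₁⟩ => le_iInf fun hK₁ =>
    le_iInf fun h0 => le_iInf fun h1 => ?_
  obtain ⟨γ, ⟨L, hL⟩, hK, e0, e1, he⟩ :=
    exists_concat_lipschitzOnWith h₁ h₂ hK₁ hK₂ (h1.trans h0'.symm)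
  have := dK_le_intervalIntegral hL hK
  rw [e0, e1, h0, h1', he] at this
  simp only [setIntegral_norm_derivWithin_eq_intervalIntegral]
  exact this.trans ENNReal.ofReal_add_le

end Geodesic

/-- McShane extension for an abstract real-valued pseudometric. -/
theorem exists_extension_of_pseudodist {α : Type*} (e : α → α → ℝ) (e_self : ∀ x, e x x = 0)
    (e_comm : ∀ x y, e x y = e y x) (e_triangle : ∀ x y z, e x z ≤ e x y + e y z)
    {f : α → ℝ} {s : Set α} (hf : ∀ x ∈ s, ∀ y ∈ s, |f x - f y| ≤ e x y) :
    ∃ g : α → ℝ, (∀ x y, |g x - g y| ≤ e x y) ∧ EqOn f g s := by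
  let _ : PseudoMetricSpace α :=
    { dist := e, dist_self := e_self, dist_comm := e_comm, dist_triangle := e_triangle }
  have hL : LipschitzOnWith 1 f s := LipschitzOnWith.of_dist_le_mul fun x hx y hy => by
    rw [NNReal.coe_one, one_mul]
    exact hf x hx y hy
  obtain ⟨g, hg, hfg⟩ := hL.extend_real
  refine ⟨g, fun x y => ?_, hfg⟩
  have := hg.dist_le_mul x y
  rwa [NNReal.coe_one, one_mul] at this

section Continuum

variable {K : Set Plane}

theorem dK_ne_top (hc : IsCompact K) (hK : IsPreconnected K) (hfin : μH[1] K ≠ ⊤) {x y : Plane}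
    (hx : x ∈ K) (hy : y ∈ K) : dK K x y ≠ ⊤ := by
  obtain ⟨γ, hL, hγ, rfl, rfl⟩ := hc.exists_lipschitzOnWith_curve hK hfin hx hy
  exact ne_top_of_le_ne_top ENNReal.coe_ne_top (dK_le_of_lipschitzOnWith hL hγ)

theorem exists_dK_le_of_dist_lt (hc : IsCompact K) (hK : IsPreconnected K) (hfin : μH[1] K ≠ ⊤)
    {x : Plane} (hx : x ∈ K) {η : ℝ≥0} (hη : 0 < η) :
    ∃ δ > 0, ∀ y ∈ K, dist x y < δ → dK K x y ≤ η := by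
  obtain ⟨δ, hδ, h⟩ := hc.exists_short_curve hK hfin hx hη
  refine ⟨δ, hδ, fun y hy hyx => ?_⟩
  obtain ⟨γ, hL, hγ, rfl, rfl⟩ := h y hy hyx
  exact dK_le_of_lipschitzOnWith hL hγ

/-- The snowflaked geodesic distance, as a real number. -/
noncomputable def sqrtGeodesic (K : Set Plane) (x y : Plane) : ℝ := √(dK K x y).toReal

theorem sqrtGeodesic_self {x : Plane} (hx : x ∈ K) : sqrtGeodesic K x x = 0 := by
  simp [sqrtGeodesic, dK_self hx]

theorem sqrtGeodesic_comm (K : Set Plane) (x y : Plane) :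
    sqrtGeodesic K x y = sqrtGeodesic K y x := by
  rw [sqrtGeodesic, sqrtGeodesic, dK_comm]

theorem sqrtGeodesic_triangle (hc : IsCompact K) (hK : IsPreconnected K) (hfin : μH[1] K ≠ ⊤)
    {x y z : Plane} (hx : x ∈ K) (hy : y ∈ K) (hz : z ∈ K) :
    sqrtGeodesic K x z ≤ sqrtGeodesic K x y + sqrtGeodesic K y z := by
  have hxy := dK_ne_top hc hK hfin hx hy
  have hyz := dK_ne_top hc hK hfin hy hz
  have h := ENNReal.toReal_mono (ENNReal.add_ne_top.2 ⟨hxy, hyz⟩) (dK_triangle K x y z)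
  rw [ENNReal.toReal_add hxy hyz] at h
  refine (Real.sqrt_le_sqrt h).trans ?_
  simpa only [sqrtGeodesic, Real.sqrt_eq_rpow] using Real.rpow_add_le_add_rpow ENNReal.toReal_nonneg
    ENNReal.toReal_nonneg (by norm_num : (0 : ℝ) ≤ 1 / 2) (by norm_num)

theorem exists_sqrtGeodesic_lt_of_dist_lt (hc : IsCompact K) (hK : IsPreconnected K)
    (hfin : μH[1] K ≠ ⊤) {x : Plane} (hx : x ∈ K) {η : ℝ} (hη : 0 < η) :
    ∃ δ > 0, ∀ y ∈ K, dist x y < δ → sqrtGeodesic K x y < η := by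
  obtain ⟨δ, hδ, h⟩ := exists_dK_le_of_dist_lt hc hK hfin hx (η := ⟨(η / 2) ^ 2, sq_nonneg _⟩)
    (by positivity : 0 < (η / 2) ^ 2)
  refine ⟨δ, hδ, fun y hy hyx => ?_⟩
  have := ENNReal.toReal_mono ENNReal.coe_ne_top (h y hy hyx)
  calc sqrtGeodesic K x y ≤ √((η / 2) ^ 2) := Real.sqrt_le_sqrt this
    _ = η / 2 := Real.sqrt_sq (by positivity)
    _ < η := by linarith

theorem ofReal_abs_le_mul_dK_rpow_iff (hc : IsCompact K) (hK : IsPreconnected K)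
    (hfin : μH[1] K ≠ ⊤) {x y : Plane} (hx : x ∈ K) (hy : y ∈ K) {M : ℝ} (hM : 0 ≤ M) (a : ℝ) :
    ENNReal.ofReal |a| ≤ ENNReal.ofReal M * (dK K x y) ^ ((1 : ℝ) / 2) ↔
      |a| ≤ M * sqrtGeodesic K x y := by
  rw [sqrtGeodesic, Real.sqrt_eq_rpow, ENNReal.toReal_rpow,
    ← ENNReal.ofReal_le_ofReal_iff (mul_nonneg hM ENNReal.toReal_nonneg), ENNReal.ofReal_mul hM,
    ENNReal.ofReal_toReal
      (ENNReal.rpow_ne_top_of_nonneg (by norm_num) (dK_ne_top hc hK hfin hx hy))]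

end Continuum

theorem stmt5 (K : Set Plane) (hc : IsCompact K) (hconn : IsConnected K)
    (hfin : μH[1] K < ⊤)
    (M : ℝ) (hM : 0 ≤ M) (u : Plane → ℝ)
    (hmeas : AEMeasurable u (μH[1].restrict K))
    (hint : Integrable (fun z => (u z) ^ 2) (μH[1].restrict K))
    (hHolder : ∀ᵐ p ∂((μH[1].restrict K).prod (μH[1].restrict K)),
      ENNReal.ofReal |u p.1 - u p.2| ≤ ENNReal.ofReal M * (dK K p.1 p.2) ^ ((1:ℝ)/2)) :
    ∃ utilde : Plane → ℝ,
      (∀ᵐ z ∂(μH[1].restrict K), utilde z = u z) ∧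
      (∀ x ∈ K, ∀ y ∈ K,
        ENNReal.ofReal |utilde x - utilde y| ≤ ENNReal.ofReal M * (dK K x y) ^ ((1:ℝ)/2)) ∧
      ContinuousOn utilde K := by
  have hK := hconn.isPreconnected
  have hfin := hfin.ne
  rcases K.subsingleton_or_nontrivial with hsub | hnt
  · refine ⟨u, .of_forall fun _ => rfl, fun x hx y hy => ?_, hsub.continuousOn u⟩
    simp [hsub hx hy]
  have : IsFiniteMeasure (μH[1].restrict K : Measure Plane) :=
    isFiniteMeasure_restrict.2 hfin
  have hae : ∀ᵐ x ∂(μH[1].restrict K), ∀ᵐ y ∂(μH[1].restrict K),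
      ENNReal.ofReal |u x - u y| ≤ ENNReal.ofReal M * (dK K x y) ^ ((1:ℝ)/2) :=
    Measure.ae_ae_of_ae_prod hHolder
  have hfreq : ∀ x ∈ K, ∀ δ > 0, ∀ p : Plane → Prop, (∀ᵐ y ∂(μH[1].restrict K), p y) →
      ∃ z ∈ K, dist x z < δ ∧ p z := by
    intro x hx δ hδ p hp
    obtain ⟨w, hw, hwx⟩ := hnt.exists_ne x
    have hpos : μH[1] (K ∩ ball x (min δ (dist x w))) ≠ 0 := by
      refine (lt_of_lt_of_le ?_ (hK.ofReal_le_hausdorffMeasure_inter_ball_s5 hx hw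
        (min_le_right δ (dist x w)))).ne'
      exact ENNReal.ofReal_pos.2 (lt_min hδ (dist_pos.2 hwx.symm))
    have hp' := ae_iff.1 ((ae_restrict_iff' hc.measurableSet).1 hp)
    by_contra! hcon
    refine hpos (measure_mono_null (fun z hz => ?_) hp')
    have hzδ : dist x z < δ := by
      rw [dist_comm]
      exact (mem_ball.1 hz.2).trans_le (min_le_left _ _)
    exact fun h => hcon z hz.1 hzδ (h hz.1)
  have hG : ∀ x ∈ K, ∀ y ∈ K,
      (∀ᵐ z ∂(μH[1].restrict K),
        ENNReal.ofReal |u x - u z| ≤ ENNReal.ofReal M * (dK K x z) ^ ((1:ℝ)/2)) →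
      (∀ᵐ z ∂(μH[1].restrict K),
        ENNReal.ofReal |u y - u z| ≤ ENNReal.ofReal M * (dK K y z) ^ ((1:ℝ)/2)) →
      |u x - u y| ≤ M * sqrtGeodesic K x y := by
    intro x hx y hy hxz hyz
    have hlim : ∀ η > 0, |u x - u y| ≤ M * (2 * η + sqrtGeodesic K x y) := by
      intro η hη
      obtain ⟨δ, hδ, hball⟩ := exists_sqrtGeodesic_lt_of_dist_lt hc hK hfin hx hη
      obtain ⟨z, hz, hzδ, h1, h2⟩ := hfreq x hx δ hδ _ (hxz.and hyz)
      rw [ofReal_abs_le_mul_dK_rpow_iff hc hK hfin hx hz hM] at h1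
      rw [ofReal_abs_le_mul_dK_rpow_iff hc hK hfin hy hz hM] at h2
      have h3 := hball z hz hzδ
      have h4 := sqrtGeodesic_triangle hc hK hfin hy hx hz
      rw [sqrtGeodesic_comm K y x] at h4
      calc |u x - u y| ≤ |u x - u z| + |u z - u y| := abs_sub_le _ _ _
        _ ≤ M * sqrtGeodesic K x z + M * sqrtGeodesic K y z := by
          rw [abs_sub_comm (u z)]
          exact add_le_add h1 h2
        _ = M * (sqrtGeodesic K x z + sqrtGeodesic K y z) := by ring
        _ ≤ M * (2 * η + sqrtGeodesic K x y) :=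
          mul_le_mul_of_nonneg_left (by linarith) hM
    have hcont : Tendsto (fun η : ℝ => M * (2 * η + sqrtGeodesic K x y)) (𝓝[>] 0)
        (𝓝 (M * (2 * 0 + sqrtGeodesic K x y))) :=
      (Continuous.tendsto (by fun_prop) 0).mono_left nhdsWithin_le_nhds
    simpa using ge_of_tendsto hcont (eventually_mem_nhdsWithin.mono hlim)
  obtain ⟨g, hg, hug⟩ := exists_extension_of_pseudodist (α := K)
    (fun x y => M * sqrtGeodesic K x y) (fun x => by simp [sqrtGeodesic_self x.2])
    (fun x y => by rw [sqrtGeodesic_comm]) (fun x y z => by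
      rw [← mul_add]
      exact mul_le_mul_of_nonneg_left (sqrtGeodesic_triangle hc hK hfin x.2 y.2 z.2) hM)
    (f := fun x => u x) (s := {x | ∀ᵐ z ∂(μH[1].restrict K),
        ENNReal.ofReal |u x - u z| ≤ ENNReal.ofReal M * (dK K x z) ^ ((1:ℝ)/2)})
    (fun x hx y hy => hG x x.2 y y.2 hx hy)
  classical
  let utilde : Plane → ℝ := fun x => if hx : x ∈ K then g ⟨x, hx⟩ else 0
  have hut : ∀ x (hx : x ∈ K), utilde x = g ⟨x, hx⟩ := fun x hx => dif_pos hx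
  have hbound : ∀ x ∈ K, ∀ y ∈ K, |utilde x - utilde y| ≤ M * sqrtGeodesic K x y := by
    intro x hx y hy
    rw [hut x hx, hut y hy]
    exact hg ⟨x, hx⟩ ⟨y, hy⟩
  refine ⟨utilde, ?_, fun x hx y hy =>
    (ofReal_abs_le_mul_dK_rpow_iff hc hK hfin hx hy hM _).2 (hbound x hx y hy), ?_⟩
  · filter_upwards [hae, ae_restrict_mem hc.measurableSet] with x hx hxK
    rw [hut x hxK]
    exact (hug (x := ⟨x, hxK⟩) hx).symm
  · refine Metric.continuousOn_iff.2 fun x hx ε hε => ?_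
    obtain ⟨δ, hδ, hball⟩ := exists_sqrtGeodesic_lt_of_dist_lt hc hK hfin hx
      (η := ε / (M + 1)) (by positivity)
    refine ⟨δ, hδ, fun y hy hyx => ?_⟩
    have h := hball y hy (dist_comm x y ▸ hyx)
    rw [lt_div_iff₀ (by positivity)] at h
    have h0 : 0 ≤ sqrtGeodesic K x y := Real.sqrt_nonneg _
    rw [dist_comm, Real.dist_eq]
    linarith [hbound x hx y hy]
end

section
/- Let K ⊆ ℝ² be a compact, connected set, let x ∈ K and r > 0, and suppose there exists a point y ∈ K with |y − x| ≥ r (i.e., K is not contained in the open ball B(x,r)). Then H¹(K ∩ closedBall(x,r)) ≥ r. In other words, every compact connected set is lower Ahlfors-regular with constant 1. -/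
open MeasureTheory Set
open scoped ENNReal NNReal

theorem stmt7 (K : Set Plane) (hc : IsCompact K) (hconn : IsConnected K)
    (x : Plane) (hx : x ∈ K) (r : ℝ) (hr : 0 < r)
    (hout : ∃ y ∈ K, r ≤ dist y x) :
    ENNReal.ofReal r ≤ μH[1] (K ∩ Metric.closedBall x r) := by
  obtain ⟨y, hy, hyr⟩ := hout
  have hsub : Icc 0 r ⊆ (fun z => dist z x) '' (K ∩ Metric.closedBall x r) := by
    intro t ht
    have hivt := hconn.isPreconnected.intermediate_value hx hy
      (f := fun z => dist z x) (by fun_prop)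
    obtain ⟨z, hz, rfl⟩ := hivt ⟨by simpa using ht.1, ht.2.trans hyr⟩
    exact ⟨z, ⟨hz, ht.2⟩, rfl⟩
  calc ENNReal.ofReal r = μH[1] (Icc 0 r) := by
        rw [hausdorffMeasure_real, Real.volume_Icc, sub_zero]
    _ ≤ μH[1] ((fun z => dist z x) '' (K ∩ Metric.closedBall x r)) := measure_mono hsub
    _ ≤ μH[1] (K ∩ Metric.closedBall x r) := by
        simpa using (LipschitzWith.dist_left x).hausdorffMeasure_image_le zero_le_one
          (K ∩ Metric.closedBall x r)
end

section
/- There exists a universal constant C > 0 such that the following holds: for every compact, connected set K ⊆ ℝ² with H¹(K) < ∞ and Λ_K := sup{ H¹(K ∩ B(z,r))/r : z ∈ K, r > 0 } < ∞, and every continuously differentiable function w : ℝ² → ℝ with compact support, one has ∫_K |w| dH¹ ≤ C Λ_K ( ∫_{ℝ²} |w(x)| dx + ∫_{ℝ²} ‖∇w(x)‖ dx ). -/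
open MeasureTheory Set
open scoped ENNReal NNReal

/-- Upper Ahlfors-regularity constant `Λ_K = sup { H¹(K ∩ B(z,r))/r : z ∈ K, r > 0 }`. -/
noncomputable def ahlforsConst (K : Set Plane) : ℝ≥0∞ :=
  ⨆ (z : Plane) (_ : z ∈ K) (r : ℝ) (_ : 0 < r),
    μH[1] (K ∩ Metric.ball z r) / ENNReal.ofReal r

open Filter Topology Metric

theorem lintegral_comp_smul_add {f : Plane → ℝ≥0∞} (hf : Measurable f) {a : ℝ} (ha : a ≠ 0)
    (b : Plane) :
    ∫⁻ x, f (a • x + b) = ENNReal.ofReal |(a ^ 2)⁻¹| * ∫⁻ x, f x := by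
  have h1 : ∫⁻ x, f (a • x + b) = ∫⁻ y, f (y + b) ∂(Measure.map (fun x : Plane => a • x) volume) :=
    (lintegral_map (f := fun y => f (y + b)) (by fun_prop) (by fun_prop)).symm
  rw [h1, Measure.map_addHaar_smul _ ha, lintegral_smul_measure, lintegral_add_right_eq_self,
    finrank_euclideanSpace_fin, smul_eq_mul]

theorem lintegral_comp_smul_add_le {f : Plane → ℝ≥0∞} (hf : Measurable f) {a : ℝ} (ha : 1 / 2 ≤ a)
    (b : Plane) :
    ∫⁻ x, f (a • x + b) ≤ 4 * ∫⁻ x, f x := by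
  rw [lintegral_comp_smul_add hf (by linarith)]
  gcongr
  rw [abs_of_nonneg (by positivity), ← ENNReal.ofReal_ofNat 4]
  apply ENNReal.ofReal_le_ofReal
  rw [inv_le_comm₀ (by positivity) (by norm_num)]
  nlinarith

/-- For every `s ∈ [0, 1]`, one of the two end points of a segment in a ball can be integrated
out at the cost of a constant factor. -/
theorem lintegral_lintegral_segment_le (B : Set Plane) {G : Plane → ℝ≥0∞}
    (hG : Measurable G) (s : ℝ) :
    ∫⁻ x in B, ∫⁻ y in B, G (x + s • (y - x)) ≤ 4 * volume B * ∫⁻ x, G x := by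
  rcases le_total (1 / 2) s with hs | hs
  · calc ∫⁻ x in B, ∫⁻ y in B, G (x + s • (y - x))
        ≤ ∫⁻ x in B, 4 * ∫⁻ z, G z := by
          refine lintegral_mono fun x => (setLIntegral_le_lintegral _ _).trans ?_
          have := lintegral_comp_smul_add_le hG hs (x - s • x)
          refine le_trans (le_of_eq ?_) this
          congr 1 with y
          congr 1
          module
      _ = 4 * volume B * ∫⁻ x, G x := by
          rw [setLIntegral_const]; ring
  · rw [lintegral_lintegral_swap (by fun_prop)]
    calc ∫⁻ y in B, ∫⁻ x in B, G (x + s • (y - x))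
        ≤ ∫⁻ y in B, 4 * ∫⁻ z, G z := by
          refine lintegral_mono fun y => (setLIntegral_le_lintegral _ _).trans ?_
          have := lintegral_comp_smul_add_le (a := 1 - s) hG (by linarith) (s • y)
          refine le_trans (le_of_eq ?_) this
          congr 1 with x
          congr 1
          module
      _ = 4 * volume B * ∫⁻ x, G x := by
          rw [setLIntegral_const]; ring

theorem enorm_sub_le_lintegral_segment {u : Plane → ℝ} (hu : ContDiff ℝ 1 u) (x y : Plane) :
    ‖u x - u y‖ₑ ≤ ‖y - x‖ₑ * ∫⁻ s in Icc (0 : ℝ) 1, ‖fderiv ℝ u (x + s • (y - x))‖ₑ := by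
  have hline : ContDiff ℝ 1 (fun s : ℝ => x + s • (y - x)) := by fun_prop
  have h := enorm_sub_le_lintegral_deriv_of_contDiffOn_Icc
    (f := fun s : ℝ => u (x + s • (y - x))) (a := 0) (b := 1)
    (hu.comp hline).contDiffOn zero_le_one
  have e : ‖u x - u y‖ₑ = ‖u (x + (1 : ℝ) • (y - x)) - u (x + (0 : ℝ) • (y - x))‖ₑ := by
    rw [enorm_sub_rev]; simp
  rw [e]
  refine h.trans ?_
  rw [← lintegral_const_mul' _ _ enorm_ne_top]
  refine lintegral_mono fun s => ?_
  have hd : HasDerivAt (fun s : ℝ => x + s • (y - x)) (y - x) s := by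
    simpa using ((hasDerivAt_id s).smul_const (y - x)).const_add x
  have := ((hu.differentiable one_ne_zero _).hasFDerivAt.comp_hasDerivAt s hd).deriv
  simp only [Function.comp_def] at this
  rw [this, mul_comm]
  exact ContinuousLinearMap.le_opENorm _ _

/-- A Poincaré inequality on balls, in double integral form. -/
theorem lintegral_lintegral_enorm_sub_le {u : Plane → ℝ} (hu : ContDiff ℝ 1 u) (c : Plane)
    (r : ℝ) :
    ∫⁻ x in closedBall c r, ∫⁻ y in closedBall c r, ‖u x - u y‖ₑ ≤
      8 * ENNReal.ofReal r * volume (closedBall c r) *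
        ∫⁻ x in closedBall c r, ‖fderiv ℝ u x‖ₑ := by
  set B := closedBall c r
  have hB : MeasurableSet B := isClosed_closedBall.measurableSet
  set G : Plane → ℝ≥0∞ := B.indicator fun x => ‖fderiv ℝ u x‖ₑ
  have hG : Measurable G :=
    (hu.continuous_fderiv one_ne_zero).measurable.enorm.indicator hB
  have hpt : ∀ x ∈ B, ∀ y ∈ B, ‖u x - u y‖ₑ ≤
      2 * ENNReal.ofReal r * ∫⁻ s in Icc (0 : ℝ) 1, G (x + s • (y - x)) := by
    intro x hx y hy
    refine (enorm_sub_le_lintegral_segment hu x y).trans ?_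
    gcongr ?_ * ?_
    · have h2 : 2 * ENNReal.ofReal r = ENNReal.ofReal (2 * r) := by
        rw [ENNReal.ofReal_mul (by norm_num), ENNReal.ofReal_ofNat]
      rw [h2, ← ofReal_norm]
      apply ENNReal.ofReal_le_ofReal
      rw [← dist_eq_norm]
      have := dist_triangle_right y x c
      rw [mem_closedBall] at hx hy
      linarith
    · refine setLIntegral_mono' measurableSet_Icc fun s hs => ?_
      have hmem : x + s • (y - x) ∈ B :=
        (convex_closedBall c r).add_smul_sub_mem hx hy hs
      simp only [G, indicator_of_mem hmem, le_refl]
  calc ∫⁻ x in B, ∫⁻ y in B, ‖u x - u y‖ₑ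
      ≤ ∫⁻ x in B, ∫⁻ y in B,
          2 * ENNReal.ofReal r * ∫⁻ s in Icc (0 : ℝ) 1, G (x + s • (y - x)) :=
        setLIntegral_mono' hB fun x hx => setLIntegral_mono' hB fun y hy => hpt x hx y hy
    _ = 2 * ENNReal.ofReal r * ∫⁻ s in Icc (0 : ℝ) 1,
          ∫⁻ x in B, ∫⁻ y in B, G (x + s • (y - x)) := by
        have hc : 2 * ENNReal.ofReal r ≠ ⊤ := by finiteness
        simp_rw [lintegral_const_mul' _ _ hc]
        congr 1
        have : ∀ x, ∫⁻ y in B, ∫⁻ s in Icc (0 : ℝ) 1, G (x + s • (y - x)) =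
            ∫⁻ s in Icc (0 : ℝ) 1, ∫⁻ y in B, G (x + s • (y - x)) := fun x =>
          lintegral_lintegral_swap (by fun_prop)
        simp_rw [this]
        apply lintegral_lintegral_swap
        apply Measurable.aemeasurable
        have hm : Measurable fun q : (Plane × ℝ) × Plane => G (q.1.1 + q.1.2 • (q.2 - q.1.1)) := by
          fun_prop
        exact hm.lintegral_prod_right'
    _ ≤ 2 * ENNReal.ofReal r * ∫⁻ s in Icc (0 : ℝ) 1, 4 * volume B * ∫⁻ x, G x := by
        gcongr with s
        exact lintegral_lintegral_segment_le B hG s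
    _ = _ := by
        rw [setLIntegral_const, lintegral_indicator hB]
        simp only [Real.volume_Icc, sub_zero, ENNReal.ofReal_one]
        ring

/-- If `u` vanishes on half of a ball and equals `1` on a fixed fraction of it, its gradient has
mass at least comparable to the radius. -/
theorem ofReal_le_lintegral_fderiv {u : Plane → ℝ} (hu : ContDiff ℝ 1 u) {c : Plane} {r : ℝ}
    (hr : 0 < r) {Z F : Set Plane} (hZB : Z ⊆ closedBall c r) (hFB : F ⊆ closedBall c r)
    (hZ : MeasurableSet Z) (hF : MeasurableSet F)
    (hZ0 : ∀ x ∈ Z, u x = 0) (hF1 : ∀ x ∈ F, u x = 1)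
    (hZv : volume (closedBall c r) ≤ 2 * volume Z)
    (hFv : volume (closedBall c r) ≤ 16 * volume F) :
    ENNReal.ofReal r ≤ 256 * ∫⁻ x in closedBall c r, ‖fderiv ℝ u x‖ₑ := by
  have hP := lintegral_lintegral_enorm_sub_le hu c r
  have hvol := EuclideanSpace.volume_closedBall_fin_two c r
  set B := closedBall c r
  set I := ∫⁻ x in B, ‖fderiv ℝ u x‖ₑ
  have hlow : volume Z * volume F ≤ ∫⁻ x in B, ∫⁻ y in B, ‖u x - u y‖ₑ := by
    calc volume Z * volume F = ∫⁻ x in Z, ∫⁻ y in F, 1 := by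
          simp [mul_comm]
      _ ≤ ∫⁻ x in Z, ∫⁻ y in F, ‖u x - u y‖ₑ := by
          refine setLIntegral_mono' hZ fun x hx => setLIntegral_mono' hF fun y hy => ?_
          simp [hZ0 x hx, hF1 y hy]
      _ ≤ ∫⁻ x in B, ∫⁻ y in B, ‖u x - u y‖ₑ :=
          (lintegral_mono fun x => lintegral_mono_set hFB).trans (lintegral_mono_set hZB)
  have hB0 : volume B ≠ 0 := (measure_closedBall_pos _ _ hr).ne'
  have hBt : volume B ≠ ⊤ := measure_closedBall_lt_top.ne
  have h1 : volume B * volume B ≤ volume B * (256 * ENNReal.ofReal r * I) := by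
    calc volume B * volume B ≤ (2 * volume Z) * (16 * volume F) := by gcongr
      _ = 32 * (volume Z * volume F) := by ring
      _ ≤ 32 * (8 * ENNReal.ofReal r * volume B * I) := mul_le_mul_right (hlow.trans hP) _
      _ = _ := by ring
  have h2 := (ENNReal.mul_le_mul_iff_right hB0 hBt).1 h1
  have hr0 : ENNReal.ofReal r ≠ 0 := by simpa using hr
  have h3 : ENNReal.ofReal r * ENNReal.ofReal r ≤ ENNReal.ofReal r * (256 * I) := by
    calc ENNReal.ofReal r * ENNReal.ofReal r = ENNReal.ofReal r ^ 2 * 1 := by ring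
      _ ≤ ENNReal.ofReal r ^ 2 * ENNReal.ofReal Real.pi := by
          gcongr
          rw [← ENNReal.ofReal_one]
          exact ENNReal.ofReal_le_ofReal (by linarith [Real.pi_gt_three])
      _ ≤ 256 * ENNReal.ofReal r * I := hvol ▸ h2
      _ = _ := by ring
  exact (ENNReal.mul_le_mul_iff_right hr0 ENNReal.ofReal_ne_top).1 h3

/-- Around a point interior to a set `E` of finite area, some ball of controlled radius is split
by `E` into two parts of comparable area. -/
theorem exists_closedBall_balanced {E : Set Plane} (hE : volume E ≠ ⊤) {r₀ : ℝ} (hr₀ : 0 < r₀)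
    {c : Plane} (hc : closedBall c r₀ ⊆ E) :
    ∃ r, r₀ ≤ r ∧ r ≤ 8 * (volume E).toReal + 1 ∧
      2 * volume (E ∩ closedBall c r) ≤ volume (closedBall c r) ∧
      volume (closedBall c r) ≤ 8 * volume (E ∩ closedBall c r) := by
  classical
  have hlarge : ∀ r, 8 * (volume E).toReal + 1 < r → 8 * volume E < volume (closedBall c r) := by
    intro r hr
    have hV : 0 ≤ (volume E).toReal := ENNReal.toReal_nonneg
    rw [EuclideanSpace.volume_closedBall_fin_two, ← ENNReal.ofReal_pow (by linarith),
      ← ENNReal.ofReal_mul (by positivity)]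
    nth_rewrite 1 [← ENNReal.ofReal_toReal hE]
    rw [← ENNReal.ofReal_ofNat 8, ← ENNReal.ofReal_mul (by norm_num),
      ENNReal.ofReal_lt_ofReal_iff_of_nonneg (by positivity)]
    have h3 := Real.pi_gt_three
    nlinarith [mul_pos (show 0 < r ^ 2 by nlinarith) (show 0 < Real.pi - 1 by linarith)]
  have hex : ∃ n : ℕ, 2 * volume (E ∩ closedBall c (2 ^ n * r₀)) ≤
      volume (closedBall c (2 ^ n * r₀)) := by
    obtain ⟨n, hn⟩ := pow_unbounded_of_one_lt ((8 * (volume E).toReal + 1) / r₀)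
      (one_lt_two : (1 : ℝ) < 2)
    refine ⟨n, ?_⟩
    calc 2 * volume (E ∩ closedBall c (2 ^ n * r₀)) ≤ 8 * volume E := by
          gcongr
          · norm_num
          · exact inter_subset_left
      _ ≤ _ := (hlarge _ ((div_lt_iff₀ hr₀).1 hn)).le
  set n := Nat.find hex with hn
  have hn1 := Nat.find_spec hex
  rw [← hn] at hn1
  have hn0 : n ≠ 0 := by
    intro h0
    rw [h0, pow_zero, one_mul, inter_eq_right.2 hc, two_mul] at hn1
    have hpos : volume (closedBall c r₀) ≠ 0 := (measure_closedBall_pos _ _ hr₀).ne'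
    have := ENNReal.lt_add_right (measure_closedBall_lt_top (μ := volume) (x := c) (r := r₀)).ne hpos
    exact absurd hn1 (not_le.2 this)
  obtain ⟨m, hm⟩ := Nat.exists_eq_succ_of_ne_zero hn0
  have hm1 := Nat.find_min hex (m := m) (by omega)
  rw [not_le] at hm1
  have h8 : volume (closedBall c (2 ^ n * r₀)) ≤ 8 * volume (E ∩ closedBall c (2 ^ n * r₀)) := by
    have hr : (2 : ℝ) ^ n * r₀ = 2 * (2 ^ m * r₀) := by rw [hm, pow_succ]; ring
    calc volume (closedBall c (2 ^ n * r₀)) = 4 * volume (closedBall c (2 ^ m * r₀)) := by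
          rw [EuclideanSpace.volume_closedBall_fin_two, EuclideanSpace.volume_closedBall_fin_two,
            hr, ENNReal.ofReal_mul (by norm_num), ENNReal.ofReal_ofNat]
          ring
      _ ≤ 4 * (2 * volume (E ∩ closedBall c (2 ^ m * r₀))) := by gcongr
      _ = 8 * volume (E ∩ closedBall c (2 ^ m * r₀)) := by ring
      _ ≤ _ := by
          gcongr 8 * volume (E ∩ closedBall c ?_)
          rw [hr]
          linarith [show (0 : ℝ) < 2 ^ m * r₀ by positivity]
  refine ⟨2 ^ n * r₀, le_mul_of_one_le_left hr₀.le (one_le_pow₀ one_le_two), ?_, hn1, h8⟩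
  by_contra! hlt
  have : volume (closedBall c (2 ^ n * r₀)) ≤ 8 * volume E :=
    h8.trans (by gcongr; exact inter_subset_left)
  exact absurd this (not_le.2 (hlarge _ hlt))

/-- A smooth form of Gustin's boxing inequality, for a measure of linear growth on `S`. -/
theorem measure_le_lintegral_fderiv {ν : Measure Plane} {Λ : ℝ≥0∞} {S E T : Set Plane}
    (hν : ∀ x ∈ S, ∀ r > 0, ν (closedBall x r) ≤ Λ * ENNReal.ofReal r)
    (hE : MeasurableSet E) (hEv : volume E ≠ ⊤) (hT : MeasurableSet T) {r₀ : ℝ} (hr₀ : 0 < r₀)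
    (hS : ∀ x ∈ S, closedBall x r₀ ⊆ E)
    (hTv : 16 * volume T ≤ volume (closedBall (0 : Plane) r₀))
    {u : Plane → ℝ} (hu : ContDiff ℝ 1 u) (hu0 : ∀ x ∉ E, u x = 0) (hu1 : ∀ x ∈ E \ T, u x = 1) :
    ν S ≤ 1280 * Λ * ∫⁻ x, ‖fderiv ℝ u x‖ₑ := by
  choose! r hr₀r hrR hr2 hr8 using fun x hx => exists_closedBall_balanced hEv hr₀ (hS x hx)
  have hrpos : ∀ x ∈ S, 0 < r x := fun x hx => hr₀.trans_le (hr₀r x hx)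
  have hmass : ∀ x ∈ S, ENNReal.ofReal (r x) ≤
      256 * ∫⁻ y in closedBall x (r x), ‖fderiv ℝ u y‖ₑ := by
    intro x hx
    have hBt : volume (closedBall x (r x)) ≠ ⊤ := measure_closedBall_lt_top.ne
    have hBm : MeasurableSet (closedBall x (r x)) := isClosed_closedBall.measurableSet
    have hTB : 16 * volume T ≤ volume (closedBall x (r x)) := by
      refine hTv.trans ?_
      rw [EuclideanSpace.volume_closedBall_fin_two, EuclideanSpace.volume_closedBall_fin_two]
      gcongr
      exact hr₀r x hx
    refine ofReal_le_lintegral_fderiv hu (hrpos x hx) (Z := closedBall x (r x) \ E)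
      (F := (E ∩ closedBall x (r x)) \ T) sdiff_subset
      (sdiff_subset.trans inter_subset_right) (hBm.diff hE) ((hE.inter hBm).diff hT)
      (fun y hy => hu0 y hy.2) (fun y hy => hu1 y ⟨hy.1.1, hy.2⟩) ?_ ?_
    · have hsplit := measure_inter_add_sdiff (μ := volume) (closedBall x (r x)) hE
      rw [inter_comm] at hsplit
      have h2 := hr2 x hx
      have ha : volume (E ∩ closedBall x (r x)) ≠ ⊤ := measure_ne_top_of_subset inter_subset_left hEv
      rw [← hsplit, two_mul] at h2
      have h3 := (ENNReal.add_le_add_iff_left ha).1 h2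
      calc volume (closedBall x (r x)) = _ := hsplit.symm
        _ ≤ volume (closedBall x (r x) \ E) + volume (closedBall x (r x) \ E) := by gcongr
        _ = _ := (two_mul _).symm
    · have h4 : volume (E ∩ closedBall x (r x)) ≤
          volume ((E ∩ closedBall x (r x)) \ T) + volume T :=
        (measure_mono (subset_sdiff_union _ T)).trans (measure_union_le _ _)
      have h5 : volume (closedBall x (r x)) + volume (closedBall x (r x)) ≤
          volume (closedBall x (r x)) + 16 * volume ((E ∩ closedBall x (r x)) \ T) := by
        calc volume (closedBall x (r x)) + volume (closedBall x (r x))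
            = 2 * volume (closedBall x (r x)) := (two_mul _).symm
          _ ≤ 2 * (8 * (volume ((E ∩ closedBall x (r x)) \ T) + volume T)) := by
              gcongr
              exact (hr8 x hx).trans (by gcongr)
          _ = 16 * volume T + 16 * volume ((E ∩ closedBall x (r x)) \ T) := by ring
          _ ≤ _ := by gcongr
      exact (ENNReal.add_le_add_iff_left hBt).1 h5
  obtain ⟨A, hAS, hdisj, hcov⟩ :=
    Vitali.exists_disjoint_subfamily_covering_enlargement_closedBall S id r _ hrR 5 (by norm_num)
  simp only [id] at hdisj hcov
  have hA : A.Countable := by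
    refine hdisj.countable_of_nonempty_interior fun x hx => ?_
    exact ⟨x, ball_subset_interior_closedBall (mem_ball_self (hrpos x (hAS hx)))⟩
  have hsub : S ⊆ ⋃ x ∈ A, closedBall x (5 * r x) := by
    intro x hx
    obtain ⟨y, hy, hxy⟩ := hcov x hx
    exact mem_biUnion hy (hxy (mem_closedBall_self (hrpos x hx).le))
  calc ν S ≤ ∑' x : A, ν (closedBall x (5 * r x)) :=
        (measure_mono hsub).trans (measure_biUnion_le _ hA _)
    _ ≤ ∑' x : A, 1280 * Λ * ∫⁻ y in closedBall (x : Plane) (r x), ‖fderiv ℝ u y‖ₑ := by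
        refine ENNReal.tsum_le_tsum fun x => ?_
        have hx := hAS x.2
        calc ν (closedBall (x : Plane) (5 * r x)) ≤ Λ * ENNReal.ofReal (5 * r x) :=
              hν x hx _ (by linarith [hrpos x hx])
          _ = 5 * Λ * ENNReal.ofReal (r x) := by
              rw [ENNReal.ofReal_mul (by norm_num), ENNReal.ofReal_ofNat]; ring
          _ ≤ 5 * Λ * (256 * ∫⁻ y in closedBall (x : Plane) (r x), ‖fderiv ℝ u y‖ₑ) := by
              gcongr; exact hmass x hx
          _ = _ := by ring
    _ = 1280 * Λ * ∫⁻ y in ⋃ x ∈ A, closedBall x (r x), ‖fderiv ℝ u y‖ₑ := by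
        rw [ENNReal.tsum_mul_left, lintegral_biUnion hA
          (fun x _ => isClosed_closedBall.measurableSet) hdisj]
    _ ≤ _ := by gcongr; exact Measure.restrict_le_self

theorem lintegral_enorm_deriv_smoothTransition_ne_top :
    ∫⁻ s, ‖deriv Real.smoothTransition s‖ₑ ≠ ⊤ := by
  have hcont : Continuous (deriv Real.smoothTransition) :=
    (Real.smoothTransition.contDiff (n := 1)).continuous_deriv (by simp)
  have hsupp : HasCompactSupport (deriv Real.smoothTransition) := by
    refine HasCompactSupport.intro (isCompact_Icc (a := (0 : ℝ)) (b := 1)) fun x hx => ?_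
    rcases lt_or_ge x 0 with h | h
    · have : Real.smoothTransition =ᶠ[𝓝 x] fun _ => 0 := by
        filter_upwards [Iio_mem_nhds h] with y hy
        exact Real.smoothTransition.zero_of_nonpos (le_of_lt hy)
      rw [this.deriv_eq, deriv_const]
    · have h1 : 1 < x := by
        by_contra! h1
        exact hx ⟨h, h1⟩
      have : Real.smoothTransition =ᶠ[𝓝 x] fun _ => 1 := by
        filter_upwards [Ioi_mem_nhds h1] with y hy
        exact Real.smoothTransition.one_of_one_le (le_of_lt hy)
      rw [this.deriv_eq, deriv_const]
  exact (hcont.integrable_of_hasCompactSupport hsupp).2.ne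

theorem lintegral_comp_mul_sub {h : ℝ → ℝ≥0∞} (hh : Measurable h) {n : ℝ} (hn : 0 < n) (a : ℝ) :
    ∫⁻ t, ENNReal.ofReal n * h (n * (a - t)) = ∫⁻ s, h s := by
  rw [lintegral_sub_left_eq_self (fun t => ENNReal.ofReal n * h (n * t)) a,
    lintegral_const_mul' _ _ ENNReal.ofReal_ne_top]
  conv_rhs => rw [← Real.smul_map_volume_mul_left hn.ne', lintegral_smul_measure,
    lintegral_map hh (by fun_prop), abs_of_pos hn, smul_eq_mul]

/-- The area density of `‖∇w‖` near the level `t`, at scale `1 / (n + 1)`. -/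
noncomputable def levelDensity (w : Plane → ℝ) (n : ℕ) (t : ℝ) : ℝ≥0∞ :=
  ∫⁻ x, ENNReal.ofReal (n + 1) * ‖deriv Real.smoothTransition ((n + 1) * (w x - t))‖ₑ *
    ‖fderiv ℝ w x‖ₑ

theorem measurable_levelDensity_integrand {w : Plane → ℝ} (hw : ContDiff ℝ 1 w) (n : ℕ) :
    Measurable fun q : ℝ × Plane => ENNReal.ofReal (n + 1) *
      ‖deriv Real.smoothTransition ((n + 1) * (w q.2 - q.1))‖ₑ * ‖fderiv ℝ w q.2‖ₑ := by
  have h1 : Measurable w := hw.continuous.measurable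
  have h2 : Measurable (fderiv ℝ w) := (hw.continuous_fderiv one_ne_zero).measurable
  have h3 : Measurable (deriv Real.smoothTransition) := measurable_deriv _
  fun_prop

theorem measurable_levelDensity {w : Plane → ℝ} (hw : ContDiff ℝ 1 w) (n : ℕ) :
    Measurable (levelDensity w n) :=
  (measurable_levelDensity_integrand hw n).lintegral_prod_right'

theorem lintegral_levelDensity {w : Plane → ℝ} (hw : ContDiff ℝ 1 w) (n : ℕ) :
    ∫⁻ t, levelDensity w n t =
      (∫⁻ s, ‖deriv Real.smoothTransition s‖ₑ) * ∫⁻ x, ‖fderiv ℝ w x‖ₑ := by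
  unfold levelDensity
  rw [lintegral_lintegral_swap (measurable_levelDensity_integrand hw n).aemeasurable,
    ← lintegral_const_mul _ (hw.continuous_fderiv one_ne_zero).measurable.enorm]
  congr 1 with x
  rw [lintegral_mul_const' _ _ enorm_ne_top,
    lintegral_comp_mul_sub (measurable_deriv Real.smoothTransition).enorm (by positivity)]

theorem lintegral_enorm_fderiv_smoothTransition {w : Plane → ℝ} (hw : ContDiff ℝ 1 w) (n : ℕ)
    (t : ℝ) :
    ∫⁻ x, ‖fderiv ℝ (fun y => Real.smoothTransition ((n + 1) * (w y - t))) x‖ₑ =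
      levelDensity w n t := by
  unfold levelDensity
  congr 1 with x
  have hd : HasFDerivAt (fun y => ((n : ℝ) + 1) * (w y - t)) (((n : ℝ) + 1) • fderiv ℝ w x) x :=
    (((hw.differentiable one_ne_zero x).hasFDerivAt).sub_const t).const_mul _
  have hs : HasDerivAt Real.smoothTransition
      (deriv Real.smoothTransition ((n + 1) * (w x - t))) ((n + 1) * (w x - t)) :=
    ((Real.smoothTransition.contDiff (n := 1)).differentiable (by simp) _).hasDerivAt
  have := (hs.comp_hasFDerivAt x hd).fderiv
  simp only [Function.comp_def] at this
  rw [this, enorm_smul, enorm_smul, Real.enorm_of_nonneg (by positivity : (0 : ℝ) ≤ n + 1)]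
  ring

theorem measure_levelSet_le_liminf {ν : Measure Plane} {Λ : ℝ≥0∞} {K : Set Plane}
    (hν : ∀ x ∈ K, ∀ r > 0, ν (closedBall x r) ≤ Λ * ENNReal.ofReal r) (hΛ : Λ ≠ ⊤)
    {w : Plane → ℝ} (hw : ContDiff ℝ 1 w) (hws : HasCompactSupport w) {t : ℝ} (ht : 0 < t) :
    ν (K ∩ {x | t < w x}) ≤ 1280 * Λ * liminf (fun n => levelDensity w n t) atTop := by
  set E := {x | t < w x}
  have hE : MeasurableSet E := (isOpen_lt continuous_const hw.continuous).measurableSet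
  have hEv : volume E ≠ ⊤ := by
    have hsub : E ⊆ tsupport w := fun x (hx : t < w x) =>
      subset_tsupport w (ht.trans hx).ne'
    exact measure_ne_top_of_subset hsub hws.isCompact.measure_lt_top.ne
  obtain ⟨L, hL⟩ := hw.lipschitzWith_of_hasCompactSupport hws one_ne_zero
  have hδ : ∀ δ > 0, ν (K ∩ {x | t + δ ≤ w x}) ≤
      1280 * Λ * liminf (fun n => levelDensity w n t) atTop := by
    intro δ hδ
    set r₀ : ℝ := δ / (2 * (L + 1))
    have hr₀ : 0 < r₀ := by positivity
    have hball : ∀ x ∈ K ∩ {x | t + δ ≤ w x}, closedBall x r₀ ⊆ E := by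
      intro x hx y hy
      have h1 := hL.dist_le_mul x y
      rw [mem_closedBall'] at hy
      have h2 : (L : ℝ) * dist x y ≤ δ / 2 := by
        calc (L : ℝ) * dist x y ≤ (L + 1) * r₀ := by gcongr; linarith
          _ = δ / 2 := by simp only [r₀]; field_simp
      have h3 := (abs_le.1 (Real.dist_eq (w x) (w y) ▸ h1.trans h2)).2
      have h4 : t + δ ≤ w x := hx.2
      change t < w y
      linarith
    set T : ℕ → Set Plane := fun n => {x | t < w x ∧ w x < t + 1 / ((n : ℝ) + 1)}
    have hT : ∀ n, MeasurableSet (T n) := fun n =>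
      ((isOpen_lt continuous_const hw.continuous).inter
        (isOpen_lt hw.continuous continuous_const)).measurableSet
    have hTanti : Antitone T := by
      intro m n hmn x hx
      refine ⟨hx.1, hx.2.trans_le ?_⟩
      gcongr
    have hTempty : ⋂ n, T n = ∅ := by
      rw [eq_empty_iff_forall_notMem]
      intro x hx
      rw [mem_iInter] at hx
      obtain ⟨n, hn⟩ := exists_nat_one_div_lt (sub_pos.2 (hx 0).1)
      linarith [(hx n).2]
    have hlim : Tendsto (fun n => 16 * volume (T n)) atTop (𝓝 0) := by
      have := tendsto_measure_iInter_atTop (μ := volume) (fun n => (hT n).nullMeasurableSet) hTanti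
        ⟨0, measure_ne_top_of_subset (fun x hx => hx.1) hEv⟩
      rw [hTempty, measure_empty] at this
      simpa using ENNReal.Tendsto.const_mul (a := 16) this (Or.inr (by simp))
    have hev : ∀ᶠ n in atTop, 16 * volume (T n) < volume (closedBall (0 : Plane) r₀) :=
      hlim.eventually_lt_const (measure_closedBall_pos _ _ hr₀)
    rw [← ENNReal.liminf_const_mul_of_ne_top (by finiteness)]
    refine le_liminf_of_le (by isBoundedDefault) ?_
    filter_upwards [hev] with n hn
    rw [← lintegral_enorm_fderiv_smoothTransition hw]
    refine measure_le_lintegral_fderiv (fun x hx => hν x hx.1) hE hEv (hT n) hr₀ hball hn.le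
      (Real.smoothTransition.contDiff.comp (by fun_prop)) ?_ ?_
    · intro x hx
      have : w x - t ≤ 0 := by simpa [E] using hx
      exact Real.smoothTransition.zero_of_nonpos
        (mul_nonpos_of_nonneg_of_nonpos (by positivity) this)
    · rintro x ⟨hx, hxT⟩
      have h1 : t + 1 / ((n : ℝ) + 1) ≤ w x := by
        by_contra! h
        exact hxT ⟨hx, h⟩
      refine Real.smoothTransition.one_of_one_le ?_
      rw [← div_le_iff₀' (by positivity)]
      linarith
  have hmono : Monotone fun n : ℕ => K ∩ {x | t + 1 / ((n : ℝ) + 1) ≤ w x} := by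
    intro m n hmn x hx
    have h : t + 1 / ((m : ℝ) + 1) ≤ w x := hx.2
    refine ⟨hx.1, show t + 1 / ((n : ℝ) + 1) ≤ w x from le_trans ?_ h⟩
    gcongr
  have hunion : K ∩ E = ⋃ n : ℕ, K ∩ {x | t + 1 / ((n : ℝ) + 1) ≤ w x} := by
    rw [← inter_iUnion]
    congr 1
    ext x
    simp only [E, mem_ofPred_eq, mem_iUnion]
    constructor
    · intro h
      obtain ⟨n, hn⟩ := exists_nat_one_div_lt (sub_pos.2 h)
      exact ⟨n, by linarith⟩
    · rintro ⟨n, hn⟩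
      have : 0 < 1 / ((n : ℝ) + 1) := by positivity
      linarith
  rw [hunion, hmono.measure_iUnion]
  exact iSup_le fun n => hδ _ (by positivity)

/-- The Meyers–Ziemer trace inequality in the plane, for the positive part. -/
theorem lintegral_ofReal_le {ν : Measure Plane} {Λ : ℝ≥0∞} {K : Set Plane}
    (hν : ∀ x ∈ K, ∀ r > 0, ν (closedBall x r) ≤ Λ * ENNReal.ofReal r) (hΛ : Λ ≠ ⊤)
    (hK : ν Kᶜ = 0) {w : Plane → ℝ} (hw : ContDiff ℝ 1 w) (hws : HasCompactSupport w) :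
    ∫⁻ x, ENNReal.ofReal (w x) ∂ν ≤
      1280 * Λ * ((∫⁻ s, ‖deriv Real.smoothTransition s‖ₑ) * ∫⁻ x, ‖fderiv ℝ w x‖ₑ) := by
  have hc : 1280 * Λ ≠ ⊤ := by finiteness
  calc ∫⁻ x, ENNReal.ofReal (w x) ∂ν = ∫⁻ x, ENNReal.ofReal (max (w x) 0) ∂ν := by
        congr 1 with x
        rcases le_total (w x) 0 with h | h
        · rw [max_eq_right h, ENNReal.ofReal_of_nonpos h, ENNReal.ofReal_zero]
        · rw [max_eq_left h]
    _ = ∫⁻ t in Ioi 0, ν {x | t < max (w x) 0} :=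
        lintegral_eq_lintegral_meas_lt ν (ae_of_all _ fun x => le_max_right _ _)
          (hw.continuous.max continuous_const).measurable.aemeasurable
    _ ≤ ∫⁻ t in Ioi 0, 1280 * Λ * liminf (fun n => levelDensity w n t) atTop := by
        refine setLIntegral_mono' measurableSet_Ioi fun t ht => ?_
        have ht : 0 < t := ht
        refine le_trans ?_ (measure_levelSet_le_liminf hν hΛ hw hws ht)
        have hsub : {x | t < max (w x) 0} ⊆ (K ∩ {x | t < w x}) ∪ Kᶜ := by
          intro x hx
          have : t < w x := (lt_max_iff.1 hx).resolve_right ht.not_gt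
          by_cases hxK : x ∈ K
          · exact Or.inl ⟨hxK, this⟩
          · exact Or.inr hxK
        calc _ ≤ _ := measure_mono hsub
          _ ≤ _ := measure_union_le _ _
          _ = _ := by rw [hK, add_zero]
    _ ≤ ∫⁻ t, 1280 * Λ * liminf (fun n => levelDensity w n t) atTop :=
        setLIntegral_le_lintegral _ _
    _ = 1280 * Λ * ∫⁻ t, liminf (fun n => levelDensity w n t) atTop :=
        lintegral_const_mul' _ _ hc
    _ ≤ 1280 * Λ * liminf (fun n => ∫⁻ t, levelDensity w n t) atTop := by
        gcongr
        exact lintegral_liminf_le fun n => measurable_levelDensity hw n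
    _ = _ := by simp_rw [lintegral_levelDensity hw, liminf_const]

theorem measure_closedBall_le_ahlforsConst (K : Set Plane) {x : Plane} (hx : x ∈ K) {r : ℝ}
    (hr : 0 < r) :
    (μH[1] : Measure Plane).restrict K (closedBall x r) ≤
      2 * ahlforsConst K * ENNReal.ofReal r := by
  have h2r : 0 < 2 * r := by linarith
  have hle : μH[1] (K ∩ ball x (2 * r)) / ENNReal.ofReal (2 * r) ≤ ahlforsConst K :=
    le_iSup_of_le x <| le_iSup_of_le hx <| le_iSup_of_le (2 * r) <| le_iSup_of_le h2r le_rfl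
  rw [ENNReal.div_le_iff (by simpa using hr) ENNReal.ofReal_ne_top] at hle
  rw [Measure.restrict_apply isClosed_closedBall.measurableSet, inter_comm]
  calc μH[1] (K ∩ closedBall x r) ≤ μH[1] (K ∩ ball x (2 * r)) := by
        gcongr
        exact closedBall_subset_ball (by linarith)
    _ ≤ ahlforsConst K * ENNReal.ofReal (2 * r) := hle
    _ = _ := by rw [ENNReal.ofReal_mul (by norm_num), ENNReal.ofReal_ofNat]; ring

theorem lintegral_enorm_le_ahlforsConst {K : Set Plane} (hK : IsCompact K)
    (hΛ : ahlforsConst K < ⊤) {w : Plane → ℝ} (hw : ContDiff ℝ 1 w) (hws : HasCompactSupport w) :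
    ∫⁻ x in K, ‖w x‖ₑ ∂μH[1] ≤ 5120 * (∫⁻ s, ‖deriv Real.smoothTransition s‖ₑ) *
      ahlforsConst K * ∫⁻ x, ‖fderiv ℝ w x‖ₑ := by
  have hν := fun x hx r (hr : r > 0) => measure_closedBall_le_ahlforsConst K (x := x) hx hr
  have hΛ2 : 2 * ahlforsConst K ≠ ⊤ := by finiteness
  have hKc : (μH[1] : Measure Plane).restrict K Kᶜ = 0 := by
    rw [Measure.restrict_apply hK.measurableSet.compl, compl_inter_self, measure_empty]
  have hpos := lintegral_ofReal_le hν hΛ2 hKc hw hws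
  have hneg := lintegral_ofReal_le hν hΛ2 hKc hw.neg hws.neg
  have hd : ∀ x, ‖fderiv ℝ (fun y => -w y) x‖ₑ = ‖fderiv ℝ w x‖ₑ := fun x => by
    rw [fderiv_fun_neg, enorm_neg]
  simp only [hd] at hneg
  calc ∫⁻ x in K, ‖w x‖ₑ ∂μH[1]
      = ∫⁻ x in K, (ENNReal.ofReal (w x) + ENNReal.ofReal (-w x)) ∂μH[1] := by
        congr 1 with x
        rw [Real.enorm_eq_ofReal_abs]
        rcases le_total (w x) 0 with h | h
        · rw [abs_of_nonpos h, ENNReal.ofReal_of_nonpos h, zero_add]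
        · rw [abs_of_nonneg h, ENNReal.ofReal_of_nonpos (neg_nonpos.2 h), add_zero]
    _ = _ := lintegral_add_left hw.continuous.measurable.ennreal_ofReal _
    _ ≤ _ := add_le_add hpos hneg
    _ = _ := by ring

theorem stmt9 :
    ∃ C : ℝ, 0 < C ∧
      ∀ K : Set Plane, IsCompact K → IsConnected K → μH[1] K < ⊤ → ahlforsConst K < ⊤ →
        ∀ w : Plane → ℝ, ContDiff ℝ 1 w → HasCompactSupport w →
          ∫ z in K, |w z| ∂μH[1] ≤
            C * (ahlforsConst K).toReal * ((∫ x, |w x|) + ∫ x, ‖gradient w x‖) := by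
  set M := ∫⁻ s, ‖deriv Real.smoothTransition s‖ₑ
  have hM : M ≠ ⊤ := lintegral_enorm_deriv_smoothTransition_ne_top
  refine ⟨5120 * M.toReal + 1, by positivity, ?_⟩
  intro K hK _ _ hΛ w hw hws
  have hgrad : ∀ x, ‖gradient w x‖ = ‖fderiv ℝ w x‖ := fun x => by simp [gradient]
  have hint : Integrable (fderiv ℝ w) :=
    (hw.continuous_fderiv one_ne_zero).integrable_of_hasCompactSupport (hws.fderiv ℝ)
  have hfin : ∫⁻ x, ‖fderiv ℝ w x‖ₑ ≠ ⊤ := hint.2.ne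
  have hmain := ENNReal.toReal_mono (by finiteness) (lintegral_enorm_le_ahlforsConst hK hΛ hw hws)
  simp only [ENNReal.toReal_mul, ENNReal.toReal_ofNat,
    ← integral_norm_eq_lintegral_enorm hw.continuous.aestronglyMeasurable,
    ← integral_norm_eq_lintegral_enorm hint.1, Real.norm_eq_abs] at hmain
  simp only [hgrad]
  have h0 : 0 ≤ ∫ x, |w x| := integral_nonneg fun _ => abs_nonneg _
  have h1 : 0 ≤ ∫ x, ‖fderiv ℝ w x‖ := integral_nonneg fun _ => norm_nonneg _
  refine hmain.trans ?_
  gcongr <;> linarith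
end

section
/- There exists a universal constant C > 0 such that the following holds: for every compact, connected set K ⊆ ℝ² with H¹(K) < ∞ and Λ_K := sup{ H¹(K ∩ B(z,r))/r : z ∈ K, r > 0 } < ∞, and all continuously differentiable compactly supported functions v₁, v₂ : ℝ² → ℝ, one has ∫_K |v₁ v₂| dH¹ ≤ C Λ_K ‖v₁‖_{H¹(ℝ²)} ‖v₂‖_{H¹(ℝ²)}, where ‖v‖_{H¹(ℝ²)} := ( ∫_{ℝ²} (v(x)² + ‖∇v(x)‖²) dx )^{1/2}. -/
open MeasureTheory Set
open scoped ENNReal NNReal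

theorem norm_gradient_eq_norm_fderiv (v : Plane → ℝ) (x : Plane) :
    ‖gradient v x‖ = ‖fderiv ℝ v x‖ := by
  simp [gradient]

theorem hausdorffMeasure_inter_ball_le {K : Set Plane} (y : Plane) {t : ℝ} (ht : 0 < t) :
    μH[1] (K ∩ Metric.ball y t) ≤ 2 * ahlforsConst K * ENNReal.ofReal t := by
  rcases (K ∩ Metric.ball y t).eq_empty_or_nonempty with h | ⟨z, hzK, hz⟩
  · simp [h]
  have hsub : Metric.ball y t ⊆ Metric.ball z (2 * t) :=
    Metric.ball_subset_ball' (by rw [Metric.mem_ball'] at hz; linarith)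
  have h1 : μH[1] (K ∩ Metric.ball z (2 * t)) / ENNReal.ofReal (2 * t) ≤ ahlforsConst K :=
    le_iSup₂_of_le z hzK (le_iSup₂_of_le (2 * t) (by positivity) le_rfl)
  rw [ENNReal.div_le_iff (by simp [ht]) ENNReal.ofReal_ne_top] at h1
  calc μH[1] (K ∩ Metric.ball y t) ≤ μH[1] (K ∩ Metric.ball z (2 * t)) := by gcongr
    _ ≤ ahlforsConst K * ENNReal.ofReal (2 * t) := h1
    _ = 2 * ahlforsConst K * ENNReal.ofReal t := by
      rw [ENNReal.ofReal_mul (by norm_num), ENNReal.ofReal_ofNat]; ring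

theorem lintegral_ball_comp_add_smul (g : Plane → ℝ≥0∞) (hg : Measurable g) (x : Plane)
    {t : ℝ} (ht : 0 < t) :
    ∫⁻ w in Metric.ball 0 1, g (x + t • w) =
      ENNReal.ofReal (t ^ 2)⁻¹ * ∫⁻ y in Metric.ball x t, g y := by
  have hF : Measurable ((Metric.ball x t).indicator g) :=
    hg.indicator Metric.isOpen_ball.measurableSet
  have hmap := Measure.map_addHaar_smul (volume : Measure Plane) ht.ne'
  calc ∫⁻ w in Metric.ball 0 1, g (x + t • w)
      = ∫⁻ w, (Metric.ball x t).indicator g (x + t • w) := by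
        rw [← lintegral_indicator Metric.isOpen_ball.measurableSet]
        congr 1 with w
        have : x + t • w ∈ Metric.ball x t ↔ w ∈ Metric.ball (0 : Plane) 1 := by
          simp [norm_smul, abs_of_pos ht, ht]
        by_cases hw : w ∈ Metric.ball (0 : Plane) 1
        · rw [indicator_of_mem hw, indicator_of_mem (this.2 hw)]
        · rw [indicator_of_notMem hw, indicator_of_notMem (mt this.1 hw)]
    _ = ∫⁻ w, (Metric.ball x t).indicator g (x + w) ∂(Measure.map (t • ·) volume) := by
        exact (lintegral_map (f := fun w ↦ (Metric.ball x t).indicator g (x + w))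
          (hF.comp (measurable_const_add x)) (measurable_const_smul t)).symm
    _ = _ := by
        rw [hmap, lintegral_smul_measure, lintegral_add_left_eq_self,
          lintegral_indicator Metric.isOpen_ball.measurableSet]
        simp [abs_of_pos ht]

theorem lintegral_lintegral_ball_le (ν : Measure Plane) [SFinite ν] {M : ℝ≥0∞}
    (hν : ∀ y : Plane, ∀ t : ℝ, 0 < t → ν (Metric.ball y t) ≤ M * ENNReal.ofReal t)
    (g : Plane → ℝ≥0∞) (hg : Measurable g) {t : ℝ} (ht : 0 < t) :
    ∫⁻ x, (∫⁻ w in Metric.ball 0 1, g (x + t • w)) ∂ν ≤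
      ENNReal.ofReal t⁻¹ * (M * ∫⁻ y, g y) := by
  have hS : MeasurableSet {p : Plane × Plane | p.2 ∈ Metric.ball p.1 t} :=
    measurableSet_lt (f := fun p : Plane × Plane ↦ dist p.2 p.1) (g := fun _ ↦ t)
      (by fun_prop) (by fun_prop)
  have hm : Measurable fun p : Plane × Plane ↦ (Metric.ball p.1 t).indicator g p.2 :=
    (hg.comp measurable_snd).indicator hS
  have hswap : ∫⁻ x, (∫⁻ y in Metric.ball x t, g y) ∂ν ≤
      ENNReal.ofReal t * (M * ∫⁻ y, g y) := by
    calc ∫⁻ x, (∫⁻ y in Metric.ball x t, g y) ∂ν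
        = ∫⁻ x, (∫⁻ y, (Metric.ball x t).indicator g y) ∂ν := by
          simp_rw [lintegral_indicator Metric.isOpen_ball.measurableSet]
      _ = ∫⁻ y, (∫⁻ x, (Metric.ball x t).indicator g y ∂ν) :=
          lintegral_lintegral_swap hm.aemeasurable
      _ = ∫⁻ y, g y * ν (Metric.ball y t) := by
          congr 1 with y
          rw [← lintegral_indicator_const Metric.isOpen_ball.measurableSet]
          congr 1 with x
          simp only [indicator, Metric.mem_ball, dist_comm]
      _ ≤ ∫⁻ y, (ENNReal.ofReal t * M) * g y := by
          refine lintegral_mono fun y ↦ ?_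
          calc g y * ν (Metric.ball y t) ≤ g y * (M * ENNReal.ofReal t) := by
                gcongr; exact hν y t ht
            _ = ENNReal.ofReal t * M * g y := by ring
      _ = _ := by rw [lintegral_const_mul _ hg, mul_assoc]
  simp_rw [lintegral_ball_comp_add_smul g hg _ ht]
  rw [lintegral_const_mul' _ _ ENNReal.ofReal_ne_top]
  calc _ ≤ ENNReal.ofReal (t ^ 2)⁻¹ * (ENNReal.ofReal t * (M * ∫⁻ y, g y)) := by gcongr
    _ = _ := by
      rw [← mul_assoc, ← ENNReal.ofReal_mul (by positivity)]
      congr 2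
      field_simp

theorem sq_intervalIntegral_le_intervalIntegral_sq {f : ℝ → ℝ} (hf : Continuous f) :
    (∫ s in (0 : ℝ)..1, f s) ^ 2 ≤ ∫ s in (0 : ℝ)..1, f s ^ 2 := by
  set m := ∫ s in (0 : ℝ)..1, f s with hm
  have h0 : 0 ≤ ∫ s in (0 : ℝ)..1, (f s - m) ^ 2 :=
    intervalIntegral.integral_nonneg zero_le_one fun s _ ↦ sq_nonneg _
  have h1 : ∫ s in (0 : ℝ)..1, (f s - m) ^ 2 =
      (∫ s in (0 : ℝ)..1, f s ^ 2) - 2 * m * m + m ^ 2 := by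
    have : ∀ s, (f s - m) ^ 2 = f s ^ 2 - 2 * m * f s + m ^ 2 := fun s ↦ by ring
    simp_rw [this]
    rw [intervalIntegral.integral_add, intervalIntegral.integral_sub,
      intervalIntegral.integral_const_mul, intervalIntegral.integral_const, ← hm]
    · simp
    all_goals exact Continuous.intervalIntegrable (by fun_prop) _ _
  nlinarith

theorem sq_sub_le_integral_sq_fderiv {v : Plane → ℝ} (hv : ContDiff ℝ 1 v) (x : Plane)
    {w : Plane} (hw : ‖w‖ ≤ 1) :
    (v (x + w) - v x) ^ 2 ≤
      ∫ s in (0 : ℝ)..1, 4 * s ^ 2 * ‖fderiv ℝ v (x + s ^ 2 • w)‖ ^ 2 := by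
  have hd : Continuous (fderiv ℝ v) := hv.continuous_fderiv one_ne_zero
  set f : ℝ → ℝ := fun s ↦ fderiv ℝ v (x + s ^ 2 • w) ((2 * s) • w) with hf
  have hfc : Continuous f := by
    have : Continuous fun s : ℝ ↦ fderiv ℝ v (x + s ^ 2 • w) := hd.comp (by fun_prop)
    exact this.clm_apply (by fun_prop)
  have hderiv : ∀ s : ℝ, HasDerivAt (fun s : ℝ ↦ v (x + s ^ 2 • w)) (f s) s := by
    intro s
    have h1 : HasDerivAt (fun s : ℝ ↦ x + s ^ 2 • w) ((2 * s) • w) s := by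
      simpa using ((hasDerivAt_pow 2 s).smul_const w).const_add x
    exact ((hv.differentiable one_ne_zero _).hasFDerivAt).comp_hasDerivAt s h1
  have hftc : ∫ s in (0 : ℝ)..1, f s = v (x + w) - v x := by
    rw [intervalIntegral.integral_eq_sub_of_hasDerivAt (fun s _ ↦ hderiv s)
      (hfc.intervalIntegrable _ _)]
    simp
  rw [← hftc]
  refine (sq_intervalIntegral_le_intervalIntegral_sq hfc).trans ?_
  refine intervalIntegral.integral_mono_on zero_le_one ((hfc.pow 2).intervalIntegrable _ _) ?_ ?_
  · refine Continuous.intervalIntegrable ?_ _ _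
    have : Continuous fun s : ℝ ↦ fderiv ℝ v (x + s ^ 2 • w) := hd.comp (by fun_prop)
    fun_prop
  · intro s hs
    have hb : |f s| ≤ ‖fderiv ℝ v (x + s ^ 2 • w)‖ * (2 * s) := by
      calc |f s| ≤ ‖fderiv ℝ v (x + s ^ 2 • w)‖ * ‖(2 * s) • w‖ :=
            (fderiv ℝ v (x + s ^ 2 • w)).le_opNorm _
        _ ≤ _ := by
          gcongr
          rw [norm_smul, Real.norm_of_nonneg (by linarith [hs.1])]
          exact mul_le_of_le_one_right (by linarith [hs.1]) hw
    calc f s ^ 2 = |f s| ^ 2 := (sq_abs _).symm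
      _ ≤ (‖fderiv ℝ v (x + s ^ 2 • w)‖ * (2 * s)) ^ 2 := by gcongr
      _ = _ := by ring

theorem ofReal_sq_le_add_lintegral_fderiv {v : Plane → ℝ} (hv : ContDiff ℝ 1 v) (x : Plane)
    {w : Plane} (hw : ‖w‖ ≤ 1) :
    ENNReal.ofReal (v x ^ 2) ≤ 2 * ENNReal.ofReal (v (x + w) ^ 2) +
      ∫⁻ s in Ioc (0 : ℝ) 1, ENNReal.ofReal (8 * s ^ 2) *
        ENNReal.ofReal (‖fderiv ℝ v (x + s ^ 2 • w)‖ ^ 2) := by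
  have hd : Continuous (fderiv ℝ v) := hv.continuous_fderiv one_ne_zero
  have hc : Continuous fun s : ℝ ↦ 4 * s ^ 2 * ‖fderiv ℝ v (x + s ^ 2 • w)‖ ^ 2 := by
    have : Continuous fun s : ℝ ↦ fderiv ℝ v (x + s ^ 2 • w) := hd.comp (by fun_prop)
    fun_prop
  have h := sq_sub_le_integral_sq_fderiv hv x hw
  set I := ∫ s in (0 : ℝ)..1, 4 * s ^ 2 * ‖fderiv ℝ v (x + s ^ 2 • w)‖ ^ 2 with hI
  have hreal : v x ^ 2 ≤ 2 * v (x + w) ^ 2 + 2 * I := by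
    nlinarith [sq_nonneg (2 * v (x + w) - v x)]
  have hIlin : ENNReal.ofReal (2 * I) = ∫⁻ s in Ioc (0 : ℝ) 1, ENNReal.ofReal (8 * s ^ 2) *
        ENNReal.ofReal (‖fderiv ℝ v (x + s ^ 2 • w)‖ ^ 2) := by
    rw [hI, ← intervalIntegral.integral_const_mul, intervalIntegral.integral_of_le zero_le_one,
      ofReal_integral_eq_lintegral_ofReal]
    · congr 1 with s
      rw [← ENNReal.ofReal_mul (by positivity)]
      congr 1
      ring
    · exact ((hc.const_smul (2 : ℝ)).intervalIntegrable 0 1).1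
    · exact Filter.Eventually.of_forall fun s ↦ by positivity
  calc ENNReal.ofReal (v x ^ 2) ≤ ENNReal.ofReal (2 * v (x + w) ^ 2 + 2 * I) :=
        ENNReal.ofReal_le_ofReal hreal
    _ ≤ ENNReal.ofReal (2 * v (x + w) ^ 2) + ENNReal.ofReal (2 * I) := ENNReal.ofReal_add_le
    _ = _ := by
      rw [hIlin, ENNReal.ofReal_mul (by norm_num), ENNReal.ofReal_ofNat]

/-- Trace inequality for measures of linear growth on the plane. -/
theorem lintegral_sq_le_of_measure_ball_le (ν : Measure Plane) [SFinite ν] {M : ℝ≥0∞}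
    (hν : ∀ y : Plane, ∀ t : ℝ, 0 < t → ν (Metric.ball y t) ≤ M * ENNReal.ofReal t)
    {v : Plane → ℝ} (hv : ContDiff ℝ 1 v) :
    ∫⁻ x, ENNReal.ofReal (v x ^ 2) ∂ν ≤
      8 * M * ∫⁻ x, ENNReal.ofReal (v x ^ 2 + ‖fderiv ℝ v x‖ ^ 2) := by
  have hd : Continuous (fderiv ℝ v) := hv.continuous_fderiv one_ne_zero
  have hvc : Continuous v := hv.continuous
  set B : Set Plane := Metric.ball 0 1 with hB
  set g : Plane → ℝ≥0∞ := fun x ↦ ENNReal.ofReal (v x ^ 2) with hg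
  set G : Plane → ℝ≥0∞ := fun x ↦ ENNReal.ofReal (‖fderiv ℝ v x‖ ^ 2) with hG
  have hgc : Continuous g := ENNReal.continuous_ofReal.comp (by fun_prop)
  have hGc : Continuous G := ENNReal.continuous_ofReal.comp (by fun_prop)
  have hvol : 1 ≤ volume B := by
    rw [hB, EuclideanSpace.volume_ball_fin_two]
    simp only [ENNReal.ofReal_one, one_pow, one_mul]
    exact ENNReal.one_le_ofReal.2 (by linarith [Real.pi_gt_three])
  have hg1 : ∫⁻ x, (∫⁻ w in B, g (x + w)) ∂ν ≤ M * ∫⁻ y, g y := by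
    simpa using lintegral_lintegral_ball_le ν hν g hgc.measurable one_pos
  have hmeas : Measurable fun p : (Plane × Plane) × ℝ ↦
      ENNReal.ofReal (8 * p.2 ^ 2) * G (p.1.1 + p.2 ^ 2 • p.1.2) := by
    fun_prop
  have hG1 : ∫⁻ x, (∫⁻ w in B, ∫⁻ s in Ioc (0 : ℝ) 1,
      ENNReal.ofReal (8 * s ^ 2) * G (x + s ^ 2 • w)) ∂ν ≤ 8 * (M * ∫⁻ y, G y) := by
    calc ∫⁻ x, (∫⁻ w in B, ∫⁻ s in Ioc (0 : ℝ) 1,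
          ENNReal.ofReal (8 * s ^ 2) * G (x + s ^ 2 • w)) ∂ν
        = ∫⁻ x, (∫⁻ s in Ioc (0 : ℝ) 1, ∫⁻ w in B,
          ENNReal.ofReal (8 * s ^ 2) * G (x + s ^ 2 • w)) ∂ν := by
          congr 1 with x
          refine lintegral_lintegral_swap (Measurable.aemeasurable ?_)
          exact hmeas.comp (f := fun q : Plane × ℝ ↦ ((x, q.1), q.2)) (by fun_prop)
      _ = ∫⁻ s in Ioc (0 : ℝ) 1, (∫⁻ x, (∫⁻ w in B,
          ENNReal.ofReal (8 * s ^ 2) * G (x + s ^ 2 • w)) ∂ν) := by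
          refine lintegral_lintegral_swap (Measurable.aemeasurable ?_)
          exact (hmeas.comp (f := fun q : (Plane × ℝ) × Plane ↦ ((q.1.1, q.2), q.1.2))
            (by fun_prop)).lintegral_prod_right'
      _ ≤ ∫⁻ s in Ioc (0 : ℝ) 1, 8 * (M * ∫⁻ y, G y) := by
          refine setLIntegral_mono' measurableSet_Ioc fun s hs ↦ ?_
          have hs2 : 0 < s ^ 2 := pow_pos hs.1 2
          simp_rw [lintegral_const_mul' _ _ (ENNReal.ofReal_ne_top (r := 8 * s ^ 2))]
          calc _ ≤ ENNReal.ofReal (8 * s ^ 2) *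
                (ENNReal.ofReal (s ^ 2)⁻¹ * (M * ∫⁻ y, G y)) := by
                gcongr
                exact lintegral_lintegral_ball_le ν hν G hGc.measurable hs2
            _ = _ := by
              rw [← mul_assoc, ← ENNReal.ofReal_mul (by positivity), mul_assoc 8,
                mul_inv_cancel₀ hs2.ne']
              simp
      _ = _ := by simp
  calc ∫⁻ x, g x ∂ν ≤ ∫⁻ x, (∫⁻ w in B, g x) ∂ν := by
        refine lintegral_mono fun x ↦ ?_
        rw [setLIntegral_const]
        exact le_mul_of_one_le_right' hvol
    _ ≤ ∫⁻ x, (∫⁻ w in B, (2 * g (x + w) + ∫⁻ s in Ioc (0 : ℝ) 1,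
          ENNReal.ofReal (8 * s ^ 2) * G (x + s ^ 2 • w))) ∂ν := by
        refine lintegral_mono fun x ↦ ?_
        refine setLIntegral_mono' Metric.isOpen_ball.measurableSet fun w hw ↦ ?_
        exact ofReal_sq_le_add_lintegral_fderiv hv x (mem_ball_zero_iff.1 hw).le
    _ = 2 * (∫⁻ x, (∫⁻ w in B, g (x + w)) ∂ν) + ∫⁻ x, (∫⁻ w in B, ∫⁻ s in Ioc (0 : ℝ) 1,
          ENNReal.ofReal (8 * s ^ 2) * G (x + s ^ 2 • w)) ∂ν := by
        have hm2 : Measurable fun p : Plane × Plane ↦ 2 * g (p.1 + p.2) := by fun_prop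
        rw [← lintegral_const_mul' _ _ (by simp), ← lintegral_add_left]
        · congr 1 with x
          have hx : Measurable fun w ↦ 2 * g (x + w) := by fun_prop
          rw [lintegral_add_left hx, lintegral_const_mul' _ _ (by simp)]
        · simp_rw [← lintegral_const_mul' _ _ (ENNReal.ofNat_ne_top (n := 2))]
          exact hm2.lintegral_prod_right'
    _ ≤ 8 * (M * ∫⁻ y, g y) + 8 * (M * ∫⁻ y, G y) := by
        gcongr
        norm_num
    _ = 8 * M * ∫⁻ x, ENNReal.ofReal (v x ^ 2 + ‖fderiv ℝ v x‖ ^ 2) := by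
        have : ∀ x, ENNReal.ofReal (v x ^ 2 + ‖fderiv ℝ v x‖ ^ 2) = g x + G x :=
          fun x ↦ ENNReal.ofReal_add (by positivity) (by positivity)
        simp_rw [this]
        rw [lintegral_add_left hgc.measurable]
        ring

theorem setIntegral_sq_le {K : Set Plane} (hK : μH[1] K < ⊤)
    (hΛ : ahlforsConst K < ⊤) {v : Plane → ℝ} (hv : ContDiff ℝ 1 v)
    (hs : HasCompactSupport v) :
    ∫ z in K, v z ^ 2 ∂μH[1] ≤
      16 * (ahlforsConst K).toReal * ∫ x, (v x ^ 2 + ‖gradient v x‖ ^ 2) := by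
  have : IsFiniteMeasure ((μH[1] : Measure Plane).restrict K) := ⟨by simpa using hK⟩
  have hd : Continuous (fderiv ℝ v) := hv.continuous_fderiv one_ne_zero
  have hvc : Continuous v := hv.continuous
  have hball : ∀ y : Plane, ∀ t : ℝ, 0 < t → (μH[1] : Measure Plane).restrict K
      (Metric.ball y t) ≤ 2 * ahlforsConst K * ENNReal.ofReal t := by
    intro y t ht
    rw [Measure.restrict_apply Metric.isOpen_ball.measurableSet, inter_comm]
    exact hausdorffMeasure_inter_ball_le y ht
  have key := lintegral_sq_le_of_measure_ball_le _ hball hv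
  simp_rw [norm_gradient_eq_norm_fderiv]
  have hint : Integrable fun x ↦ v x ^ 2 + ‖fderiv ℝ v x‖ ^ 2 := by
    refine Continuous.integrable_of_hasCompactSupport (by fun_prop) ?_
    refine HasCompactSupport.add (hs.comp_left (g := fun a : ℝ ↦ a ^ 2) (by simp))
      ((hs.fderiv ℝ).comp_left (g := fun a ↦ ‖a‖ ^ 2) (by simp))
  rw [← ofReal_integral_eq_lintegral_ofReal hint
    (Filter.Eventually.of_forall fun x ↦ by positivity)] at key
  rw [integral_eq_lintegral_of_nonneg_ae (Filter.Eventually.of_forall fun x ↦ by positivity)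
    (by fun_prop)]
  have hne : 8 * (2 * ahlforsConst K) *
      ENNReal.ofReal (∫ x, (v x ^ 2 + ‖fderiv ℝ v x‖ ^ 2)) ≠ ⊤ := by
    finiteness
  refine (ENNReal.toReal_mono hne key).trans_eq ?_
  have : 0 ≤ ∫ x, (v x ^ 2 + ‖fderiv ℝ v x‖ ^ 2) := integral_nonneg fun x ↦ by positivity
  simp only [ENNReal.toReal_mul, ENNReal.toReal_ofNat, ENNReal.toReal_ofReal this]
  ring

theorem stmt10 :
    ∃ C : ℝ, 0 < C ∧
      ∀ K : Set Plane, IsCompact K → IsConnected K → μH[1] K < ⊤ → ahlforsConst K < ⊤ →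
        ∀ v₁ v₂ : Plane → ℝ, ContDiff ℝ 1 v₁ → HasCompactSupport v₁ →
          ContDiff ℝ 1 v₂ → HasCompactSupport v₂ →
          ∫ z in K, |v₁ z * v₂ z| ∂μH[1] ≤
            C * (ahlforsConst K).toReal *
              Real.sqrt (∫ x, ((v₁ x) ^ 2 + ‖gradient v₁ x‖ ^ 2)) *
              Real.sqrt (∫ x, ((v₂ x) ^ 2 + ‖gradient v₂ x‖ ^ 2)) := by
  refine ⟨16, by norm_num, fun K _ _ hK hΛ v₁ v₂ hv₁ hs₁ hv₂ hs₂ ↦ ?_⟩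
  have : IsFiniteMeasure ((μH[1] : Measure Plane).restrict K) := ⟨by simpa using hK⟩
  have hmem : ∀ v : Plane → ℝ, ContDiff ℝ 1 v → HasCompactSupport v →
      MemLp (fun z ↦ |v z|) (ENNReal.ofReal 2) ((μH[1] : Measure Plane).restrict K) :=
    fun v hv hs ↦ (hv.continuous.memLp_of_hasCompactSupport hs).abs
  have hcs := integral_mul_le_Lp_mul_Lq_of_nonneg Real.HolderConjugate.two_two
    (Filter.Eventually.of_forall fun z ↦ abs_nonneg (v₁ z))
    (Filter.Eventually.of_forall fun z ↦ abs_nonneg (v₂ z))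
    (hmem v₁ hv₁ hs₁) (hmem v₂ hv₂ hs₂)
  simp only [Real.rpow_two, sq_abs, ← Real.sqrt_eq_rpow, ← abs_mul] at hcs
  set L := (ahlforsConst K).toReal with hL
  have hL0 : 0 ≤ 16 * L := by positivity
  refine hcs.trans ?_
  calc _ ≤ √(16 * L * ∫ x, ((v₁ x) ^ 2 + ‖gradient v₁ x‖ ^ 2)) *
        √(16 * L * ∫ x, ((v₂ x) ^ 2 + ‖gradient v₂ x‖ ^ 2)) := by
        gcongr
        · exact setIntegral_sq_le hK hΛ hv₁ hs₁
        · exact setIntegral_sq_le hK hΛ hv₂ hs₂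
    _ = (√(16 * L) * √(16 * L)) * √(∫ x, ((v₁ x) ^ 2 + ‖gradient v₁ x‖ ^ 2)) *
        √(∫ x, ((v₂ x) ^ 2 + ‖gradient v₂ x‖ ^ 2)) := by
        rw [Real.sqrt_mul hL0, Real.sqrt_mul hL0]
        ring
    _ = _ := by rw [Real.mul_self_sqrt hL0]
end

section
/- Let Ω ⊆ ℝ² be open and bounded, K ⊆ closure(Ω) compact with H¹(K) < ∞, and let a, b, μ, ν, C_P, C_T > 0. Let v : ℝ² → ℝ be continuously differentiable with compact support contained in Ω, satisfying the Poincaré inequality ∫_Ω v² dx ≤ C_P ∫_Ω ‖∇v‖² dx and the trace inequality ∫_K v² dH¹ ≤ C_T ∫_Ω ‖∇v‖² dx, and let u : K → ℝ be H¹-measurable with ∫_K u² dH¹ < ∞. Then a ν ∫_Ω ‖∇v‖² dx + ∫_K (ν v − μ u)² dH¹ ≥ min( a/3 , a/(3 C_P) , a μ/(a + 3 C_T ν) ) · ( ν ∫_Ω (‖∇v‖² + v²) dx + μ ∫_K u² dH¹ ) (coercivity of the road–field bilinear form). -/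
open MeasureTheory Set
open scoped ENNReal NNReal

/-- A weighted Young inequality for the square of a difference. -/
lemma mul_sq_sub_mul_sq_le_sub_sq {a d : ℝ} (ha : 0 < a) (hd : 0 < d) (x y : ℝ) :
    a / (a + d) * y ^ 2 - a / d * x ^ 2 ≤ (x - y) ^ 2 := by
  have h : (x - y) ^ 2 - (a / (a + d) * y ^ 2 - a / d * x ^ 2) =
      ((a + d) * x - d * y) ^ 2 / (d * (a + d)) := by
    field_simp
    ring
  have : 0 ≤ ((a + d) * x - d * y) ^ 2 / (d * (a + d)) := by positivity
  linarith

/-- The integrated form of the weighted Young inequality for the square of a difference. -/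
lemma integral_mul_sq_sub_le_integral_sub_sq {α : Type*} [MeasurableSpace α] {m : Measure α}
    {f g : α → ℝ} (hf : MemLp f 2 m) (hg : MemLp g 2 m) {a d : ℝ} (ha : 0 < a) (hd : 0 < d)
    (μ ν : ℝ) :
    a / (a + d) * (μ ^ 2 * ∫ z, g z ^ 2 ∂m) - a / d * (ν ^ 2 * ∫ z, f z ^ 2 ∂m) ≤
      ∫ z, (ν * f z - μ * g z) ^ 2 ∂m := by
  have hfi := (hf.integrable_sq.const_mul (ν ^ 2)).const_mul (a / d)
  have hgi := (hg.integrable_sq.const_mul (μ ^ 2)).const_mul (a / (a + d))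
  simp only [← integral_const_mul]
  rw [← integral_sub hgi hfi]
  refine integral_mono (hgi.sub hfi) ((hf.const_mul ν).sub (hg.const_mul μ)).integrable_sq
    fun z => ?_
  simpa only [mul_pow] using mul_sq_sub_mul_sq_le_sub_sq ha hd (ν * f z) (μ * g z)

theorem stmt11 (Ω : Set Plane) (hΩo : IsOpen Ω) (hΩb : Bornology.IsBounded Ω)
    (K : Set Plane) (hK : K ⊆ closure Ω) (hKc : IsCompact K) (hKfin : μH[1] K < ⊤)
    (a b μ ν Cp Ct : ℝ) (ha : 0 < a) (hb : 0 < b) (hμ : 0 < μ) (hν : 0 < ν)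
    (hCp : 0 < Cp) (hCt : 0 < Ct)
    (v : Plane → ℝ) (hv : ContDiff ℝ 1 v) (hvsupp : HasCompactSupport v)
    (hvΩ : tsupport v ⊆ Ω)
    (hPoincare : ∫ x in Ω, (v x) ^ 2 ≤ Cp * ∫ x in Ω, ‖gradient v x‖ ^ 2)
    (hTrace : ∫ z in K, (v z) ^ 2 ∂μH[1] ≤ Ct * ∫ x in Ω, ‖gradient v x‖ ^ 2)
    (u : Plane → ℝ) (humeas : AEMeasurable u (μH[1].restrict K))
    (huint : Integrable (fun z => (u z) ^ 2) (μH[1].restrict K)) :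
    a * ν * (∫ x in Ω, ‖gradient v x‖ ^ 2) + ∫ z in K, (ν * v z - μ * u z) ^ 2 ∂μH[1] ≥
      min (min (a / 3) (a / (3 * Cp))) (a * μ / (a + 3 * Ct * ν)) *
        (ν * (∫ x in Ω, (‖gradient v x‖ ^ 2 + (v x) ^ 2)) +
          μ * ∫ z in K, (u z) ^ 2 ∂μH[1]) := by
  have : IsFiniteMeasure (μH[1].restrict K : Measure Plane) :=
    isFiniteMeasure_restrict.2 hKfin.ne
  have hvK : MemLp v 2 (μH[1].restrict K) :=
    hv.continuous.memLp_of_hasCompactSupport hvsupp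
  have huK : MemLp u 2 (μH[1].restrict K) :=
    (memLp_two_iff_integrable_sq humeas.aestronglyMeasurable).2 huint
  have hgrad : ∀ x, ‖gradient v x‖ = ‖fderiv ℝ v x‖ := fun x => by simp [gradient]
  have hgi : IntegrableOn (fun x => ‖gradient v x‖ ^ 2) Ω := by
    simp only [hgrad]
    have hc : MemLp (fderiv ℝ v) 2 (volume : Measure Plane) :=
      (hv.continuous_fderiv one_ne_zero).memLp_of_hasCompactSupport (hvsupp.fderiv ℝ)
    exact hc.norm.integrable_sq.integrableOn
  have hvi : IntegrableOn (fun x => v x ^ 2) Ω :=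
    MemLp.integrable_sq (μ := volume.restrict Ω)
      (hv.continuous.memLp_of_hasCompactSupport hvsupp)
  have hd : 0 < 3 * Ct * ν := by positivity
  have hyoung := integral_mul_sq_sub_le_integral_sub_sq hvK huK ha hd μ ν
  have hG : 0 ≤ ∫ x in Ω, ‖gradient v x‖ ^ 2 := integral_nonneg fun _ => by positivity
  have hV : 0 ≤ ∫ x in Ω, v x ^ 2 := integral_nonneg fun _ => by positivity
  have hU : 0 ≤ ∫ z in K, u z ^ 2 ∂μH[1] := integral_nonneg fun _ => by positivity
  rw [integral_add hgi hvi]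
  set k := min (min (a / 3) (a / (3 * Cp))) (a * μ / (a + 3 * Ct * ν))
  have hk₁ : k ≤ a / 3 := (min_le_left _ _).trans (min_le_left _ _)
  have hk₂ : k ≤ a / (3 * Cp) := (min_le_left _ _).trans (min_le_right _ _)
  have hk₃ : k ≤ a * μ / (a + 3 * Ct * ν) := min_le_right _ _
  generalize (∫ x in Ω, ‖gradient v x‖ ^ 2) = G at *
  generalize (∫ x in Ω, v x ^ 2) = V at *
  generalize (∫ z in K, u z ^ 2 ∂μH[1]) = U at *
  generalize (∫ z in K, v z ^ 2 ∂μH[1]) = T at *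
  have hkG : k * (ν * G) ≤ a / 3 * (ν * G) := by gcongr
  have hkV : k * (ν * V) ≤ a / 3 * (ν * G) := calc
    k * (ν * V) ≤ a / (3 * Cp) * (ν * (Cp * G)) := by gcongr
    _ = a / 3 * (ν * G) := by field_simp
  have hkU : k * (μ * U) ≤ a / (a + 3 * Ct * ν) * (μ ^ 2 * U) := calc
    k * (μ * U) ≤ a * μ / (a + 3 * Ct * ν) * (μ * U) := by gcongr
    _ = a / (a + 3 * Ct * ν) * (μ ^ 2 * U) := by ring
  have hT : a / (3 * Ct * ν) * (ν ^ 2 * T) ≤ a / 3 * (ν * G) := calc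
    a / (3 * Ct * ν) * (ν ^ 2 * T) ≤ a / (3 * Ct * ν) * (ν ^ 2 * (Ct * G)) := by gcongr
    _ = a / 3 * (ν * G) := by field_simp
  linarith
end

section
/- Let Ω ⊆ ℝ² be open and bounded, K ⊆ closure(Ω) compact with H¹(K) < ∞, and let a, μ, ν, C_P, C_T > 0. Set α := (a + C_T ν + C_P μ)/(2a) − sqrt( ((a + C_T ν + C_P μ)/(2a))² − C_P μ / a ). Let v : ℝ² → ℝ be continuously differentiable with compact support contained in Ω, satisfying ∫_Ω v² dx ≤ C_P ∫_Ω ‖∇v‖² dx and ∫_K v² dH¹ ≤ C_T ∫_Ω ‖∇v‖² dx, and let u : K → ℝ be H¹-measurable with ∫_K u² dH¹ < ∞. Then a ν ∫_Ω ‖∇v‖² dx + ∫_K (ν v − μ u)² dH¹ ≥ (a α / C_P) · ( ν ∫_Ω v² dx + μ ∫_K u² dH¹ ); in particular the first eigenvalue λ₁ of the road–field bilinear form is bounded below by a α / C_P > 0. -/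
open MeasureTheory Set
open scoped ENNReal NNReal

/-- The smaller root of `x² - (1 + c + q) x + q`, where `c, q > 0`, lies strictly between `0` and
`min 1 q`; here `p` is half the sum of the two roots. -/
theorem smaller_root_spec {c q p α : ℝ} (hc : 0 < c) (hq : 0 < q) (hp : 2 * p = 1 + c + q)
    (hα : α = p - Real.sqrt (p ^ 2 - q)) :
    0 < α ∧ α < q ∧ (1 - α) * (q - α) = c * α := by
  have hdisc : 0 ≤ p ^ 2 - q := by nlinarith [sq_nonneg (1 - q), mul_pos hc hq]
  have hsq := Real.sq_sqrt hdisc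
  have hroot : (1 - α) * (q - α) = c * α := by
    rw [hα]; linear_combination hsq + (p - Real.sqrt (p ^ 2 - q)) * hp
  have hpos : 0 < α := by
    have : Real.sqrt (p ^ 2 - q) < p := (Real.sqrt_lt' (by linarith)).2 (by linarith)
    linarith
  have hle : α ≤ p := by linarith [Real.sqrt_nonneg (p ^ 2 - q)]
  refine ⟨hpos, ?_, hroot⟩
  by_contra! h
  have h1 : 1 < α := by
    by_contra! h1
    nlinarith [mul_pos hc hpos, mul_nonneg (sub_nonneg.2 h1) (sub_nonneg.2 h)]
  nlinarith [mul_pos hc hpos, mul_nonneg (sub_nonneg.2 h1.le) (sub_nonneg.2 h)]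

/-- Weighted Young inequality for the square of a difference. -/
theorem sq_sub_ge_of_lt {α q : ℝ} (hα : 0 < α) (hαq : α < q) (x y : ℝ) :
    α / q * y ^ 2 - α / (q - α) * x ^ 2 ≤ (x - y) ^ 2 := by
  have hq : 0 < q := hα.trans hαq
  have hd : 0 < q - α := sub_pos.2 hαq
  have key : (x - y) ^ 2 - (α / q * y ^ 2 - α / (q - α) * x ^ 2) =
      (q * x - (q - α) * y) ^ 2 / (q * (q - α)) := by
    field_simp
    ring
  have : 0 ≤ (q * x - (q - α) * y) ^ 2 / (q * (q - α)) := by positivity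
  linarith

/-- Integrated form of `sq_sub_ge_of_lt`. -/
theorem integral_sq_sub_ge_of_lt {X : Type*} [MeasurableSpace X] {m : Measure X} {f g : X → ℝ}
    (hf : MemLp f 2 m) (hg : MemLp g 2 m) {α q : ℝ} (hα : 0 < α) (hαq : α < q) :
    α / q * ∫ x, g x ^ 2 ∂m - α / (q - α) * ∫ x, f x ^ 2 ∂m ≤ ∫ x, (f x - g x) ^ 2 ∂m := by
  have hf2 := hf.integrable_sq.const_mul (α / (q - α))
  have hg2 := hg.integrable_sq.const_mul (α / q)
  rw [← integral_const_mul, ← integral_const_mul, ← integral_sub hg2 hf2]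
  exact integral_mono (hg2.sub hf2) (hf.sub hg).integrable_sq
    fun x => sq_sub_ge_of_lt hα hαq (f x) (g x)

theorem stmt12 (Ω : Set Plane) (hΩo : IsOpen Ω) (hΩb : Bornology.IsBounded Ω)
    (K : Set Plane) (hK : K ⊆ closure Ω) (hKc : IsCompact K) (hKfin : μH[1] K < ⊤)
    (a μ ν Cp Ct : ℝ) (ha : 0 < a) (hμ : 0 < μ) (hν : 0 < ν)
    (hCp : 0 < Cp) (hCt : 0 < Ct)
    (α : ℝ)
    (hα : α = (a + Ct * ν + Cp * μ) / (2 * a) -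
      Real.sqrt (((a + Ct * ν + Cp * μ) / (2 * a)) ^ 2 - Cp * μ / a))
    (v : Plane → ℝ) (hv : ContDiff ℝ 1 v) (hvsupp : HasCompactSupport v)
    (hvΩ : tsupport v ⊆ Ω)
    (hPoincare : ∫ x in Ω, (v x) ^ 2 ≤ Cp * ∫ x in Ω, ‖gradient v x‖ ^ 2)
    (hTrace : ∫ z in K, (v z) ^ 2 ∂μH[1] ≤ Ct * ∫ x in Ω, ‖gradient v x‖ ^ 2)
    (u : Plane → ℝ) (humeas : AEMeasurable u (μH[1].restrict K))
    (huint : Integrable (fun z => (u z) ^ 2) (μH[1].restrict K)) :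
    0 < a * α / Cp ∧
    a * ν * (∫ x in Ω, ‖gradient v x‖ ^ 2) + ∫ z in K, (ν * v z - μ * u z) ^ 2 ∂μH[1] ≥
      a * α / Cp *
        (ν * (∫ x in Ω, (v x) ^ 2) + μ * ∫ z in K, (u z) ^ 2 ∂μH[1]) := by
  obtain ⟨hα0, hαq, hroot⟩ := smaller_root_spec (c := Ct * ν / a) (q := Cp * μ / a)
    (by positivity) (by positivity) (by field_simp) hα
  refine ⟨by positivity, ?_⟩
  have : IsFiniteMeasure (μH[1].restrict K : Measure Plane) := ⟨by simpa using hKfin⟩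
  obtain ⟨B, hB⟩ := hvsupp.exists_bound_of_continuous hv.continuous
  have hvLp : MemLp v 2 (μH[1].restrict K) :=
    MemLp.of_bound hv.continuous.aestronglyMeasurable B (.of_forall hB)
  have huLp : MemLp u 2 (μH[1].restrict K) :=
    (memLp_two_iff_integrable_sq humeas.aestronglyMeasurable).2 huint
  have hyoung := integral_sq_sub_ge_of_lt (hvLp.const_mul ν) (huLp.const_mul μ) hα0 hαq
  simp only [mul_pow, integral_const_mul] at hyoung
  set q := Cp * μ / a with hq
  set G := ∫ x in Ω, ‖gradient v x‖ ^ 2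
  set V := ∫ x in Ω, v x ^ 2
  set T := ∫ z in K, v z ^ 2 ∂μH[1]
  set U := ∫ z in K, u z ^ 2 ∂μH[1]
  have hd : 0 < q - α := sub_pos.2 hαq
  have hV : a * α / Cp * (ν * V) ≤ a * α * ν * G :=
    calc a * α / Cp * (ν * V) ≤ a * α / Cp * (ν * (Cp * G)) := by gcongr
      _ = a * α * ν * G := by field_simp
  have hT : α / (q - α) * (ν ^ 2 * T) ≤ a * (1 - α) * ν * G := by
    have hcoef : α / (q - α) * (ν * Ct) = a * (1 - α) := by
      rw [div_mul_eq_mul_div, div_eq_iff hd.ne', mul_assoc, hroot]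
      field_simp
    calc α / (q - α) * (ν ^ 2 * T) ≤ α / (q - α) * (ν ^ 2 * (Ct * G)) := by gcongr
      _ = α / (q - α) * (ν * Ct) * (ν * G) := by ring
      _ = a * (1 - α) * ν * G := by rw [hcoef]; ring
  have hU : α / q * (μ ^ 2 * U) = a * α / Cp * (μ * U) := by
    rw [hq]; field_simp
  rw [ge_iff_le, mul_add]
  linarith
end
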